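/- arXiv:2212.05318 — 4 statements merged into one kernel-verified Lean document; each statement's English description precedes it below -/
import Mathlib

section
/- There exists a maximal cofinitary group G ≤ S∞ which is isomorphic, as a group, to the free group on a set of the cardinality of the continuum (equivalently, to the free group on the set ℕ → Bool). -/
/-- A subgroup of `S∞ = Equiv.Perm ℕ` is cofinitary if every non-identity element has only
finitely many fixed points. -/
def IsCofinitary (G : Subgroup (Equiv.Perm ℕ)) : Prop :=
  ∀ g ∈ G, g ≠ 1 → {n : ℕ | g n = n}.Finite

/-- A cofinitary group is maximal if it is not strictly contained in any cofinitary group. -/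
def IsMaximalCofinitary (G : Subgroup (Equiv.Perm ℕ)) : Prop :=
  IsCofinitary G ∧ ∀ H : Subgroup (Equiv.Perm ℕ), IsCofinitary H → G ≤ H → G = H

open Equiv

namespace MCG

theorem word_lemma {X : Type*} (w : FreeGroup X) (hw : w ≠ 1) :
    ∃ (c : FreeGroup X) (n : ℕ) (a : ℕ → X × Bool) (π : ℕ → FreeGroup X),
      0 < n ∧ (∀ i, a (i + n) = a i) ∧ π 0 = 1 ∧ (∀ i, π (i+1) = π i * FreeGroup.mk [a i]) ∧
      π n = c⁻¹ * w * c ∧ (∀ i j, i < j → π i ≠ π j) ∧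
      (∀ i, (a i).1 = (a (i+1)).1 → (a i).2 = (a (i+1)).2) := by
  classical
  set L := FreeGroup.reduceCyclically w.toWord with hL
  have hcr : FreeGroup.IsCyclicallyReduced L :=
    FreeGroup.reduceCyclically.isCyclicallyReduced FreeGroup.isReduced_toWord
  have hconj := FreeGroup.reduceCyclically.conj_conjugator_reduceCyclically w.toWord
  set C := FreeGroup.reduceCyclically.conjugator w.toWord
  have hw2 : w = FreeGroup.mk C * FreeGroup.mk L * (FreeGroup.mk C)⁻¹ := by
    rw [FreeGroup.inv_mk, FreeGroup.mul_mk, FreeGroup.mul_mk, hL, hconj, FreeGroup.mk_toWord]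
  have hne : L ≠ [] := by
    intro h
    apply hw
    rw [hw2, h, ← FreeGroup.one_eq_mk, mul_one, mul_inv_cancel]
  have hn : 0 < L.length := List.length_pos_iff.2 hne
  let a : ℕ → X × Bool := fun i => L[i % L.length]'(Nat.mod_lt _ hn)
  have hadj : ∀ i, (a i).1 = (a (i+1)).1 → (a i).2 = (a (i+1)).2 := by
    intro i
    have hlt := Nat.mod_lt i hn
    by_cases h : i % L.length + 1 < L.length
    · have h1 : (i+1) % L.length = i % L.length + 1 := by
        rw [Nat.add_mod, Nat.mod_eq_of_lt (a := 1) (by omega), Nat.mod_eq_of_lt h]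
      simp only [a, h1]
      exact (List.isChain_iff_getElem.1 hcr.1) _ h
    · have h0 : i % L.length + 1 = L.length := by omega
      have h1 : (i+1) % L.length = 0 := by
        rw [← Nat.mod_add_mod, h0, Nat.mod_self]
      have h2 : i % L.length = L.length - 1 := by omega
      simp only [a, h1, h2]
      apply hcr.2
      · rw [Option.mem_def, List.getLast?_eq_getElem?]; simp [hn]
      · rw [Option.mem_def, List.head?_eq_getElem?]; simp [hn]
  let π : ℕ → FreeGroup X := fun i => FreeGroup.mk ((List.range i).map a)
  have hπ : ∀ i, π (i+1) = π i * FreeGroup.mk [a i] := by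
    intro i; simp [π, List.range_succ, FreeGroup.mul_mk]
  have hseg : ∀ i l, π (i + l) = π i * FreeGroup.mk ((List.range' i l).map a) := by
    intro i l
    induction l with
    | zero => simp [← FreeGroup.one_eq_mk]
    | succ l ih =>
      rw [← add_assoc, hπ, ih, mul_assoc, FreeGroup.mul_mk, List.range'_concat]; simp
  refine ⟨FreeGroup.mk C, L.length, a, π, hn, ?_, ?_, hπ, ?_, ?_, hadj⟩
  · intro i; simp [a]
  · simp [π, ← FreeGroup.one_eq_mk]
  · have : π L.length = FreeGroup.mk L := by
      simp only [π]; congr 1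
      apply List.ext_getElem
      · simp
      · intro i h1 h2
        simp [a, Nat.mod_eq_of_lt h2]
    rw [this, hw2]; group
  · intro i j hij h
    obtain ⟨l, rfl⟩ := Nat.exists_eq_add_of_lt hij
    rw [add_assoc, hseg] at h
    have h1 : FreeGroup.mk ((List.range' i (l+1)).map a) = 1 := by
      simpa using h
    have hred : FreeGroup.IsReduced ((List.range' i (l+1)).map a) := by
      rw [FreeGroup.IsReduced, List.isChain_iff_getElem]
      intro k hk
      simp only [List.getElem_map, List.getElem_range', one_mul]
      exact hadj _
    have := FreeGroup.toWord_eq_nil_iff.2 h1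
    rw [FreeGroup.toWord_mk, hred.reduce_eq] at this
    simp at this

theorem sparse (A : Set ℕ) (hA : A.Infinite) (f : ℕ → ℕ) :
    ∃ B ⊆ A, B.Infinite ∧ ∀ k ∈ B, ∀ k' ∈ B, k < k' → f k < k' := by
  choose g hg using fun m => hA.exists_gt m
  let b : ℕ → ℕ := fun i => Nat.rec (g 0) (fun _ m => g (m + f m)) i
  have hb : ∀ i, b (i+1) = g (b i + f (b i)) := fun _ => rfl
  have hbA : ∀ i, b i ∈ A := by
    intro i; cases i with
    | zero => exact (hg 0).1
    | succ i => rw [hb]; exact (hg _).1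
  have hlt : ∀ i, b i + f (b i) < b (i+1) := fun i => by rw [hb]; exact (hg _).2
  have hmono : StrictMono b := strictMono_nat_of_lt_succ fun i => by have := hlt i; omega
  refine ⟨Set.range b, ?_, Set.infinite_range_of_injective hmono.injective, ?_⟩
  · rintro _ ⟨i, rfl⟩; exact hbA i
  · rintro _ ⟨i, rfl⟩ _ ⟨j, rfl⟩ h
    have h1 : i < j := hmono.lt_iff_lt.1 h
    have h2 : b (i+1) ≤ b j := hmono.monotone h1
    have := hlt i; omega

theorem exists_sigma {Ω : Type*} (lev : Ω → ℕ) (B : Set ℕ) (p d : ℕ → Ω)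
    (hp : ∀ k ∈ B, lev (p k) = k) (hd : ∀ k ∈ B, k ≤ lev (d k))
    (hs : ∀ k ∈ B, ∀ k' ∈ B, k < k' → lev (d k) < k') :
    ∃ σ : Perm Ω, (∀ q, σ (σ q) = q) ∧ (∀ k ∈ B, σ (p k) = d k) ∧
      (∀ q, σ q ≠ q → ∃ k ∈ B, (q = p k ∧ σ q = d k) ∨ (q = d k ∧ σ q = p k)) := by
  classical
  have u1 : ∀ k ∈ B, ∀ k' ∈ B, p k = p k' → k = k' := by
    intro k hk k' hk' h; rw [← hp k hk, ← hp k' hk', h]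
  have u2 : ∀ k ∈ B, ∀ k' ∈ B, d k = d k' → k = k' := by
    intro k hk k' hk' h
    have a1 := hs k hk k' hk'
    have a2 := hs k' hk' k hk
    have a3 := hd k hk
    have a4 := hd k' hk'
    rw [h] at a1 a3
    by_contra hne
    rcases lt_or_gt_of_ne hne with h' | h'
    · have := a1 h'; omega
    · have := a2 h'; omega
  have u3 : ∀ k ∈ B, ∀ k' ∈ B, p k = d k' → k = k' := by
    intro k hk k' hk' h
    have a2 := hs k' hk' k hk
    have a4 := hd k' hk'
    rw [← h, hp k hk] at a2 a4
    by_contra hne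
    have : k' < k := by omega
    have := a2 this; omega
  let f : Ω → Ω := fun q => if h : ∃ k ∈ B, q = p k then d h.choose
    else if h : ∃ k ∈ B, q = d k then p h.choose else q
  have f1 : ∀ k ∈ B, f (p k) = d k := by
    intro k hk
    have h : ∃ k' ∈ B, p k = p k' := ⟨k, hk, rfl⟩
    simp only [f, dif_pos h]
    exact congrArg d (u1 k hk _ h.choose_spec.1 h.choose_spec.2).symm
  have f2 : ∀ k ∈ B, f (d k) = p k := by
    intro k hk
    by_cases h' : ∃ k' ∈ B, d k = p k'
    · obtain ⟨k', hk', e⟩ := h'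
      have := u3 k' hk' k hk e.symm
      subst this
      rw [e, f1 _ hk, e]
    · have h : ∃ k' ∈ B, d k = d k' := ⟨k, hk, rfl⟩
      simp only [f, dif_neg h', dif_pos h]
      exact congrArg p (u2 k hk _ h.choose_spec.1 h.choose_spec.2).symm
  have f3 : ∀ q, (∃ k ∈ B, q = p k) ∨ (∃ k ∈ B, q = d k) ∨ f q = q := by
    intro q
    by_cases h1 : ∃ k ∈ B, q = p k
    · exact Or.inl h1
    by_cases h2 : ∃ k ∈ B, q = d k
    · exact Or.inr (Or.inl h2)
    · right; right; simp only [f, dif_neg h1, dif_neg h2]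
  have finv : Function.Involutive f := by
    intro q
    rcases f3 q with ⟨k, hk, rfl⟩ | ⟨k, hk, rfl⟩ | h
    · rw [f1 k hk, f2 k hk]
    · rw [f2 k hk, f1 k hk]
    · rw [h, h]
  refine ⟨finv.toPerm, finv, f1, ?_⟩
  intro q hq
  rcases f3 q with ⟨k, hk, rfl⟩ | ⟨k, hk, rfl⟩ | h
  · exact ⟨k, hk, Or.inl ⟨rfl, f1 k hk⟩⟩
  · exact ⟨k, hk, Or.inr ⟨rfl, f2 k hk⟩⟩
  · exact absurd h hq

theorem path_contra {X Ω : Type*} (lev : Ω → ℕ) (β : FreeGroup X →* Perm Ω)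
    (hβ : ∀ w q, lev (β w q) = lev q)
    (B : X → Set ℕ) (p d : X → ℕ → Ω)
    (hp : ∀ x, ∀ k ∈ B x, lev (p x k) = k) (hd : ∀ x, ∀ k ∈ B x, k ≤ lev (d x k))
    (n : ℕ) (hn : 0 < n) (y : ℕ → X) (m : ℕ → FreeGroup X) (z z' : ℕ → Ω)
    (hyper : ∀ i, y (i + n) = y i) (hzper : ∀ i, z (i + n) = z i)
    (hstep : ∀ i, z (i+1) = β ((m (i+1))⁻¹ * m i) (z' i))
    (hmod : ∀ i, z' i ≠ z i → ∃ k ∈ B (y i), (z i = p (y i) k ∧ z' i = d (y i) k) ∨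
      (z i = d (y i) k ∧ z' i = p (y i) k))
    (K : ℕ) (hK : ∀ i, K ≤ lev (z i))
    (F : ∀ i j, i < j → j < 5 * n → y i = y j → ∀ q, K ≤ lev q → β ((m j)⁻¹ * m i) q ≠ q)
    (S : ∀ i j l, i < 5 * n → j < 5 * n → l < 5 * n → ∀ k, K ≤ k → k ∈ B (y l) →
      β ((m j)⁻¹ * m i) (p (y l) k) ≠ d (y l) k)
    (O : ∀ i j, i < 5 * n → j < 5 * n → ∀ k, K ≤ k → k ∈ B (y i) → k ∈ B (y j) → y i = y j) :
    False := by
  have hlev : ∀ i, lev (z (i+1)) = lev (z' i) := fun i => by rw [hstep, hβ]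
  -- the minimal level
  obtain ⟨i1, hi1⟩ : ∃ i1, ∀ i, lev (z i1) ≤ lev (z i) := by
    have hex : ∃ k, ∃ i, lev (z i) = k := ⟨_, 0, rfl⟩
    classical
    obtain ⟨i, hi⟩ := Nat.find_spec hex
    exact ⟨i, fun j => by rw [hi]; exact Nat.find_min' hex ⟨j, rfl⟩⟩
  have hmod' : ∀ i, z (i % n) = z i := by
    have : Function.Periodic z n := hzper
    exact fun i => this.map_mod_nat i
  obtain ⟨k, i0, hi0n, hi0, hmin⟩ : ∃ k i0, i0 < n ∧ lev (z i0) = k ∧ ∀ i, k ≤ lev (z i) :=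
    ⟨lev (z i1), i1 % n, Nat.mod_lt _ hn, by rw [hmod'], hi1⟩
  have hmin' : ∀ i, k ≤ lev (z' i) := fun i => by rw [← hlev]; exact hmin _
  have hKk : K ≤ k := hi0 ▸ hK i0
  have leave : ∀ i, i + n < 5 * n → lev (z i) = k →
      ∃ j, i ≤ j ∧ j < i + n ∧ z' j ≠ z j ∧ z j = β ((m j)⁻¹ * m i) (z i) := by
    intro i hi hk
    have key : ∀ t, (∃ j, i ≤ j ∧ j < i + t ∧ z' j ≠ z j ∧ z j = β ((m j)⁻¹ * m i) (z i)) ∨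
        z (i + t) = β ((m (i+t))⁻¹ * m i) (z i) := by
      intro t
      induction t with
      | zero => right; simp
      | succ t ih =>
        rcases ih with ⟨j, h1, h2, h3⟩ | ih
        · exact Or.inl ⟨j, h1, by omega, h3⟩
        · by_cases h : z' (i+t) = z (i+t)
          · right
            rw [← add_assoc, hstep, h, ih, ← Perm.mul_apply, ← map_mul]
            congr 2; group
          · exact Or.inl ⟨i+t, by omega, by omega, h, ih⟩
    rcases key n with h | h
    · exact h
    · exfalso
      rw [hzper] at h
      exact F i (i+n) (by omega) hi (hyper i).symm (z i) (hK i) h.symm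
  obtain ⟨j0, hj1, hj2, hj3, hj4⟩ := leave i0 (by omega) hi0
  have hj5 : lev (z j0) = k := by rw [hj4, hβ, hi0]
  obtain ⟨t, ht1, ht2, ht3⟩ : ∃ t, t < 2 * n + n ∧ lev (z' t) = k ∧ z' t ≠ z t := by
    classical
    have hex : ∃ s, lev (z' (j0 + s)) = k := by
      refine ⟨n - 1, ?_⟩
      rw [← hlev, show j0 + (n-1) + 1 = j0 + n by omega, hzper, hj5]
    have hs := Nat.find_spec hex
    have hle : Nat.find hex ≤ n - 1 := by
      apply Nat.find_min'
      rw [← hlev, show j0 + (n-1) + 1 = j0 + n by omega, hzper, hj5]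
    have hm : ∀ s, s < Nat.find hex → lev (z' (j0 + s)) ≠ k := fun s h => Nat.find_min hex h
    generalize Nat.find hex = s at hs hle hm
    refine ⟨j0 + s, by omega, hs, ?_⟩
    rcases s with _ | s
    · simpa using hj3
    · intro h
      apply hm s (by omega)
      rw [← hlev, add_assoc, ← h, hs]
  obtain ⟨j, h1, h2, h3, h4⟩ := leave (t+1) (by omega) (by rw [hlev, ht2])
  have h5 : z j = β ((m j)⁻¹ * m t) (z' t) := by
    rw [h4, hstep, ← Perm.mul_apply, ← map_mul]
    congr 2; group
  have h6 : lev (z j) = k := by rw [h5, hβ, ht2]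
  obtain ⟨κ, hκ, c1⟩ := hmod t ht3
  obtain ⟨κ', hκ', c2⟩ := hmod j h3
  have e1 : κ = k := by
    have a1 := hp _ _ hκ
    have a2 := hd _ _ hκ
    have a3 := hmin t
    have a4 := hmin' t
    rcases c1 with ⟨r1, r2⟩ | ⟨r1, r2⟩
    · rw [← r1] at a1; rw [← r2] at a2; omega
    · rw [← r2] at a1; omega
  have e2 : κ' = k := by
    have a1 := hp _ _ hκ'
    have a2 := hd _ _ hκ'
    have a3 := hmin j
    have a4 := hmin' j
    rcases c2 with ⟨r1, r2⟩ | ⟨r1, r2⟩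
    · rw [← r1] at a1; omega
    · rw [← r2] at a1; rw [← r1] at a2; omega
  subst e1; subst e2
  have ey := O t j (by omega) (by omega) κ' hKk hκ hκ'
  rw [← ey] at c2
  have hF := F t j (by omega) (by omega) ey (z' t) (by rw [ht2]; exact hKk)
  have hS1 := S t j t (by omega) (by omega) (by omega) κ' hKk hκ
  have hS2 := S j t t (by omega) (by omega) (by omega) κ' hKk hκ
  have h7 : z' t = β ((m t)⁻¹ * m j) (z j) := by
    rw [h5, ← Perm.mul_apply, ← map_mul]
    have : (m t)⁻¹ * m j * ((m j)⁻¹ * m t) = 1 := by group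
    rw [this]; simp
  rcases c1 with ⟨_, r1⟩ | ⟨_, r1⟩ <;> rcases c2 with ⟨r2, _⟩ | ⟨r2, _⟩
  · rw [r1, r2] at h7; exact hS2 h7.symm
  · rw [← h5, r1, r2] at hF; exact hF rfl
  · rw [← h5, r1, r2] at hF; exact hF rfl
  · rw [r1, r2] at h5; exact hS1 h5.symm

open Filter in
theorem cofin {X Ω : Type*} (lev : Ω → ℕ) (hfin : ∀ k, {q | lev q < k}.Finite)
    (β : FreeGroup X →* Perm Ω)
    (hβ : ∀ w q, lev (β w q) = lev q)
    (hfree : ∀ w, w ≠ 1 → ∀ᶠ k in atTop, ∀ q, lev q = k → β w q ≠ q)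
    (B : X → Set ℕ) (p d : X → ℕ → Ω)
    (hp : ∀ x, ∀ k ∈ B x, lev (p x k) = k) (hd : ∀ x, ∀ k ∈ B x, k ≤ lev (d x k))
    (hS : ∀ x w, ∀ᶠ k in atTop, k ∈ B x → β w (p x k) ≠ d x k)
    (hO : ∀ x y, x ≠ y → ∀ᶠ k in atTop, ¬ (k ∈ B x ∧ k ∈ B y))
    (σ : X → Perm Ω) (hσ : ∀ x q, σ x (σ x q) = q)
    (hmod : ∀ x q, σ x q ≠ q → ∃ k ∈ B x, (q = p x k ∧ σ x q = d x k) ∨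
      (q = d x k ∧ σ x q = p x k))
    (w : FreeGroup X) (hw : w ≠ 1) :
    {q | FreeGroup.lift (fun x => β (FreeGroup.of x) * σ x) w q = q}.Finite := by
  obtain ⟨c, n, a, π, hn, hper, hπ0, hπ, hπn, hinj, hadj⟩ := word_lemma w hw
  set Φ := FreeGroup.lift (fun x => β (FreeGroup.of x) * σ x) with hΦ
  have hσi : ∀ x, (σ x)⁻¹ = σ x := by
    intro x; ext q; rw [Perm.inv_eq_iff_eq, hσ]
  -- reduce to the conjugate
  suffices h : {q | Φ (π n) q = q}.Finite by
    refine (h.image (Φ c)).subset ?_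
    intro q hq
    refine ⟨(Φ c)⁻¹ q, ?_, by simp⟩
    have hq' : Φ w q = q := hq
    simp [hπn, hq']
  let m : ℕ → FreeGroup X := fun i => if (a i).2 then π (i+1) else π i
  let y : ℕ → X := fun i => (a i).1
  have hπper : ∀ i, π (i + n) = π n * π i := by
    intro i
    induction i with
    | zero => simp [hπ0]
    | succ i ih => rw [show i + 1 + n = i + n + 1 by omega, hπ, hπ, ih, hper, mul_assoc]
  have hmper : ∀ i, m (i + n) = π n * m i := by
    intro i
    simp only [m, hper]
    split_ifs
    · rw [show i + n + 1 = i + 1 + n by omega, hπper]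
    · rw [hπper]
  have hinj' : ∀ i j, π i = π j → i = j := by
    intro i j h
    by_contra hne
    rcases lt_or_gt_of_ne hne with h' | h'
    · exact hinj _ _ h' h
    · exact hinj _ _ h' h.symm
  have hm : ∀ i j, i < j → y i = y j → (m j)⁻¹ * m i ≠ 1 := by
    intro i j hij hy h
    have h : m i = m j := by rw [inv_mul_eq_one] at h; exact h.symm
    simp only [m] at h
    by_cases h1 : (a i).2 = true <;> by_cases h2 : (a j).2 = true
    · simp only [h1, h2, if_true] at h
      have := hinj' _ _ h; omega
    · simp only [h1, h2, if_true] at h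
      have := hinj' _ _ h
      subst this
      have := hadj i hy
      rw [h1] at this; exact h2 this.symm
    · simp only [h1, h2, if_true] at h
      have := hinj' _ _ h; omega
    · simp only [h1, h2] at h
      have := hinj' _ _ h; omega
  -- the threshold
  have E1 : ∀ᶠ k in atTop, ∀ i ∈ Finset.range (5*n), ∀ j ∈ Finset.range (5*n), i < j → y i = y j →
      ∀ q, lev q = k → β ((m j)⁻¹ * m i) q ≠ q := by
    simp only [Filter.eventually_all_finset]
    intro i _ j _
    by_cases h : i < j ∧ y i = y j
    · filter_upwards [hfree _ (hm i j h.1 h.2)] with k hk _ _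
      exact hk
    · exact Eventually.of_forall fun k h1 h2 => absurd ⟨h1, h2⟩ h
  have E2 : ∀ᶠ k in atTop, ∀ i ∈ Finset.range (5*n), ∀ j ∈ Finset.range (5*n),
      ∀ l ∈ Finset.range (5*n), k ∈ B (y l) → β ((m j)⁻¹ * m i) (p (y l) k) ≠ d (y l) k := by
    simp only [Filter.eventually_all_finset]
    intro i _ j _ l _
    exact hS _ _
  have E3 : ∀ᶠ k in atTop, ∀ i ∈ Finset.range (5*n), ∀ j ∈ Finset.range (5*n),
      k ∈ B (y i) → k ∈ B (y j) → y i = y j := by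
    simp only [Filter.eventually_all_finset]
    intro i _ j _
    by_cases h : y i = y j
    · exact Eventually.of_forall fun _ _ _ => h
    · filter_upwards [hO _ _ h] with k hk h1 h2
      exact absurd ⟨h1, h2⟩ hk
  obtain ⟨K, hK⟩ := eventually_atTop.1 (E1.and (E2.and E3))
  -- points
  let Z : ℕ → Perm Ω := fun i => β ((m i)⁻¹ * π i) * (Φ (π i))⁻¹
  have hbad : (⋃ i ∈ Finset.range n, {q | lev (Z i q) < K}).Finite := by
    apply Set.Finite.biUnion (Finset.finite_toSet _)
    intro i _
    exact (hfin K).preimage (Z i).injective.injOn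
  refine hbad.subset ?_
  intro q hq
  have hq : Φ (π n) q = q := hq
  by_contra hnot
  simp only [Set.mem_iUnion, Finset.mem_range, Set.mem_ofPred_eq, not_exists, not_lt] at hnot
  have hzper : ∀ i, Z (i + n) q = Z i q := by
    intro i
    simp only [Z, hmper, hπper, map_mul, mul_inv_rev, Perm.mul_apply]
    have : (Φ (π n))⁻¹ q = q := by rw [Perm.inv_eq_iff_eq, hq]
    rw [this]
    simp
  have hzmod : ∀ i, Z (i % n) q = Z i q := by
    have : Function.Periodic (fun i => Z i q) n := hzper
    exact fun i => this.map_mod_nat i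
  have hqstep : ∀ i, (Φ (π (i+1)))⁻¹ q = β ((π (i+1))⁻¹ * m i) (σ (y i) (Z i q)) := by
    intro i
    simp only [Z, Perm.mul_apply]
    generalize hr : (Φ (π i))⁻¹ q = r
    have hr' : (Φ (π (i+1)))⁻¹ q = (Φ (FreeGroup.mk [a i]))⁻¹ r := by
      rw [hπ, map_mul, mul_inv_rev, Perm.mul_apply, hr]
    rw [hr']
    rcases hai : a i with ⟨x, b⟩
    have hyi : y i = x := by simp [y, hai]
    have hmk : π (i+1) = π i * FreeGroup.mk [(x, b)] := by rw [hπ, hai]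
    cases b with
    | true =>
      have e1 : m i = π (i+1) := by simp [m, hai]
      have e2 : FreeGroup.mk [(x, true)] = FreeGroup.of x := rfl
      rw [e1, inv_mul_cancel, hmk, e2, hyi, hΦ]
      simp [hσi]
    | false =>
      have e1 : m i = π i := by simp [m, hai]
      have e2 : FreeGroup.mk [(x, false)] = (FreeGroup.of x)⁻¹ := rfl
      rw [e1, inv_mul_cancel, hmk, e2, hyi, hΦ]
      simp
  refine path_contra lev β hβ B p d hp hd n hn y m (fun i => Z i q) (fun i => σ (y i) (Z i q))
    (fun i => by simp only [y, hper]) hzper ?_ ?_ K ?_ ?_ ?_ ?_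
  · intro i
    have h1 : Z (i+1) q = β ((m (i+1))⁻¹ * π (i+1)) ((Φ (π (i+1)))⁻¹ q) := rfl
    rw [h1, hqstep, ← Perm.mul_apply, ← map_mul]
    congr 2; group
  · intro i h
    exact hmod _ _ h
  · intro i
    rw [← hzmod]
    exact hnot _ (Nat.mod_lt _ hn)
  · intro i j hij hj hy r hr
    exact (hK _ hr).1 i (by simp; omega) j (by simpa using hj) hij hy r rfl
  · intro i j l hi hj hl k hk hB
    exact (hK k hk).2.1 i (by simpa using hi) j (by simpa using hj) l (by simpa using hl) hB
  · intro i j hi hj k hk h1 h2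
    exact (hK k hk).2.2 i (by simpa using hi) j (by simpa using hj) h1 h2

theorem count_lemma {X Ω : Type*} (lev : Ω → ℕ) (hfin : ∀ k, {q | lev q < k}.Finite)
    (β Φ : FreeGroup X →* Perm Ω)
    (hβ : ∀ w q, lev (β w q) = lev q)
    (h : ∀ x, ∃ C, ∀ k, {q | lev q = k ∧ Φ (FreeGroup.of x) q ≠ β (FreeGroup.of x) q}.ncard ≤ C)
    (w : FreeGroup X) : ∃ C, ∀ k, {q | lev q = k ∧ Φ w q ≠ β w q}.ncard ≤ C := by
  have hf : ∀ k (P : Ω → Prop), {q | lev q = k ∧ P q}.Finite := fun k P =>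
    (hfin (k+1)).subset fun q hq => by
      have := hq.1; simp only [Set.mem_ofPred_eq]; omega
  induction w using FreeGroup.induction_on with
  | C1 => exact ⟨0, fun k => by simp⟩
  | of x => exact h x
  | inv_of x ih =>
    obtain ⟨C, hC⟩ := ih
    refine ⟨C, fun k => le_trans ?_ (hC k)⟩
    refine Set.ncard_le_ncard_of_injOn (fun q => (β (FreeGroup.of x))⁻¹ q) ?_
      ((β (FreeGroup.of x))⁻¹.injective.injOn) (hf _ _)
    rintro q ⟨h1, h2⟩
    refine ⟨?_, ?_⟩
    · rw [← map_inv, hβ, h1]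
    · intro h3
      apply h2
      rw [map_inv, map_inv, Perm.inv_eq_iff_eq, h3]; simp
  | mul u v hu hv =>
    obtain ⟨C, hC⟩ := hu
    obtain ⟨D, hD⟩ := hv
    refine ⟨C + D, fun k => ?_⟩
    have hsub : {q | lev q = k ∧ Φ (u * v) q ≠ β (u * v) q} ⊆
        (β v) ⁻¹' {q | lev q = k ∧ Φ u q ≠ β u q} ∪ {q | lev q = k ∧ Φ v q ≠ β v q} := by
      rintro q ⟨h1, h2⟩
      by_cases h3 : Φ v q = β v q
      · left
        refine ⟨by rw [hβ, h1], ?_⟩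
        intro h4
        apply h2
        rw [map_mul, map_mul, Perm.mul_apply, Perm.mul_apply, h3, h4]
      · right; exact ⟨h1, h3⟩
    refine (Set.ncard_le_ncard hsub ?_).trans ((Set.ncard_union_le _ _).trans ?_)
    · exact ((hf _ _).preimage (β v).injective.injOn).union (hf _ _)
    · refine add_le_add ?_ (hD k)
      refine le_trans ?_ (hC k)
      exact Set.ncard_le_ncard_of_injOn (β v) (fun q hq => hq) (β v).injective.injOn (hf _ _)

open Filter in
theorem abstract_main {X Ω : Type*} (lev : Ω → ℕ) (hfin : ∀ k, {q | lev q < k}.Finite)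
    (β : FreeGroup X →* Perm Ω)
    (hβ : ∀ w q, lev (β w q) = lev q)
    (hfree : ∀ w, w ≠ 1 → ∀ᶠ k in atTop, ∀ q, lev q = k → β w q ≠ q)
    (hpop : ∀ (h : Perm Ω) (k : ℕ), ∃ p, lev p = k ∧ k ≤ lev (h p) ∧
      ∀ w, β w p = h p → k < {q | lev q = k ∧ β w q = h q}.ncard)
    (A : X → Set ℕ) (hA : ∀ x, (A x).Infinite)
    (hO : ∀ x y, x ≠ y → ∀ᶠ k in atTop, ¬ (k ∈ A x ∧ k ∈ A y))
    (H : X → Perm Ω) (hH : Function.Surjective H) :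
    ∃ Φ : FreeGroup X →* Perm Ω, (∀ w, w ≠ 1 → {q | Φ w q = q}.Finite) ∧
      ∀ h : Perm Ω, ∃ w, {q | Φ w q = h q}.Infinite := by
  choose P hP1 hP2 hP3 using hpop
  let p : X → ℕ → Ω := fun x k => P (H x) k
  let d : X → ℕ → Ω := fun x k => (β (FreeGroup.of x))⁻¹ (H x (p x k))
  have hd : ∀ x k, k ≤ lev (d x k) := by
    intro x k
    simp only [d]
    rw [← map_inv, hβ]; exact hP2 _ _
  let good : X → Prop := fun x => ∀ w, {k | k ∈ A x ∧ β w (p x k) = H x (p x k)}.Finite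
  have hB : ∀ x, ∃ B ⊆ A x, (good x → B.Infinite) ∧ (¬ good x → B = ∅) ∧
      ∀ k ∈ B, ∀ k' ∈ B, k < k' → lev (d x k) < k' := by
    intro x
    by_cases hg : good x
    · obtain ⟨B, h1, h2, h3⟩ := sparse (A x) (hA x) (fun k => lev (d x k))
      exact ⟨B, h1, fun _ => h2, fun h => absurd hg h, h3⟩
    · exact ⟨∅, by simp, fun h => absurd h hg, fun _ => rfl, by simp⟩
  choose B hBA hBinf hBempty hBs using hB
  have hσ := fun x => exists_sigma lev (B x) (p x) (d x) (fun k _ => hP1 _ _) (fun k _ => hd x k)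
    (hBs x)
  choose σ hσ1 hσ2 hσ3 using hσ
  refine ⟨FreeGroup.lift (fun x => β (FreeGroup.of x) * σ x), ?_, ?_⟩
  · refine cofin lev hfin β hβ hfree B p d (fun x k _ => hP1 _ _) (fun x k _ => hd x k) ?_ ?_ σ hσ1 hσ3
    · intro x w
      by_cases hg : good x
      · have := hg (FreeGroup.of x * w)
        obtain ⟨K, hK⟩ := this.bddAbove
        filter_upwards [eventually_gt_atTop K] with k hk hkB h
        have : k ≤ K := hK ⟨hBA x hkB, by
          rw [map_mul, Perm.mul_apply, h]; simp [d]⟩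
        omega
      · rw [hBempty x hg]; simp
    · intro x y hxy
      filter_upwards [hO x y hxy] with k hk h
      exact hk ⟨hBA x h.1, hBA y h.2⟩
  · intro h
    obtain ⟨x, rfl⟩ := hH h
    by_cases hg : good x
    · refine ⟨FreeGroup.of x, ?_⟩
      have hinj : Set.InjOn (p x) (B x) := fun k _ k' _ e => by
        have := congrArg lev e
        simpa [p, hP1] using this
      refine ((hBinf x hg).image hinj).mono ?_
      rintro _ ⟨k, hk, rfl⟩
      simp [hσ2 x k hk, d]
    · have hg' := hg
      simp only [good, not_forall] at hg'
      obtain ⟨w, hw⟩ := hg'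
      refine ⟨w, ?_⟩
      obtain ⟨C, hC⟩ := count_lemma lev hfin β
        (FreeGroup.lift (fun x => β (FreeGroup.of x) * σ x)) hβ (by
          intro x
          refine ⟨2, fun k => ?_⟩
          by_cases hex : ∃ κ ∈ B x, κ ≤ k ∧ k ≤ lev (d x κ)
          · obtain ⟨κ, hκ, h1, h2⟩ := hex
            refine (Set.ncard_le_ncard (t := {p x κ, d x κ}) ?_ (by simp)).trans ((Set.ncard_insert_le _ _).trans (by simp))
            rintro q ⟨hq1, hq2⟩
            have hne : σ x q ≠ q := by
              intro e; apply hq2; simp [e]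
            obtain ⟨κ', hκ', hc⟩ := hσ3 x q hne
            have : κ' ≤ k ∧ k ≤ lev (d x κ') := by
              rw [← hq1]
              have a1 := hd x κ'
              have a2 : lev (p x κ') = κ' := hP1 _ _
              rcases hc with ⟨e, _⟩ | ⟨e, _⟩
              · rw [e, a2]; exact ⟨le_rfl, a1⟩
              · rw [e]; exact ⟨a1, le_rfl⟩
            have : κ' = κ := by
              by_contra hne
              rcases lt_or_gt_of_ne hne with h' | h'
              · have := hBs x _ hκ' _ hκ h'; omega
              · have := hBs x _ hκ _ hκ' h'; omega
            subst this
            rcases hc with ⟨e, _⟩ | ⟨e, _⟩ <;> simp [e]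
          · have : {q | lev q = k ∧ FreeGroup.lift (fun x => β (FreeGroup.of x) * σ x)
                (FreeGroup.of x) q ≠ β (FreeGroup.of x) q} = ∅ := by
              ext q
              simp only [Set.mem_ofPred_eq, Set.mem_empty_iff_false, iff_false, not_and]
              intro hq1 hq2
              have hne : σ x q ≠ q := by
                intro e; apply hq2; simp [e]
              obtain ⟨κ', hκ', hc⟩ := hσ3 x q hne
              apply hex
              refine ⟨κ', hκ', ?_⟩
              rw [← hq1]
              have a1 := hd x κ'
              have a2 : lev (p x κ') = κ' := hP1 _ _
              rcases hc with ⟨e, _⟩ | ⟨e, _⟩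
              · rw [e, a2]; exact ⟨le_rfl, a1⟩
              · rw [e]; exact ⟨a1, le_rfl⟩
            rw [this]; simp) w
      intro hfinite
      obtain ⟨M, hM⟩ := (hfinite.image lev).bddAbove
      obtain ⟨k, hk, hkM⟩ := Set.Infinite.exists_gt hw (max C M)
      have h1 := hP3 (H x) k w hk.2
      have h2 := hC k
      have hlt : {q | lev q = k ∧ FreeGroup.lift (fun x => β (FreeGroup.of x) * σ x) w q
          ≠ β w q}.ncard < {q | lev q = k ∧ β w q = H x q}.ncard := by
        have : C < k := lt_of_le_of_lt (le_max_left _ _) hkM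
        omega
      obtain ⟨q, hq1, hq2⟩ := Set.exists_mem_notMem_of_ncard_lt_ncard hlt
        ((hfin (k+1)).subset fun q hq => by
          have := hq.1; simp only [Set.mem_ofPred_eq]; omega)
      have hq3 : FreeGroup.lift (fun x => β (FreeGroup.of x) * σ x) w q = H x q := by
        by_contra hne
        apply hq2
        refine ⟨hq1.1, ?_⟩
        rw [hq1.2]; exact hne
      have : k ≤ M := hM ⟨q, hq3, hq1.1⟩
      have : M < k := lt_of_le_of_lt (le_max_right _ _) hkM
      omega

open Filter in
theorem exists_phi : ∃ (Q : ℕ → Type) (_ : ∀ k, Group (Q k)) (_ : ∀ k, Finite (Q k))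
    (φ : ∀ k, FreeGroup (ℕ → Bool) →* Q k), ∀ w, w ≠ 1 → ∀ᶠ k in atTop, φ k w ≠ 1 := by
  classical
  let Y : ℕ → Type := fun k => Fin k → Bool
  let r : ∀ k, (ℕ → Bool) → Y k := fun k x i => x i
  let Ball : ℕ → Type := fun k => {v : FreeGroup (Y k) // v.norm ≤ k}
  have hBall : ∀ k, Finite (Ball k) := by
    intro k
    have h1 : {l : List (Y k × Bool) | l.length ≤ k}.Finite := List.finite_length_le _ _
    have h2 : {v : FreeGroup (Y k) | v.norm ≤ k}.Finite :=
      h1.preimage (f := FreeGroup.toWord) FreeGroup.toWord_injective.injOn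
    exact h2.to_subtype
  have he : ∀ k (y : Y k), ∃ e : Perm (Ball k), ∀ v : Ball k,
      ∀ h : (FreeGroup.of y * v.1).norm ≤ k, e v = ⟨FreeGroup.of y * v.1, h⟩ := by
    intro k y
    have := hBall k
    obtain ⟨σ, hσ⟩ := Perm.exists_extending_pair
      (α := {v : Ball k // (FreeGroup.of y * v.1).norm ≤ k}) (β := Ball k)
      (fun v => v.1) (fun v => ⟨FreeGroup.of y * v.1.1, v.2⟩) Subtype.val_injective (by
        intro u v h
        have := congrArg Subtype.val h
        simp only [mul_right_inj] at this
        exact Subtype.ext (Subtype.ext this))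
    exact ⟨σ, fun v h => hσ ⟨v, h⟩⟩
  choose e he using he
  have key : ∀ k (L : List (Y k × Bool)) (hL : L.length ≤ k),
      FreeGroup.lift (e k) (FreeGroup.mk L) ⟨1, by simp⟩ =
        ⟨FreeGroup.mk L, FreeGroup.norm_mk_le.trans hL⟩ := by
    intro k L
    induction L with
    | nil => intro _; simp [← FreeGroup.one_eq_mk]
    | cons a L ih =>
      intro hL
      have hL' : L.length ≤ k := by simp at hL; omega
      have hb : (FreeGroup.mk (a :: L)).norm ≤ k := FreeGroup.norm_mk_le.trans hL
      have hs : FreeGroup.mk (a :: L) = FreeGroup.mk [a] * FreeGroup.mk L := by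
        rw [FreeGroup.mul_mk]; rfl
      rcases a with ⟨y, b⟩
      cases b with
      | true =>
        have e2 : FreeGroup.mk [(y, true)] = FreeGroup.of y := rfl
        simp only [hs, e2] at hb ⊢
        rw [map_mul, Perm.mul_apply, ih hL', FreeGroup.lift_apply_of]
        exact he k y _ hb
      | false =>
        have e2 : FreeGroup.mk [(y, false)] = (FreeGroup.of y)⁻¹ := rfl
        simp only [hs, e2] at hb ⊢
        rw [map_mul, Perm.mul_apply, ih hL', map_inv, FreeGroup.lift_apply_of, Perm.inv_eq_iff_eq]
        have h3 : (FreeGroup.of y * ((FreeGroup.of y)⁻¹ * FreeGroup.mk L)).norm ≤ k := by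
          rw [mul_inv_cancel_left]; exact FreeGroup.norm_mk_le.trans hL'
        rw [he k y ⟨_, hb⟩ h3]
        exact Subtype.ext (mul_inv_cancel_left _ _).symm
  refine ⟨fun k => Perm (Ball k), fun k => inferInstance, fun k => ?_,
    fun k => (FreeGroup.lift (e k)).comp (FreeGroup.map (r k)), ?_⟩
  · have := hBall k
    infer_instance
  · intro w hw
    -- eventually `r k` is injective on the letters
    have hinj : ∀ᶠ k in atTop, ∀ a ∈ w.toWord.toFinset, ∀ b ∈ w.toWord.toFinset,
        r k a.1 = r k b.1 → a.1 = b.1 := by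
      simp only [Filter.eventually_all_finset]
      intro a _ b _
      by_cases h : a.1 = b.1
      · exact Eventually.of_forall fun _ _ => h
      · obtain ⟨i, hi⟩ := Function.ne_iff.1 h
        filter_upwards [eventually_gt_atTop i] with k hk h'
        exact absurd (congrFun h' ⟨i, hk⟩) hi
    filter_upwards [hinj, eventually_ge_atTop w.toWord.length] with k hk hlen h1
    have hmap : FreeGroup.map (r k) w = FreeGroup.mk (w.toWord.map fun a => (r k a.1, a.2)) := by
      conv_lhs => rw [← FreeGroup.mk_toWord (x := w)]
      rw [FreeGroup.map.mk]
    have h2 := key k (w.toWord.map fun a => (r k a.1, a.2)) (by simpa using hlen)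
    rw [MonoidHom.comp_apply, hmap] at h1
    rw [h1] at h2
    have h3 : FreeGroup.map (r k) w = 1 := by
      have := congrArg Subtype.val h2
      simp only [Perm.one_apply] at this
      rw [hmap]; exact this.symm
    apply hw
    let g : Y k → (ℕ → Bool) := fun t =>
      if h : ∃ a ∈ w.toWord, r k a.1 = t then h.choose.1 else fun _ => true
    have hg : ∀ a ∈ w.toWord, g (r k a.1) = a.1 := by
      intro a ha
      have h : ∃ b ∈ w.toWord, r k b.1 = r k a.1 := ⟨a, ha, rfl⟩
      simp only [g, dif_pos h]
      exact hk _ (by simpa using h.choose_spec.1) _ (by simpa using ha) h.choose_spec.2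
    have h4 : FreeGroup.map g (FreeGroup.map (r k) w) = w := by
      rw [hmap, FreeGroup.map.mk, List.map_map]
      conv_rhs => rw [← FreeGroup.mk_toWord (x := w)]
      congr 1
      conv_rhs => rw [← List.map_id w.toWord]
      apply List.map_congr_left
      intro a ha
      simp [hg a ha]
    rw [← h4, h3, map_one]

theorem exists_M (c : ℕ → ℕ) : ∃ M : ℕ → ℕ, ∀ k, ∑ j ∈ Finset.range k, c j * M j + k + 1 ≤ M k := by
  let S : ℕ → ℕ := fun k => Nat.rec 0 (fun k s => s + c k * (s + k + 1)) k
  refine ⟨fun k => S k + k + 1, fun k => ?_⟩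
  have : ∀ k, ∑ j ∈ Finset.range k, c j * (S j + j + 1) = S k := by
    intro k
    induction k with
    | zero => rfl
    | succ k ih => rw [Finset.sum_range_succ, ih]
  rw [this]

open Filter in
theorem exists_model : ∃ (Ω : Type) (_ : Countable Ω) (_ : Infinite Ω) (lev : Ω → ℕ)
    (β : FreeGroup (ℕ → Bool) →* Perm Ω), (∀ k, {q | lev q < k}.Finite) ∧
    (∀ w q, lev (β w q) = lev q) ∧
    (∀ w, w ≠ 1 → ∀ᶠ k in atTop, ∀ q, lev q = k → β w q ≠ q) ∧
    (∀ (h : Perm Ω) (k : ℕ), ∃ p, lev p = k ∧ k ≤ lev (h p) ∧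
      ∀ w, β w p = h p → k < {q | lev q = k ∧ β w q = h q}.ncard) := by
  classical
  obtain ⟨Q, iG, iF, φ, hφ⟩ := exists_phi
  have iFt : ∀ k, Fintype (Q k) := fun k => Fintype.ofFinite _
  obtain ⟨M, hM⟩ := exists_M (fun k => Fintype.card (Q k))
  let Ω : Type := Σ k, Q k × Fin (M k)
  let lev : Ω → ℕ := Sigma.fst
  have hMpos : ∀ k, 0 < M k := fun k => by have := hM k; omega
  let act : FreeGroup (ℕ → Bool) → Perm Ω := fun w =>
    { toFun := fun q => ⟨q.1, φ q.1 w * q.2.1, q.2.2⟩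
      invFun := fun q => ⟨q.1, (φ q.1 w)⁻¹ * q.2.1, q.2.2⟩
      left_inv := fun q => by simp
      right_inv := fun q => by simp }
  have hact : ∀ w k (g : Q k) i, act w ⟨k, g, i⟩ = ⟨k, φ k w * g, i⟩ := fun _ _ _ _ => rfl
  let β : FreeGroup (ℕ → Bool) →* Perm Ω :=
    { toFun := act
      map_one' := by
        ext1 ⟨k, g, i⟩; rw [hact]; simp
      map_mul' := fun u v => by
        ext1 ⟨k, g, i⟩; rw [Perm.mul_apply, hact, hact, hact]; simp [mul_assoc] }
  have hβ : ∀ w k (g : Q k) i, β w ⟨k, g, i⟩ = ⟨k, φ k w * g, i⟩ := fun _ _ _ _ => rfl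
  let lv : ℕ → Finset Ω := fun k => Finset.univ.map ⟨fun t : Q k × Fin (M k) => (⟨k, t⟩ : Ω),
    fun a b h => eq_of_heq (Sigma.mk.inj h).2⟩
  have hlv : ∀ k q, q ∈ lv k ↔ lev q = k := by
    intro k q
    simp only [lv, Finset.mem_map, Finset.mem_univ, true_and, Function.Embedding.coeFn_mk, lev]
    constructor
    · rintro ⟨t, rfl⟩; rfl
    · rintro rfl; exact ⟨q.2, rfl⟩
  have hlvc : ∀ k, (lv k).card = Fintype.card (Q k) * M k := by
    intro k; simp [lv]
  let low : ℕ → Finset Ω := fun k => (Finset.range k).biUnion lv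
  have hlow : ∀ k q, q ∈ low k ↔ lev q < k := by
    intro k q; simp [low, hlv]
  have hlowc : ∀ k, (low k).card ≤ ∑ j ∈ Finset.range k, Fintype.card (Q j) * M j := by
    intro k
    refine Finset.card_biUnion_le.trans ?_
    simp [hlvc]
  refine ⟨Ω, inferInstance, ?_, lev, β, ?_, ?_, ?_, ?_⟩
  · refine Infinite.of_injective (fun k => (⟨k, 1, ⟨0, hMpos k⟩⟩ : Ω)) ?_
    intro a b h
    exact congrArg Sigma.fst h
  · intro k
    exact (low k).finite_toSet.subset fun q hq => (hlow k q).2 hq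
  · rintro w ⟨k, g, i⟩; rfl
  · intro w hw
    filter_upwards [hφ w hw] with k hk
    rintro ⟨k', g, i⟩ h1 h2
    have : k' = k := h1
    subst this
    rw [hβ] at h2
    have h3 := congrArg Prod.fst (eq_of_heq (Sigma.mk.inj h2).2)
    exact hk (mul_eq_right.1 h3)
  · intro h k
    -- points of level `k` not sent down
    let T : Finset Ω := (lv k).filter fun q => k ≤ lev (h q)
    have hT : ∀ q, q ∈ T ↔ lev q = k ∧ k ≤ lev (h q) := by
      intro q; simp [T, hlv]
    have hTc : Fintype.card (Q k) * k < T.card := by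
      have h1 : ((lv k).filter fun q => ¬ k ≤ lev (h q)).card ≤ (low k).card := by
        apply Finset.card_le_card_of_injOn h
        · intro q hq
          simp only [Finset.coe_filter, Set.mem_ofPred_eq, not_le] at hq
          exact (hlow _ _).2 hq.2
        · exact h.injective.injOn
      have h2 := Finset.card_filter_add_card_filter_not (s := lv k) (fun q => k ≤ lev (h q))
      have h3 := hlowc k
      have h4 := hM k
      have h5 : 0 < Fintype.card (Q k) := Fintype.card_pos
      rw [hlvc] at h2
      have h6 := Nat.mul_le_mul_left (Fintype.card (Q k)) h4
      have h7 : (∑ j ∈ Finset.range k, Fintype.card (Q j) * M j) ≤ Fintype.card (Q k) *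
         (∑ j ∈ Finset.range k, Fintype.card (Q j) * M j) := Nat.le_mul_of_pos_left _ h5
      have h8 : T.card = ((lv k).filter fun q => k ≤ lev (h q)).card := rfl
      rw [← h8] at h2
      nlinarith
    by_cases hout : ∃ p ∈ T, ∀ w, β w p ≠ h p
    · obtain ⟨p, hp, hw⟩ := hout
      exact ⟨p, ((hT p).1 hp).1, ((hT p).1 hp).2, fun w hw' => absurd hw' (hw w)⟩
    · push Not at hout
      choose! W hW using hout
      obtain ⟨g, -, hg⟩ := Finset.exists_lt_card_fiber_of_mul_lt_card_of_maps_to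
        (s := T) (t := (Finset.univ : Finset (Q k))) (f := fun q => φ k (W q)) (n := k)
        (fun _ _ => Finset.mem_univ _) (by simpa using hTc)
      have hne : (T.filter fun q => φ k (W q) = g).Nonempty := by
        rw [← Finset.card_pos]; omega
      obtain ⟨p, hp⟩ := hne
      rw [Finset.mem_filter] at hp
      have hpT := (hT p).1 hp.1
      refine ⟨p, hpT.1, hpT.2, ?_⟩
      intro w hw
      refine lt_of_lt_of_le hg ?_
      rw [← Set.ncard_coe_finset]
      apply Set.ncard_le_ncard
      · intro q hq
        simp only [Finset.coe_filter, Set.mem_ofPred_eq] at hq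
        have hqT := (hT q).1 hq.1
        refine ⟨hqT.1, ?_⟩
        have e1 : φ k w = g := by
          have h1 := hW p hp.1
          rw [← hw] at h1
          obtain ⟨k', a, i⟩ := p
          have : k' = k := hpT.1
          subst this
          rw [hβ, hβ] at h1
          have h3 := mul_right_cancel (congrArg Prod.fst (eq_of_heq (Sigma.mk.inj h1).2))
          rw [← h3]; exact hp.2
        rw [← hW q hq.1]
        obtain ⟨k', a, i⟩ := q
        have : k' = k := hqT.1
        subst this
        rw [hβ, hβ, e1, hq.2]
      · exact (lv k).finite_toSet.subset fun q hq => (hlv k q).2 hq.1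

open Filter in
theorem exists_own : ∃ A : (ℕ → Bool) → Set ℕ, (∀ x, (A x).Infinite) ∧
    ∀ x y, x ≠ y → ∀ᶠ k in atTop, ¬ (k ∈ A x ∧ k ∈ A y) := by
  let o : (ℕ → Bool) → ℕ → ℕ := fun x m => Encodable.encode ((List.range m).map x)
  have ho : ∀ x y m m', o x m = o y m' → m = m' ∧ ∀ i < m, x i = y i := by
    intro x y m m' h
    have h1 := Encodable.encode_injective h
    have h2 : m = m' := by simpa using congrArg List.length h1
    subst h2
    refine ⟨rfl, fun i hi => ?_⟩
    rw [List.map_inj_left] at h1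
    exact h1 i (List.mem_range.2 hi)
  refine ⟨fun x => Set.range (o x), fun x => Set.infinite_range_of_injective
    fun m m' h => (ho x x m m' h).1, ?_⟩
  intro x y hxy
  obtain ⟨i, hi⟩ := Function.ne_iff.1 hxy
  have hf : ((o x) '' Set.Iic i).Finite := (Set.finite_Iic i).image _
  obtain ⟨K, hK⟩ := hf.bddAbove
  filter_upwards [eventually_gt_atTop K] with k hk
  rintro ⟨⟨m, rfl⟩, ⟨m', h⟩⟩
  have := ho x y m m' h.symm
  have hm : m ≤ i := by
    by_contra hlt
    exact hi (this.2 i (by omega))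
  have := hK ⟨m, hm, rfl⟩
  omega

theorem exists_hom : ∃ Φ : FreeGroup (ℕ → Bool) →* Perm ℕ,
    (∀ w, w ≠ 1 → {q | Φ w q = q}.Finite) ∧ ∀ h : Perm ℕ, ∃ w, {q | Φ w q = h q}.Infinite := by
  obtain ⟨Ω, _, _, lev, β, h1, h2, h3, h4⟩ := exists_model
  obtain ⟨A, hA, hO⟩ := exists_own
  obtain ⟨e⟩ : Nonempty (Ω ≃ ℕ) := by
    exact nonempty_equiv_of_countable
  obtain ⟨H, hH⟩ : ∃ H : (ℕ → Bool) → Perm Ω, Function.Surjective H := by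
    have : Cardinal.mk (Perm Ω) = Cardinal.mk (ℕ → Bool) := by
      rw [Cardinal.mk_perm_eq_two_power, Cardinal.mk_eq_aleph0 Ω]; simp
    obtain ⟨f⟩ := Cardinal.eq.1 this
    exact ⟨f.symm, f.symm.surjective⟩
  obtain ⟨Φ, g1, g2⟩ := abstract_main lev h1 β h2 h3 h4 A hA hO H hH
  refine ⟨(e.permCongrHom : Perm Ω →* Perm ℕ).comp Φ, ?_, ?_⟩
  · intro w hw
    refine ((g1 w hw).image e).subset ?_
    intro q hq
    refine ⟨e.symm q, ?_, by simp⟩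
    have hq' : e (Φ w (e.symm q)) = q := hq
    show Φ w (e.symm q) = e.symm q
    rw [Equiv.eq_symm_apply, hq']
  · intro h
    obtain ⟨w, hw⟩ := g2 (e.symm.permCongr h)
    refine ⟨w, (hw.image e.injective.injOn).mono ?_⟩
    rintro _ ⟨q, hq, rfl⟩
    have hq' : Φ w q = e.symm (h (e q)) := hq
    show e (Φ w (e.symm (e q))) = h (e q)
    simp [hq']

end MCG

theorem exists_mcg_isomorphic_to_free_group_on_continuum :
    ∃ G : Subgroup (Equiv.Perm ℕ),
      IsMaximalCofinitary G ∧ Nonempty (G ≃* FreeGroup (ℕ → Bool)) := by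
  obtain ⟨Φ, h1, h2⟩ := MCG.exists_hom
  have hinj : Function.Injective Φ := by
    rw [injective_iff_map_eq_one]
    intro w hw
    by_contra hne
    have := h1 w hne
    rw [hw] at this
    simp only [Equiv.Perm.one_apply] at this
    exact Set.infinite_univ (this.subset fun _ _ => trivial)
  refine ⟨Φ.range, ⟨?_, ?_⟩, ⟨(MonoidHom.ofInjective hinj).symm⟩⟩
  · rintro _ ⟨w, rfl⟩ hne
    exact h1 w fun h => hne (by rw [h, map_one])
  · intro H hH hle
    refine le_antisymm hle ?_
    intro h hh
    obtain ⟨w, hw⟩ := h2 h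
    have hmem : (Φ w)⁻¹ * h ∈ H := H.mul_mem (H.inv_mem (hle ⟨w, rfl⟩)) hh
    have h3 : (Φ w)⁻¹ * h = 1 := by
      by_contra hne
      refine hw ((hH _ hmem hne).subset ?_)
      intro q hq
      have hq' : Φ w q = h q := hq
      show ((Φ w)⁻¹ * h) q = q
      rw [Equiv.Perm.mul_apply, ← hq']; simp
    rw [inv_mul_eq_one] at h3
    exact ⟨w, h3⟩
end

section
/- There exists a cofinitary group G ≤ S∞ which, viewed as a set of functions ℕ → ℕ, is an Fσ subset of Baire space, and which satisfies the following strong maximality property: for every injective function g : ℕ → ℕ there exists h ∈ G such that the set {n ∈ ℕ : g(n) = h(n)} is infinite. -/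
/-- A set `s` in a topological space is Fσ if it is a countable union of closed sets. -/
def IsFsigma {X : Type*} [TopologicalSpace X] (s : Set X) : Prop :=
  ∃ f : ℕ → Set X, (∀ n, IsClosed (f n)) ∧ s = ⋃ n, f n

set_option linter.unusedVariables false
set_option linter.unusedSectionVars false

/-! ### Words -/
def lt {ι G : Type*} [Group G] (f : ι → G) (a : ι × Bool) : G := cond a.2 (f a.1) (f a.1)⁻¹

def wd {ι G : Type*} [Group G] (f : ι → G) (L : List (ι × Bool)) : G := (L.map (lt f)).prod

section wd
variable {ι κ G H : Type*} [Group G] [Group H] (f : ι → G)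

@[simp] lemma wd_nil : wd f [] = 1 := rfl
@[simp] lemma wd_cons (a : ι × Bool) (L) : wd f (a :: L) = lt f a * wd f L := by simp [wd]
lemma wd_append (L L') : wd f (L ++ L') = wd f L * wd f L' := by simp [wd]
lemma wd_single (a : ι × Bool) : wd f [a] = lt f a := by simp [wd]
@[simp] lemma lt_true (a : ι) : lt f (a, true) = f a := rfl
@[simp] lemma lt_false (a : ι) : lt f (a, false) = (f a)⁻¹ := rfl
lemma lt_not (a : ι × Bool) : lt f (a.1, !a.2) = (lt f a)⁻¹ := by
  rcases a with ⟨a, _ | _⟩ <;> simp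
lemma wd_lift (L) : FreeGroup.lift f (FreeGroup.mk L) = wd f L := by
  rw [FreeGroup.lift_mk]; rfl
lemma wd_invRev (L) : wd f (FreeGroup.invRev L) = (wd f L)⁻¹ := by
  rw [← wd_lift, ← wd_lift, ← FreeGroup.inv_mk, map_inv]
lemma wd_hom (φ : G →* H) (L) : wd (fun i => φ (f i)) L = φ (wd f L) := by
  induction L with
  | nil => simp
  | cons a L ih => rcases a with ⟨a, _ | _⟩ <;> simp [ih]

def rs (g : κ → ι) (L : List (κ × Bool)) : List (ι × Bool) := L.map (fun a => (g a.1, a.2))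
variable (g : κ → ι)
@[simp] lemma rs_nil : rs g [] = [] := rfl
@[simp] lemma rs_cons (a) (L) : rs g (a :: L) = (g a.1, a.2) :: rs g L := rfl
@[simp] lemma rs_append (L L') : rs g (L ++ L') = rs g L ++ rs g L' := by simp [rs]
@[simp] lemma rs_length (L) : (rs g L).length = L.length := by simp [rs]
@[simp] lemma rs_eq_nil (L) : rs g L = [] ↔ L = [] := by simp [rs]
lemma wd_rs (L) : wd f (rs g L) = wd (fun i => f (g i)) L := by
  induction L with
  | nil => simp
  | cons a L ih => rcases a with ⟨a, _ | _⟩ <;> simp [ih]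
lemma rs_invRev (L) : rs g (FreeGroup.invRev L) = FreeGroup.invRev (rs g L) := by
  simp [rs, FreeGroup.invRev, List.map_reverse, Function.comp_def]

lemma isReduced_rs_invRev {L : List (ι × Bool)} (h : FreeGroup.IsReduced L) :
    FreeGroup.IsReduced (FreeGroup.invRev L) := by
  classical
  rw [FreeGroup.isReduced_iff_reduce_eq] at h ⊢
  rw [FreeGroup.reduce_invRev, h]

/-- girth property -/
def Girth (f : ι → G) (n : ℕ) : Prop :=
  ∀ L : List (ι × Bool), FreeGroup.IsReduced L → L.length ≤ n → wd f L = 1 → L = []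

lemma Girth.inj {n : ℕ} (hf : Girth f n) {L L' : List (ι × Bool)} (h : FreeGroup.IsReduced L)
    (h' : FreeGroup.IsReduced L') (hl : L.length + L'.length ≤ n) (hw : wd f L = wd f L') :
    L = L' := by
  classical
  have h1 := hf (FreeGroup.toWord ((FreeGroup.mk L)⁻¹ * FreeGroup.mk L'))
    FreeGroup.isReduced_toWord
    (by
      have h1 := FreeGroup.norm_mul_le (FreeGroup.mk L)⁻¹ (FreeGroup.mk L')
      rw [FreeGroup.norm_inv_eq] at h1
      have h2 := FreeGroup.norm_mk_le (L₁ := L)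
      have h3 := FreeGroup.norm_mk_le (L₁ := L')
      unfold FreeGroup.norm at h1 h2 h3
      omega)
    (by
      rw [← wd_lift, FreeGroup.mk_toWord, map_mul, map_inv, wd_lift, wd_lift, hw]; simp)
  rw [FreeGroup.toWord_eq_nil_iff, inv_mul_eq_one] at h1
  have := congrArg FreeGroup.toWord h1
  rwa [FreeGroup.toWord_mk, FreeGroup.toWord_mk, h.reduce_eq, h'.reduce_eq] at this
end wd

/-! ### Finite groups of large girth -/
section girth
open Classical in
lemma exists_girth_aux (S : Type) [Finite S] (n : ℕ) :
    ∃ (B : Type) (_ : Finite B) (γ : S → Equiv.Perm B), Girth γ n := by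
  let B := {w : FreeGroup S // w.norm ≤ n}
  have hB : Finite B := by
    have : Finite {l : List (S × Bool) | l.length ≤ n} := List.finite_length_le _ _
    exact Finite.of_injective (β := {l : List (S × Bool) | l.length ≤ n})
      (fun w => ⟨w.1.toWord, w.2⟩)
      (fun a b h => Subtype.ext (FreeGroup.toWord_injective (congrArg Subtype.val h)))
  have : Fintype B := Fintype.ofFinite B
  let pe : ∀ s : S, {w : B // (FreeGroup.of s * w.1).norm ≤ n} ≃
      {w : B // ((FreeGroup.of s)⁻¹ * w.1).norm ≤ n} := fun s =>
    { toFun := fun w => ⟨⟨FreeGroup.of s * w.1.1, w.2⟩, by simpa using w.1.2⟩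
      invFun := fun w => ⟨⟨(FreeGroup.of s)⁻¹ * w.1.1, w.2⟩, by simpa using w.1.2⟩
      left_inv := fun w => by ext; simp
      right_inv := fun w => by ext; simp }
  let γ : S → Equiv.Perm B := fun s => (pe s).extendSubtype
  have hγ : ∀ s (w : B) (h : (FreeGroup.of s * w.1).norm ≤ n), γ s w = ⟨_, h⟩ := by
    intro s w h
    exact Equiv.extendSubtype_apply_of_mem (pe s) w h
  have hγ' : ∀ s (w : B) (h : ((FreeGroup.of s)⁻¹ * w.1).norm ≤ n), (γ s)⁻¹ w = ⟨_, h⟩ := by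
    intro s w h
    rw [Equiv.Perm.inv_eq_iff_eq, hγ]
    · ext; simp
    · simpa using w.2
  refine ⟨B, hB, γ, ?_⟩
  intro L hL hn h1
  have key : ∀ L' : List (S × Bool), L' <:+ L → ∃ h : (FreeGroup.mk L').norm ≤ n,
      wd γ L' ⟨1, by simp⟩ = ⟨FreeGroup.mk L', h⟩ := by
    intro L' hL'
    have hle : ∀ L' : List (S × Bool), L' <:+ L → (FreeGroup.mk L').norm ≤ n := fun L' h =>
      (FreeGroup.norm_mk_le).trans (h.length_le.trans hn)
    refine ⟨hle _ hL', ?_⟩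
    induction L' with
    | nil => simp; rfl
    | cons a L' ih =>
      have h2 : L' <:+ L := (List.suffix_cons a L').trans hL'
      have h3 := hle _ hL'
      rw [wd_cons, Equiv.Perm.mul_apply, ih h2]
      rcases a with ⟨a, _ | _⟩
      · have e : (FreeGroup.of a)⁻¹ * FreeGroup.mk L' = FreeGroup.mk ((a, false) :: L') := by
          rw [FreeGroup.of, FreeGroup.inv_mk, FreeGroup.mul_mk]; rfl
        rw [lt_false, hγ']
        · simp [e]
        · simpa [e] using h3
      · have e : (FreeGroup.of a) * FreeGroup.mk L' = FreeGroup.mk ((a, true) :: L') := by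
          rw [FreeGroup.of, FreeGroup.mul_mk]; rfl
        rw [lt_true, hγ]
        · simp [e]
        · simpa [e] using h3
  obtain ⟨h, h2⟩ := key L (List.suffix_refl _)
  rw [h1] at h2
  have := congrArg (fun w : B => FreeGroup.toWord w.1) h2
  simp only [Equiv.Perm.coe_one, id_eq] at this
  rw [FreeGroup.toWord_mk, hL.reduce_eq, FreeGroup.toWord_one] at this
  exact this.symm

lemma exists_girth (S : Type) [Finite S] (n N : ℕ) :
    ∃ (c : ℕ) (γ : S → Equiv.Perm (Fin c)), Girth γ n ∧ N ≤ Nat.card (Equiv.Perm (Fin c)) := by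
  obtain ⟨B, hB, γ, hγ⟩ := exists_girth_aux S n
  have e : B ⊕ Fin N ≃ Fin (Nat.card (B ⊕ Fin N)) := Finite.equivFin _
  let φ : Equiv.Perm B →* Equiv.Perm (Fin (Nat.card (B ⊕ Fin N))) :=
    (e.permCongrHom.toMonoidHom).comp
      ((Equiv.Perm.sumCongrHom B (Fin N)).comp (MonoidHom.inl _ _))
  have hφ : Function.Injective φ := by
    refine e.permCongrHom.injective.comp ((Equiv.Perm.sumCongrHom_injective).comp ?_)
    intro a b h
    exact (Prod.ext_iff.1 h).1
  refine ⟨_, fun s => φ (γ s), ?_, ?_⟩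
  · intro L hL hn h1
    rw [wd_hom] at h1
    exact hγ L hL hn (hφ (by simpa using h1))
  · rw [Nat.card_eq_fintype_card, Fintype.card_perm, Fintype.card_fin]
    have : N ≤ Nat.card (B ⊕ Fin N) := by simp [Nat.card_sum]
    exact this.trans (Nat.self_le_factorial _)
end girth

/-! ### The combinatorial skeleton -/
noncomputable def nW (S : Type) (k : ℕ) : ℕ := Nat.card {L : List (S × Bool) // L.length ≤ k + 1}
noncomputable def nBig (S : Type) (k sz : ℕ) : ℕ :=
  sz + (nW S k + 2) * (Nat.card S * (4 * nW S k + 1))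

structure Sys where
  A : ℕ → Type
  Q : ℕ → Type
  Γ : ℕ → Type
  fA : ∀ k, Finite (A k)
  fQ : ∀ k, Finite (Q k)
  fΓ : ∀ k, Finite (Γ k)
  gΓ : ∀ k, Group (Γ k)
  neA : Nonempty (A 0)
  neQ : Nonempty (Q 0)
  pA : ∀ k, A (k + 1) → A k
  asg : ∀ k, A (k + 1) → (A k × Q k → Γ k)
  hA : ∀ k a f, ∃ a', pA k a' = a ∧ asg k a' = f
  pQ : ∀ k, Q (k + 1) → Q k
  arr : ∀ k, Q (k + 1) → Option (ℕ × (Γ k × Option ((A k × Q k) × Fin (k + 1))))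
  arr_le : ∀ k q j t, arr k q = some (j, t) → j ≤ k
  hQ : ∀ k q o, (∀ j t, o = some (j, t) → j ≤ k) → ∃ q', pQ k q' = q ∧ arr k q' = o
  γ : ∀ k, A k × Q k → Γ k
  girth : ∀ k, Girth (γ k) (2 * k + 2)
  code : ∀ i, A i → ℕ
  code_inj : ∀ i j (a : A i) (b : A j), code i a = code j b → (⟨i, a⟩ : Σ i, A i) = ⟨j, b⟩
  code_le : ∀ i a, i ≤ code i a
  card_S : ∀ k, k < Nat.card (A k × Q k)
  sz : ℕ → ℕ
  sz_succ : ∀ k, sz (k + 1) = sz k + Nat.card (Γ k × Option ((A k × Q k) × Fin (k + 1)))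
  big : ∀ k, nBig (A k × Q k) k (sz k) ≤ Nat.card (Γ k)

structure Stg where
  A : Type
  Q : Type
  fA : Finite A
  fQ : Finite Q
  sz : ℕ

namespace Stg
attribute [instance] fA fQ
variable (k : ℕ) (s : Stg)
noncomputable def c : ℕ := (exists_girth (s.A × s.Q) (2 * k + 2) (nBig (s.A × s.Q) k s.sz)).choose
noncomputable def γ : s.A × s.Q → Equiv.Perm (Fin (s.c k)) :=
  (exists_girth (s.A × s.Q) (2 * k + 2) (nBig (s.A × s.Q) k s.sz)).choose_spec.choose
lemma γ_spec : Girth (s.γ k) (2 * k + 2) ∧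
    nBig (s.A × s.Q) k s.sz ≤ Nat.card (Equiv.Perm (Fin (s.c k))) :=
  (exists_girth (s.A × s.Q) (2 * k + 2) (nBig (s.A × s.Q) k s.sz)).choose_spec.choose_spec
noncomputable def next : Stg where
  A := s.A × (s.A × s.Q → Equiv.Perm (Fin (s.c k)))
  Q := s.Q × Option (Fin (k + 1) × (Equiv.Perm (Fin (s.c k)) × Option ((s.A × s.Q) × Fin (k + 1))))
  fA := inferInstance
  fQ := inferInstance
  sz := s.sz + Nat.card (Equiv.Perm (Fin (s.c k)) × Option ((s.A × s.Q) × Fin (k + 1)))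
noncomputable def stg : ℕ → Stg
  | 0 => ⟨Unit, Unit, inferInstance, inferInstance, 0⟩
  | k + 1 => next k (stg k)
lemma stg_card : ∀ k, k < Nat.card ((stg k).A × (stg k).Q)
  | 0 => by
    have : Nat.card ((stg 0).A × (stg 0).Q) = Nat.card (Unit × Unit) := rfl
    rw [this]; simp
  | k + 1 => by
    have ih := stg_card k
    rw [Nat.card_prod] at ih ⊢
    have h1 : Nat.card (stg k).A ≤ Nat.card (stg (k+1)).A := by
      refine Nat.card_le_card_of_surjective (fun a : (stg (k+1)).A => (Prod.fst a : (stg k).A)) ?_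
      intro a
      exact ⟨(a, fun _ => 1), rfl⟩
    have h2 : 2 * Nat.card (stg k).Q ≤ Nat.card (stg (k+1)).Q := by
      have : Nat.card (stg (k+1)).Q = Nat.card ((stg k).Q × Option (Fin (k + 1) × (Equiv.Perm (Fin ((stg k).c k)) × Option (((stg k).A × (stg k).Q) × Fin (k + 1))))) := rfl
      rw [this, Nat.card_prod, mul_comm]
      refine Nat.mul_le_mul_left _ ?_
      rw [Finite.card_option]
      have : 0 < Nat.card (Fin (k + 1) × (Equiv.Perm (Fin ((stg k).c k)) × Option (((stg k).A × (stg k).Q) × Fin (k + 1)))) :=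
        Nat.card_pos
      omega
    calc k + 1 < 2 * (Nat.card (stg k).A * Nat.card (stg k).Q) := by omega
      _ = Nat.card (stg k).A * (2 * Nat.card (stg k).Q) := by ring
      _ ≤ _ := Nat.mul_le_mul h1 h2
end Stg

lemma exists_sys : Nonempty Sys := by
  refine ⟨{
    A := fun k => (Stg.stg k).A
    Q := fun k => (Stg.stg k).Q
    Γ := fun k => Equiv.Perm (Fin ((Stg.stg k).c k))
    fA := fun k => inferInstance
    fQ := fun k => inferInstance
    fΓ := fun k => inferInstance
    gΓ := fun k => inferInstance
    neA := ⟨()⟩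
    neQ := ⟨()⟩
    pA := fun k a => a.1
    asg := fun k a => a.2
    hA := fun k a f => ⟨(a, f), rfl, rfl⟩
    pQ := fun k a => a.1
    arr := fun k q => Option.map (Prod.map Fin.val id) q.2
    arr_le := ?_
    hQ := ?_
    γ := fun k => (Stg.stg k).γ k
    girth := fun k => ((Stg.stg k).γ_spec k).1
    code := fun i a => Nat.pair i (Finite.equivFin _ a)
    code_inj := ?_
    code_le := fun i a => Nat.left_le_pair _ _
    card_S := Stg.stg_card
    sz := fun k => (Stg.stg k).sz
    sz_succ := fun k => rfl
    big := fun k => ((Stg.stg k).γ_spec k).2 }⟩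
  · intro k q j t h
    rw [Option.map_eq_some_iff] at h
    obtain ⟨⟨a, b⟩, h1, h2⟩ := h
    have : (a : ℕ) = j := (Prod.ext_iff.1 h2).1
    omega
  · intro k q o h
    rcases o with _ | ⟨j, t⟩
    · exact ⟨(q, none), rfl, rfl⟩
    · exact ⟨(q, some (⟨j, Nat.lt_succ_of_le (h j t rfl)⟩, t)), rfl, rfl⟩
  · intro i j a b h
    obtain ⟨h1, h2⟩ := Nat.pair_eq_pair.1 h
    subst h1
    have := (Finite.equivFin _).injective (Fin.ext h2)
    rw [this]

namespace Sys
attribute [instance] fA fQ fΓ gΓ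
variable (σ : Sys)

abbrev S (k : ℕ) := σ.A k × σ.Q k
abbrev Y (k : ℕ) := σ.Γ k × Option (σ.S k × Fin (k + 1))
abbrev X := Σ k, σ.Y k

structure Thr where
  α : ∀ k, σ.A k
  q : ∀ k, σ.Q k
  hα : ∀ k, σ.pA k (α (k + 1)) = α k
  hq : ∀ k, σ.pQ k (q (k + 1)) = q k

variable {σ}

namespace Thr
variable (x y : σ.Thr)

def l (k : ℕ) : σ.S k := (x.α k, x.q k)
def as (k : ℕ) : σ.S k → σ.Γ k := σ.asg k (x.α (k + 1))
def ar (k : ℕ) : Option (ℕ × σ.Y k) := σ.arr k (x.q (k + 1))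

variable {x y}
lemma l_anti {k k' : ℕ} (h : k ≤ k') (hl : x.l k' = y.l k') : x.l k = y.l k := by
  induction k', h using Nat.le_induction with
  | base => exact hl
  | succ n hn ih =>
    apply ih
    have h1 := (Prod.ext_iff.1 hl).1
    have h2 := (Prod.ext_iff.1 hl).2
    simp only [l] at h1 h2 ⊢
    rw [← x.hα, ← y.hα, ← x.hq, ← y.hq, h1, h2]
lemma as_congr {k : ℕ} (hl : x.l (k + 1) = y.l (k + 1)) : x.as k = y.as k := by
  have h1 := (Prod.ext_iff.1 hl).1
  simp only [l] at h1
  rw [as, as, h1]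
lemma ar_congr {k : ℕ} (hl : x.l (k + 1) = y.l (k + 1)) : x.ar k = y.ar k := by
  have h1 := (Prod.ext_iff.1 hl).2
  simp only [l] at h1
  rw [ar, ar, h1]
lemma ext_l (h : ∀ k, x.l k = y.l k) : x = y := by
  rcases x with ⟨a, b, _, _⟩
  rcases y with ⟨c, d, _, _⟩
  have h1 : a = c := funext fun k => (Prod.ext_iff.1 (h k)).1
  have h2 : b = d := funext fun k => (Prod.ext_iff.1 (h k)).2
  subst h1; subst h2; rfl
variable (x y)

/-- restriction of a list of threads to level `k` -/
abbrev _root_.Sys.rl (k : ℕ) (L : List (σ.Thr × Bool)) : List (σ.S k × Bool) :=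
  rs (fun x : σ.Thr => x.l k) L

def e : Equiv.Perm σ.X where
  toFun p := ⟨p.1, σ.γ p.1 (x.l p.1) * p.2.1, p.2.2⟩
  invFun p := ⟨p.1, (σ.γ p.1 (x.l p.1))⁻¹ * p.2.1, p.2.2⟩
  left_inv p := by simp
  right_inv p := by simp

lemma e_apply (p : σ.X) : x.e p = ⟨p.1, σ.γ p.1 (x.l p.1) * p.2.1, p.2.2⟩ := rfl
lemma e_inv_apply (p : σ.X) : (x.e)⁻¹ p = ⟨p.1, (σ.γ p.1 (x.l p.1))⁻¹ * p.2.1, p.2.2⟩ := rfl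
lemma lt_e_apply (a : σ.Thr × Bool) (p : σ.X) :
    lt e a p = ⟨p.1, lt (σ.γ p.1) (a.1.l p.1, a.2) * p.2.1, p.2.2⟩ := by
  rcases a with ⟨a, _ | _⟩ <;> simp [e_apply, e_inv_apply]
lemma wd_e_apply (L : List (σ.Thr × Bool)) (p : σ.X) :
    wd e L p = ⟨p.1, wd (σ.γ p.1) (rl p.1 L) * p.2.1, p.2.2⟩ := by
  induction L with
  | nil => simp
  | cons a L ih => rw [wd_cons, Equiv.Perm.mul_apply, ih, lt_e_apply]; simp [mul_assoc]

structure Eff (K j : ℕ) (t : σ.Y K) : Prop where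
  ar : x.ar K = some (j, t)
  gap : ∀ i, j ≤ i → i < K → x.ar i = none
  act : ∃ i, σ.code i (x.α i) = j
  sep : ∀ s s', s ≠ s' → ∀ L : List (σ.S j × Bool), L.length ≤ j + 1 →
    wd (σ.γ j) L * x.as j s ≠ x.as j s'
  c4a : j = K → t.2 = none → ∀ s, s ≠ x.l K → ∀ L : List (σ.S K × Bool), L.length ≤ K + 1 →
    wd (σ.γ K) L * x.as K s ≠ t.1
  c4b : j = K → t.2 = none → ∀ K' < K, ∀ t', x.ar K' = some (K', (t', none)) →
    ∀ L : List (σ.Thr × Bool), L.length ≤ K' → FreeGroup.IsReduced (rl K' L) →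
    wd (σ.γ K) (rl K L) * x.as K (x.l K) = t.1 →
    wd (σ.γ K') (rl K' L) * x.as K' (x.l K') ≠ t'

variable {x y}
lemma Eff.le {K j t} (h : x.Eff K j t) : j ≤ K := σ.arr_le _ _ _ _ h.ar
lemma Eff.uniq {K j t K' j' t'} (h : x.Eff K j t) (h' : x.Eff K' j' t') {i : ℕ}
    (h1 : j ≤ i) (h2 : i ≤ K) (h3 : j' ≤ i) (h4 : i ≤ K') : K = K' := by
  rcases lt_trichotomy K K' with h5 | h5 | h5
  · have := h'.gap K (by omega) h5
    rw [h.ar] at this; cases this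
  · exact h5
  · have := h.gap K' (by omega) h5
    rw [h'.ar] at this; cases this
lemma Eff.uniq2 {K j t j' t'} (h : x.Eff K j t) (h' : x.Eff K j' t') : j = j' ∧ t = t' := by
  have := h.ar.symm.trans h'.ar
  simpa using this
variable (x y)

def nn (j : ℕ) : σ.X := ⟨j, x.as j (x.l j), none⟩
def DD (K r : ℕ) : σ.X := ⟨K, 1, some (x.l K, Fin.ofNat (K + 1) r)⟩

inductive Low : σ.X → σ.X → Prop
  | main (K j : ℕ) (t : σ.Y K) (h : x.Eff K j t) : Low (x.nn j) ((x.e)⁻¹ ⟨K, t⟩)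
  | dup (K j : ℕ) (t : σ.Y K) (r : ℕ) (h : x.Eff K j t) (h1 : j ≤ r) (h2 : r < K)
      (h3 : t.2 ≠ some (x.l K, Fin.ofNat (K + 1) r)) : Low (x.DD r r) (x.DD K r)

lemma ofNat_inj {K r r' : ℕ} (h : r ≤ K) (h' : r' ≤ K)
    (he : Fin.ofNat (K + 1) r = Fin.ofNat (K + 1) r') : r = r' := by
  have := congrArg Fin.val he
  simp only [Fin.ofNat] at this
  rwa [Nat.mod_eq_of_lt (by omega), Nat.mod_eq_of_lt (by omega)] at this

lemma DD_inj {K r r' : ℕ} (h : r ≤ K) (h' : r' ≤ K) (he : x.DD K r = y.DD K r') :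
    r = r' ∧ x.l K = y.l K := by
  have := eq_of_heq (Sigma.ext_iff.1 he).2
  have := (Prod.ext_iff.1 this).2
  simp only [DD, Option.some.injEq, Prod.mk.injEq] at this
  exact ⟨ofNat_inj h h' this.2, this.1⟩

variable {x y}
lemma low_fun {p a b : σ.X} (h : x.Low p a) (h' : x.Low p b) : a = b := by
  generalize hp : p = p' at h'
  cases h with
  | main K j t h =>
    cases h' with
    | main K' j' t' h' =>
      have e1 : j = j' := congrArg Sigma.fst hp
      have h1 := h.le
      have h2 := h'.le
      obtain rfl := h.uniq h' (i := j) (by omega) (by omega) (by omega) (by omega)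
      obtain ⟨-, rfl⟩ := h.uniq2 h'
      rfl
    | dup K' j' t' r' h' h1 h2 h3 =>
      obtain rfl : j = r' := congrArg Sigma.fst hp
      have := eq_of_heq (Sigma.ext_iff.1 hp).2
      cases (Prod.ext_iff.1 this).2
  | dup K j t r h h1 h2 h3 =>
    cases h' with
    | main K' j' t' h' =>
      obtain rfl : r = j' := congrArg Sigma.fst hp
      have := eq_of_heq (Sigma.ext_iff.1 hp).2
      cases (Prod.ext_iff.1 this).2
    | dup K' j' t' r' h' h1 h2 h3 =>
      obtain rfl : r = r' := congrArg Sigma.fst hp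
      obtain rfl := h.uniq h' (i := r) (by omega) (by omega) (by omega) (by omega)
      rfl

lemma low_inj {p a b : σ.X} (h : x.Low a p) (h' : x.Low b p) : a = b := by
  generalize hp : p = p' at h'
  cases h with
  | main K j t h =>
    cases h' with
    | main K' j' t' h' =>
      obtain rfl : K = K' := congrArg Sigma.fst hp
      obtain ⟨rfl, rfl⟩ := h.uniq2 h'
      rfl
    | dup K' j' t' r' h' h1 h2 h3 =>
      obtain rfl : K = K' := congrArg Sigma.fst hp
      obtain ⟨rfl, rfl⟩ := h.uniq2 h'
      have := eq_of_heq (Sigma.ext_iff.1 hp).2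
      have := (Prod.ext_iff.1 this).2
      exact absurd this h3
  | dup K j t r h h1 h2 h3 =>
    cases h' with
    | main K' j' t' h' =>
      obtain rfl : K = K' := congrArg Sigma.fst hp
      obtain ⟨rfl, rfl⟩ := h.uniq2 h'
      have := eq_of_heq (Sigma.ext_iff.1 hp).2
      have := (Prod.ext_iff.1 this).2
      exact absurd this.symm h3
    | dup K' j' t' r' h' h1 h2 h3 =>
      obtain rfl : K = K' := congrArg Sigma.fst hp
      obtain ⟨rfl, -⟩ := DD_inj _ _ (by omega) (by omega) hp
      rfl

lemma low_mix {p a b : σ.X} (h : x.Low p a) (h' : x.Low b p) : a = b := by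
  generalize hp : p = p' at h'
  cases h with
  | main K j t h =>
    have h1 := h.le
    cases h' with
    | main K' j' t' h' =>
      have h2 := h'.le
      obtain rfl : j = K' := congrArg Sigma.fst hp
      obtain rfl := h.uniq h' (i := j) (by omega) (by omega) (by omega) (by omega)
      obtain ⟨rfl, rfl⟩ := h.uniq2 h'
      exact hp.symm
    | dup K' j' t' r' h' h1 h2 h3 =>
      obtain rfl : j = K' := congrArg Sigma.fst hp
      have := eq_of_heq (Sigma.ext_iff.1 hp).2
      cases (Prod.ext_iff.1 this).2
  | dup K j t r h h1 h2 h3 =>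
    cases h' with
    | main K' j' t' h' =>
      have h4 := h'.le
      obtain rfl : r = K' := congrArg Sigma.fst hp
      have := h.uniq h' (i := r) (by omega) (by omega) (by omega) (by omega)
      omega
    | dup K' j' t' r' h' h4 h5 h6 =>
      obtain rfl : r = K' := congrArg Sigma.fst hp
      obtain ⟨rfl, -⟩ := DD_inj _ _ (by omega) (by omega) hp
      omega

variable (x y)
def R (p p' : σ.X) : Prop := x.Low p p' ∨ x.Low p' p
variable {x y}
lemma R.symm {p p'} (h : x.R p p') : x.R p' p := Or.symm h
lemma R_fun {p a b : σ.X} (h : x.R p a) (h' : x.R p b) : a = b := by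
  rcases h with h | h <;> rcases h' with h' | h'
  · exact low_fun h h'
  · exact low_mix h h'
  · exact (low_mix h' h).symm
  · exact low_inj h h'
variable (x y)

open Classical in
noncomputable def πf (p : σ.X) : σ.X := if h : ∃ p', x.R p p' then h.choose else p
variable {x} in
lemma πf_eq {p p'} (h : x.R p p') : x.πf p = p' := by
  have h1 : ∃ p', x.R p p' := ⟨p', h⟩
  rw [πf, dif_pos h1]
  exact R_fun h1.choose_spec h
lemma πf_or (p) : x.πf p = p ∨ x.R p (x.πf p) := by
  by_cases h1 : ∃ p', x.R p p'
  · obtain ⟨p', h⟩ := h1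
    right; rwa [πf_eq h]
  · left; rw [πf, dif_neg h1]
lemma πf_invol (p) : x.πf (x.πf p) = p := by
  rcases x.πf_or p with h | h
  · rw [h, h]
  · exact πf_eq h.symm
noncomputable def π : Equiv.Perm σ.X := ⟨x.πf, x.πf, x.πf_invol, x.πf_invol⟩
variable {x} in
lemma π_eq {p p'} (h : x.R p p') : x.π p = p' := πf_eq h
lemma π_or (p) : x.π p = p ∨ x.R p (x.π p) := πf_or x p
@[simp] lemma π_invol (p) : x.π (x.π p) = p := πf_invol x p
@[simp] lemma π_inv : (x.π)⁻¹ = x.π := rfl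
noncomputable def h : Equiv.Perm σ.X := x.e * x.π
lemma h_apply (p) : x.h p = x.e (x.π p) := rfl
lemma h_inv_apply (p) : (x.h)⁻¹ p = x.π ((x.e)⁻¹ p) := by
  rw [h, mul_inv_rev, π_inv]; rfl

/-- the point at which the involution is applied -/
def qq (a : σ.Thr × Bool) (p : σ.X) : σ.X := cond a.2 p ((a.1.e)⁻¹ p)

lemma lt_h_true (p) : lt h (x, true) p = x.e (x.π p) := rfl
lemma lt_h_false (p) : lt h (x, false) p = x.π ((x.e)⁻¹ p) := h_inv_apply x p

lemma lt_h_of_fix (a : σ.Thr × Bool) (p) (h1 : a.1.π (qq a p) = qq a p) : lt h a p = lt e a p := by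
  rcases a with ⟨a, _ | _⟩
  · rw [lt_h_false]; exact h1
  · rw [lt_h_true]; simp only [qq, cond_true] at h1; rw [h1]; rfl

def _root_.Sys.lev (p : σ.X) : ℕ := 2 * p.1 + cond p.2.2.isSome 1 0
lemma lev_e (p) : lev (x.e p) = lev p := rfl
lemma lev_e_inv (p) : lev ((x.e)⁻¹ p) = lev p := rfl
lemma lev_lt_e (a) (p : σ.X) : lev (lt e a p) = lev p := by
  rw [lt_e_apply]; rfl
lemma lev_le (p : σ.X) : 2 * p.1 ≤ lev p := by unfold lev; omega
lemma lev_le' (p : σ.X) : lev p ≤ 2 * p.1 + 1 := by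
  unfold lev; cases p.2.2.isSome <;> simp
lemma lev_nn (j) : lev (x.nn j) = 2 * j := rfl
lemma lev_DD (K r) : lev (x.DD K r) = 2 * K + 1 := rfl
variable {x} in
lemma lev_low {p p'} (h : x.Low p p') : lev p ≤ lev p' := by
  cases h with
  | main K j t h =>
    have := h.le
    have h2 := lev_le ((x.e)⁻¹ ⟨K, t⟩)
    have h3 : ((x.e)⁻¹ ⟨K, t⟩).1 = K := rfl
    rw [h3] at h2
    rw [lev_nn]; omega
  | dup K j t r h h1 h2 h3 => rw [lev_DD, lev_DD]; omega

lemma lev_qq (a) (p : σ.X) : lev (qq a p) = lev p := by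
  rcases a with ⟨a, _ | _⟩ <;> rfl
lemma lev_lt_h (a) (p : σ.X) : lev (lt h a p) = lev (a.1.π (qq a p)) := by
  rcases a with ⟨a, _ | _⟩
  · rw [lt_h_false]; rfl
  · rfl

/-- `P0` -/
def st (a : σ.Thr × Bool) (z : σ.X) : σ.X := cond a.2 (a.1.e z) z

lemma prop (z : σ.X) (a0 : σ.Thr × Bool) (L : List (σ.Thr × Bool))
    (hred : FreeGroup.IsReduced (rl z.1 (L ++ [a0]))) (hlen : L.length + 1 ≤ 2 * z.1 + 2)
    (H : ∀ a L2 U, (a :: L2) <:+ L → qq a (wd h L2 (st a0 z)) = wd e U z →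
      U <:+: L ++ [a0] → a.1.π (wd e U z) ≠ wd e U z → wd e U z = z ∧ a.1.l z.1 = a0.1.l z.1) :
    wd h L (st a0 z) = wd e L (st a0 z) ∧
    ∀ a L2, (a :: L2) <:+ L → a.1.π (qq a (wd h L2 (st a0 z))) = qq a (wd h L2 (st a0 z)) := by
  have main : ∀ L2, L2 <:+ L → wd h L2 (st a0 z) = wd e L2 (st a0 z) ∧
      ∀ a L3, (a :: L3) <:+ L2 →
        a.1.π (qq a (wd h L3 (st a0 z))) = qq a (wd h L3 (st a0 z)) := by
    intro L2
    induction L2 with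
    | nil => intro _; refine ⟨rfl, ?_⟩; intro a L3 h3; simp at h3
    | cons a L2 ih =>
      intro hs
      obtain ⟨ih1, ih2⟩ := ih ((List.suffix_cons a L2).trans hs)
      have fix : a.1.π (qq a (wd h L2 (st a0 z))) = qq a (wd h L2 (st a0 z)) := by
        by_contra hne
        have hi : (a :: L2) ++ [a0] <:+: L ++ [a0] := by
          obtain ⟨t, ht⟩ := hs
          exact ⟨t, [], by simp [← ht]⟩
        -- find `U`
        obtain ⟨U, hU1, hU2, hU3⟩ : ∃ U, qq a (wd h L2 (st a0 z)) = wd e U z ∧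
            U <:+: (a :: L2) ++ [a0] ∧ (U = [] → a.2 = true ∧ a0.2 = false ∧ L2 = []) := by
          rw [ih1]
          rcases a with ⟨a, _ | _⟩ <;> rcases a0 with ⟨a0, _ | _⟩
          · refine ⟨(a, false) :: L2, ?_, List.infix_append' [] _ _, by simp⟩
            simp [qq, st]
          · refine ⟨(a, false) :: L2 ++ [(a0, true)], ?_, List.infix_refl _, by simp⟩
            simp [qq, st, wd_append]
          · refine ⟨L2, ?_, ?_, by simp⟩
            · simp [qq, st]
            · exact ⟨[(a, true)], [(a0, false)], by simp⟩
          · refine ⟨L2 ++ [(a0, true)], ?_, ?_, by simp⟩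
            · simp [qq, st, wd_append]
            · exact ⟨[(a, true)], [], by simp⟩
        have hU4 := hU2.trans hi
        rw [hU1] at hne
        obtain ⟨h1, h2⟩ := H a L2 U hs hU1 hU4 hne
        have hU5 : U = [] := by
          have h3 : wd (σ.γ z.1) (rl z.1 U) = 1 := by
            rw [wd_e_apply] at h1
            have := eq_of_heq (Sigma.ext_iff.1 h1).2
            have := (Prod.ext_iff.1 this).1
            simpa using this
          have h4 : rl z.1 U <:+: rl z.1 (L ++ [a0]) := hU4.map _
          have := σ.girth z.1 (rl z.1 U) (hred.infix h4) (by
            have := h4.length_le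
            simp only [rs_length, List.length_append, List.length_singleton] at this ⊢
            omega) h3
          simpa using this
        obtain ⟨h5, h6, h7⟩ := hU3 hU5
        subst h7
        have h8 : rl z.1 [a, a0] <:+: rl z.1 (L ++ [a0]) := hi.map _
        have h9 := hred.infix h8
        simp only [rs_cons, rs_nil, FreeGroup.IsReduced] at h9
        rw [List.isChain_pair] at h9
        have := h9 h2
        rw [h5, h6] at this
        cases this
      constructor
      · rw [wd_cons, wd_cons, Equiv.Perm.mul_apply, Equiv.Perm.mul_apply, lt_h_of_fix _ _ fix, ih1]
      · intro b L3 h3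
        rcases List.suffix_cons_iff.1 h3 with h3 | h3
        · obtain ⟨rfl, rfl⟩ := List.cons.inj h3
          exact fix
        · exact ih2 _ _ h3
  exact main L (List.suffix_refl _)
end Thr
end Sys

namespace Sys
namespace Thr
open Filter
variable {σ : Sys}

lemma α_anti {x y : σ.Thr} {k k' : ℕ} (h : k ≤ k') (hl : x.α k' = y.α k') : x.α k = y.α k := by
  induction k', h using Nat.le_induction with
  | base => exact hl
  | succ n hn ih => apply ih; rw [← x.hα, ← y.hα, hl]

lemma reduced_rl {L : List (σ.Thr × Bool)} (hL : FreeGroup.IsReduced L) {k : ℕ}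
    (h : ∀ a ∈ L, ∀ b ∈ L, a.1.l k = b.1.l k → a.1 = b.1) : FreeGroup.IsReduced (rl k L) := by
  unfold FreeGroup.IsReduced rl rs
  rw [List.isChain_map]
  exact List.IsChain.imp_of_mem_imp (fun a b ha hb hab hl => hab (h a ha b hb hl)) hL

lemma ev_sep (T : Set σ.Thr) (hT : T.Finite) :
    ∀ᶠ k in atTop, ∀ x ∈ T, ∀ y ∈ T, x.l k = y.l k → x = y := by
  rw [eventually_all_finite hT]; intro x hx
  rw [eventually_all_finite hT]; intro y hy
  by_cases hxy : x = y
  · exact Eventually.of_forall fun _ _ => hxy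
  · obtain ⟨k, hk⟩ : ∃ k, x.l k ≠ y.l k := by
      by_contra hcon
      push Not at hcon
      exact hxy (ext_l hcon)
    filter_upwards [eventually_ge_atTop k] with k' hk' hl
    exact absurd (l_anti hk' hl) hk

lemma ev_act (T : Set σ.Thr) (hT : T.Finite) :
    ∀ᶠ k in atTop, ∀ x ∈ T, ∀ y ∈ T, (∃ i, σ.code i (x.α i) = k) → (∃ i, σ.code i (y.α i) = k) →
      x.α = y.α := by
  rw [eventually_all_finite hT]; intro x hx
  rw [eventually_all_finite hT]; intro y hy
  by_cases hxy : x.α = y.α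
  · exact Eventually.of_forall fun _ _ _ => hxy
  · obtain ⟨i0, hk⟩ : ∃ k, x.α k ≠ y.α k := by
      by_contra hcon
      push Not at hcon
      exact hxy (funext hcon)
    filter_upwards [eventually_gt_atTop ((Finset.range i0).sup fun i => σ.code i (x.α i))]
      with k hk' ⟨i, hi⟩ ⟨i', hi'⟩
    exfalso
    have h1 := σ.code_inj i i' _ _ (hi.trans hi'.symm)
    obtain ⟨rfl, h2⟩ := Sigma.mk.inj_iff.1 h1
    have h2 := eq_of_heq h2
    have h3 : i < i0 := by
      by_contra h4
      exact hk (α_anti (by omega) h2)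
    have : σ.code i (x.α i) ≤ _ :=
      Finset.le_sup (f := fun i => σ.code i (x.α i)) (Finset.mem_range.2 h3)
    omega

lemma ev_src1 (x : σ.Thr) (W : List (σ.Thr × Bool)) :
    ∀ᶠ k in atTop, ∀ t, x.Eff k k (t, none) → wd (σ.γ k) (rl k W) * x.as k (x.l k) ≠ t := by
  classical
  have hW : ∀ k, wd (σ.γ k) (rl k W) = wd (σ.γ k) (rl k (FreeGroup.mk W).toWord) := by
    intro k
    rw [wd_rs, wd_rs, ← wd_lift, ← wd_lift, FreeGroup.mk_toWord]
  set W' := (FreeGroup.mk W).toWord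
  by_contra hcon
  have hfr : ∃ᶠ k in atTop, ∃ t, x.Eff k k (t, none) ∧
      wd (σ.γ k) (rl k W') * x.as k (x.l k) = t := by
    refine (not_eventually.1 hcon).mono ?_
    intro k hk
    push Not at hk
    simpa only [hW] using hk
  have hsep := ev_sep (σ := σ) {y | ∃ a ∈ W', a.1 = y} (W'.finite_toSet.image Prod.fst)
  obtain ⟨K', ⟨t', h1, h2⟩, h3, h4⟩ :=
    (hfr.and_eventually (hsep.and (eventually_ge_atTop W'.length))).exists
  obtain ⟨K, ⟨t, h5, h6⟩, h7⟩ := (hfr.and_eventually (eventually_gt_atTop K')).exists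
  refine h5.c4b rfl rfl K' h7 t' h1.ar W' h4 ?_ h6 h2
  refine reduced_rl FreeGroup.isReduced_toWord ?_
  intro a ha b hb
  exact h3 _ ⟨a, ha, rfl⟩ _ ⟨b, hb, rfl⟩

lemma fin_lists (T : Set σ.Thr) (hT : T.Finite) (m : ℕ) :
    {W : List (σ.Thr × Bool) | (∀ a ∈ W, a.1 ∈ T) ∧ W.length ≤ m}.Finite := by
  have := hT.to_subtype
  refine Set.Finite.subset ((List.finite_length_le (T × Bool) m).image
    (fun L => L.map fun a => (a.1.1, a.2))) ?_
  rintro W ⟨h1, h2⟩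
  refine ⟨W.attach.map (fun a => (⟨a.1.1, h1 a.1 a.2⟩, a.1.2)), by simpa using h2, ?_⟩
  simp only [List.map_map, Function.comp_def]
  exact List.attach_map_subtype_val W

lemma ev_src (T : Set σ.Thr) (hT : T.Finite) (m : ℕ) :
    ∀ᶠ k in atTop, ∀ x ∈ T, ∀ W ∈ {W : List (σ.Thr × Bool) | (∀ a ∈ W, a.1 ∈ T) ∧ W.length ≤ m},
      ∀ t, x.Eff k k (t, none) → wd (σ.γ k) (rl k W) * x.as k (x.l k) ≠ t := by
  rw [eventually_all_finite hT]; intro x hx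
  rw [eventually_all_finite (fin_lists T hT m)]; intro W hW
  exact ev_src1 x W

lemma fin_stage (N : ℕ) : {p : σ.X | p.1 < N}.Finite := by
  have : {p : σ.X | p.1 < N} ⊆ ⋃ k ∈ Finset.range N, Set.range (Sigma.mk k) := by
    rintro ⟨k, y⟩ h
    simp only [Set.mem_iUnion]
    exact ⟨k, Finset.mem_range.2 h, y, rfl⟩
  refine Set.Finite.subset ?_ this
  exact Set.Finite.biUnion (Finset.finite_toSet _) fun k _ => Set.finite_range _

structure WW (T : Set σ.Thr) (m N : ℕ) (M : List (σ.Thr × Bool)) (p : σ.X) : Prop where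
  mem : ∀ a ∈ M, a.1 ∈ T
  len : M.length = m
  red : FreeGroup.IsReduced (M ++ M)
  fix : wd h M p = p
  stg : ∀ M2, M2 <:+ M → N ≤ (wd h M2 p).1

lemma WW.rot {T : Set σ.Thr} {m N M1 M2 p} (hW : WW T m N (M1 ++ M2) p) :
    WW T m N (M2 ++ M1) (wd h M2 p) := by
  have hM1 : wd h M1 (wd h M2 p) = p := by
    have := hW.fix
    rwa [wd_append, Equiv.Perm.mul_apply] at this
  refine ⟨?_, ?_, ?_, ?_, ?_⟩
  · intro a ha
    apply hW.mem a
    rw [List.mem_append] at ha ⊢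
    exact ha.symm
  · rw [← hW.len]; simp [add_comm]
  · by_cases hn : M1 ++ M2 = []
    · simp only [List.append_eq_nil_iff] at hn
      rw [hn.1, hn.2]; simp
    · have := FreeGroup.IsReduced.append_overlap hW.red hW.red hn
      exact this.infix ⟨M1, M2, by simp⟩
  · rw [wd_append, Equiv.Perm.mul_apply, hM1]
  · intro T' hT'
    have hcase : T' <:+ M1 ∨ ∃ T2, T' = T2 ++ M1 ∧ T2 <:+ M2 := by
      rcases List.suffix_or_suffix_of_suffix hT' (List.suffix_append M2 M1) with h' | ⟨T2, h'⟩
      · exact Or.inl h'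
      · refine Or.inr ⟨T2, h'.symm, ?_⟩
        obtain ⟨u, hu⟩ := hT'
        rw [← h', ← List.append_assoc] at hu
        exact ⟨u, List.append_cancel_right hu⟩
    rcases hcase with h' | ⟨T2, rfl, hT2⟩
    · have := hW.stg (T' ++ M2) (by
        obtain ⟨u, hu⟩ := h'
        exact ⟨u, by simp [← hu]⟩)
      rwa [wd_append, Equiv.Perm.mul_apply] at this
    · rw [wd_append, Equiv.Perm.mul_apply, hM1]
      exact hW.stg T2 (hT2.trans (List.suffix_append _ _))

lemma WW.inv {T : Set σ.Thr} {m N M p} (hW : WW T m N M p) :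
    WW T m N (FreeGroup.invRev M) p := by
  refine ⟨?_, ?_, ?_, ?_, ?_⟩
  · intro a ha
    rw [FreeGroup.invRev, List.mem_reverse, List.mem_map] at ha
    obtain ⟨b, hb, rfl⟩ := ha
    exact hW.mem b hb
  · rw [FreeGroup.invRev_length, hW.len]
  · have := isReduced_rs_invRev hW.red
    rwa [FreeGroup.invRev_append] at this
  · rw [wd_invRev, Equiv.Perm.inv_eq_iff_eq, hW.fix]
  · intro T' hT'
    obtain ⟨u, hu⟩ := hT'
    have h1 : M = FreeGroup.invRev T' ++ FreeGroup.invRev u := by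
      rw [← FreeGroup.invRev_append, hu, FreeGroup.invRev_invRev]
    have h2 := hW.stg (FreeGroup.invRev u) ⟨_, h1.symm⟩
    have h3 := hW.fix
    rw [h1, wd_append, Equiv.Perm.mul_apply, wd_invRev h T', Equiv.Perm.inv_eq_iff_eq] at h3
    rwa [← h3]

lemma cof_A {T : Set σ.Thr} {m N : ℕ} (hm : m + 2 ≤ N)
    (hsep : ∀ k ≥ N, ∀ x ∈ T, ∀ y ∈ T, x.l k = y.l k → x = y)
    (hact : ∀ k ≥ N, ∀ x ∈ T, ∀ y ∈ T, (∃ i, σ.code i (x.α i) = k) →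
      (∃ i, σ.code i (y.α i) = k) → x.α = y.α)
    (hsrc : ∀ k ≥ N, ∀ x ∈ T,
      ∀ W ∈ {W : List (σ.Thr × Bool) | (∀ a ∈ W, a.1 ∈ T) ∧ W.length ≤ m + 2},
      ∀ t, x.Eff k k (t, none) → wd (σ.γ k) (rl k W) * x.as k (x.l k) ≠ t)
    {m0 : ℕ} (hmin : ∀ M p, WW T m N M p → m0 ≤ lev p)
    {M' : List (σ.Thr × Bool)} {a : σ.Thr × Bool} {p : σ.X} (hW : WW T m N (M' ++ [a]) p)
    (hmv : a.1.π (qq a p) ≠ qq a p) (hlow : a.1.Low (a.1.π (qq a p)) (qq a p))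
    (hz : lev (a.1.π (qq a p)) = m0) : False := by
  obtain ⟨z, hzdef⟩ : ∃ z, z = a.1.π (qq a p) := ⟨_, rfl⟩
  rw [← hzdef] at hz hlow hmv
  have hst : st a z = wd h [a] p := by
    rw [wd_single, hzdef]
    rcases a with ⟨a, _ | _⟩
    · rw [lt_h_false]; rfl
    · rw [lt_h_true]; rfl
  have hrot : WW T m N ([a] ++ M') (wd h [a] p) := hW.rot
  have hlevst : lev (st a z) = lev z := by rcases a with ⟨a, _ | _⟩ <;> rfl
  have hst1 : (st a z).1 = z.1 := by rcases a with ⟨a, _ | _⟩ <;> rfl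
  have hzN : N ≤ z.1 := by
    have := hrot.stg [] (List.nil_suffix)
    rwa [wd_nil, Equiv.Perm.one_apply, ← hst, hst1] at this
  have hlen : M'.length + 1 = m := by have := hW.len; simpa using this
  have hT : ∀ b ∈ a :: M' ++ [a], b.1 ∈ T := by
    intro b hb
    apply hW.mem b
    simp only [List.cons_append, List.mem_cons, List.mem_append] at hb ⊢
    tauto
  have haT : a.1 ∈ T := hT a (by simp)
  have hred : FreeGroup.IsReduced (rl z.1 (a :: M' ++ [a])) := by
    apply reduced_rl
    · exact hW.red.infix ⟨M', [], by simp⟩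
    · intro b hb c hc
      exact hsep _ hzN _ (hT b hb) _ (hT c hc)
  -- levels along the walk
  have hlev : ∀ L2, L2 <:+ [a] ++ M' → m0 ≤ lev (wd h L2 (st a z)) := by
    intro L2 ⟨u, hu⟩
    rw [hst]
    rw [← hu] at hrot
    exact hmin _ _ hrot.rot
  have key := prop z a ([a] ++ M') hred (by simp; omega) ?_
  · have h1 := key.2 a M' (List.suffix_refl _)
    have h2 : wd h M' (st a z) = p := by
      have := hW.fix
      rwa [wd_append, Equiv.Perm.mul_apply, ← hst] at this
    rw [h2, ← hzdef] at h1
    exact hmv h1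
  · intro b L2 U hs hq hU hne
    have hbT : b.1 ∈ T := hT b (by
      have := hs.subset (List.mem_cons_self)
      simp only [List.cons_append, List.mem_cons, List.mem_append] at this ⊢
      tauto)
    have hUT : ∀ c ∈ U, c.1 ∈ T := fun c hc => hT c (hU.subset hc)
    have hUlen : U.length ≤ m + 1 := by
      have := hU.length_le
      simp at this
      omega
    have hlq : m0 ≤ lev (b.1.π (wd e U z)) := by
      have := hlev _ hs
      rw [wd_cons, Equiv.Perm.mul_apply, lev_lt_h, hq] at this
      exact this
    have hR := (b.1.π_or (wd e U z)).resolve_left hne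
    clear hne hq hs hlev hst hmv hzdef
    generalize b.1.π (wd e U z) = w at hR hlq
    obtain ⟨v, hv⟩ : ∃ v, v = wd e U z := ⟨_, rfl⟩
    rw [← hv] at hR ⊢
    rw [wd_e_apply] at hv
    generalize qq a p = q0 at hlow
    cases hlow with
    | main K k t hE =>
      have hzk : (a.1.nn k).1 = k := rfl
      rw [lev_nn] at hz
      simp only [nn] at hv hzN
      rcases hR with hR | hR
      · cases hR with
        | main K' k' t' hE' =>
          obtain rfl : k' = k := congrArg Sigma.fst hv
          have hαe := hact k' hzN _ haT _ hbT hE.act hE'.act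
          have has : a.1.as k' = b.1.as k' := by rw [as, as, hαe]
          have h1 := eq_of_heq (Sigma.ext_iff.1 hv).2
          have h1 := (Prod.ext_iff.1 h1).1
          simp only [nn] at h1
          have h2 : a.1.l k' = b.1.l k' := by
            by_contra hne
            refine hE.sep _ _ hne (rl k' U) (by simp; omega) ?_
            exact h1.symm.trans (by rw [has])
          refine ⟨?_, h2.symm⟩
          rw [nn, nn, has, h2]
        | dup K' j' t' r' hE' h1 h2 h3 =>
          obtain rfl : r' = k := congrArg Sigma.fst hv
          have h1 := eq_of_heq (Sigma.ext_iff.1 hv).2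
          cases (Prod.ext_iff.1 h1).2
      · exfalso
        cases hR with
        | main K' k' t' hE' =>
          obtain rfl : K' = k := congrArg Sigma.fst hv
          have h1 := eq_of_heq (Sigma.ext_iff.1 hv).2
          have ht2 : t'.2 = none := (Prod.ext_iff.1 h1).2
          have h1 := (Prod.ext_iff.1 h1).1
          simp only [e_inv_apply] at h1
          rw [lev_nn] at hlq
          have := hE'.le
          obtain rfl : k' = K' := by omega
          have hαe := hact k' hzN _ haT _ hbT hE.act hE'.act
          have has : a.1.as k' = b.1.as k' := by rw [as, as, hαe]
          have h3 : wd (σ.γ k') (rl k' ((b.1, true) :: U)) * a.1.as k' (a.1.l k') = t'.1 := by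
            have h4 : wd (σ.γ k') (rl k' ((b.1, true) :: U)) =
              σ.γ k' (b.1.l k') * wd (σ.γ k') (rl k' U) := wd_cons _ _ _
            rw [h4, mul_assoc]
            exact (inv_mul_eq_iff_eq_mul.1 h1).symm
          by_cases h2 : a.1.l k' = b.1.l k'
          · rw [h2, has] at h3
            refine hsrc k' hzN _ hbT ((b.1, true) :: U) ⟨?_, by simpa using hUlen⟩ t'.1 ?_ h3
            · intro c hc
              rcases List.mem_cons.1 hc with rfl | hc
              · exact hbT
              · exact hUT c hc
            · rcases t' with ⟨t1, t2⟩
              simp only at ht2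
              rw [ht2] at hE'
              exact hE'
          · rw [has] at h3
            exact hE'.c4a rfl ht2 _ h2 (rl k' ((b.1, true) :: U)) (by simp; omega) h3
        | dup K' j' t' r' hE' h1 h2 h3 =>
          obtain rfl : K' = k := congrArg Sigma.fst hv
          have h1 := eq_of_heq (Sigma.ext_iff.1 hv).2
          cases (Prod.ext_iff.1 h1).2
    | dup K k t r hE hr1 hr2 hr3 =>
      rw [lev_DD] at hz
      simp only [DD] at hv hzN
      rcases hR with hR | hR
      · cases hR with
        | main K' k' t' hE' =>
          obtain rfl : k' = r := congrArg Sigma.fst hv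
          have h1 := eq_of_heq (Sigma.ext_iff.1 hv).2
          cases (Prod.ext_iff.1 h1).2
        | dup K' j' t' r' hE' h1 h2 h3 =>
          obtain rfl : r' = r := congrArg Sigma.fst hv
          have h1 := eq_of_heq (Sigma.ext_iff.1 hv).2
          have h1 := (Prod.ext_iff.1 h1).2
          simp only [DD, Option.some.injEq, Prod.mk.injEq] at h1
          refine ⟨?_, h1.1⟩
          simp only [DD, h1.1]
      · exfalso
        cases hR with
        | main K' k' t' hE' =>
          obtain rfl : K' = r := congrArg Sigma.fst hv
          rw [lev_nn] at hlq
          have := hE'.le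
          omega
        | dup K' j' t' r' hE' h1 h2 h3 =>
          obtain rfl : K' = r := congrArg Sigma.fst hv
          rw [lev_DD] at hlq
          omega

lemma cof_B {T : Set σ.Thr} {m N : ℕ} (hm : m + 2 ≤ N) (hm0 : 0 < m)
    (hsep : ∀ k ≥ N, ∀ x ∈ T, ∀ y ∈ T, x.l k = y.l k → x = y)
    (hact : ∀ k ≥ N, ∀ x ∈ T, ∀ y ∈ T, (∃ i, σ.code i (x.α i) = k) →
      (∃ i, σ.code i (y.α i) = k) → x.α = y.α)
    (hsrc : ∀ k ≥ N, ∀ x ∈ T,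
      ∀ W ∈ {W : List (σ.Thr × Bool) | (∀ a ∈ W, a.1 ∈ T) ∧ W.length ≤ m + 2},
      ∀ t, x.Eff k k (t, none) → wd (σ.γ k) (rl k W) * x.as k (x.l k) ≠ t)
    {M : List (σ.Thr × Bool)} {p : σ.X} (hW : WW T m N M p) : False := by
  classical
  have hex : ∃ n, ∃ M p, WW T m N M p ∧ lev p = n := ⟨_, M, p, hW, rfl⟩
  obtain ⟨M, p, hW, hlp⟩ := Nat.find_spec hex
  set m0 := Nat.find hex
  have hmin : ∀ M p, WW T m N M p → m0 ≤ lev p := fun M p h => Nat.find_min' hex ⟨M, p, h, rfl⟩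
  have hnm : ∀ M' a p, WW T m N (M' ++ [a]) p → lev p = m0 → a.1.π (qq a p) = qq a p := by
    intro M' a p hW hlp
    by_contra hmv
    have hR := (a.1.π_or (qq a p)).resolve_left hmv
    have hlevz : m0 ≤ lev (a.1.π (qq a p)) := by
      have := hmin _ _ hW.rot
      rwa [wd_single, lev_lt_h] at this
    rcases hR with hR | hR
    · -- invert
      have h1 : WW T m N (FreeGroup.invRev M' ++ [(a.1, !a.2)]) (lt h a p) := by
        have := hW.rot.inv
        rw [FreeGroup.invRev_append, wd_single] at this
        exact this
      have h2 : qq (a.1, !a.2) (lt h a p) = a.1.π (qq a p) := by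
        rcases a with ⟨a, _ | _⟩
        · rw [lt_h_false]; rfl
        · rw [lt_h_true]; simp [qq]
      refine cof_A hm hsep hact hsrc hmin h1 ?_ ?_ ?_
      · simp only [h2, π_invol]; exact fun hh => hmv hh.symm
      · simp only [h2, π_invol]; exact hR
      · simp only [h2, π_invol]; rw [lev_qq, hlp]
    · refine cof_A hm hsep hact hsrc hmin hW hmv hR ?_
      have := lev_low hR
      rw [lev_qq] at this
      omega
  have hwalk : ∀ L2, L2 <:+ M → wd h L2 p = wd e L2 p := by
    intro L2
    induction L2 with
    | nil => intro _; rfl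
    | cons a L2 ih =>
      intro hs
      have ih := ih ((List.suffix_cons a L2).trans hs)
      obtain ⟨u, hu⟩ := hs
      have hW' := hW
      rw [← hu, ← List.singleton_append, ← List.append_assoc] at hW'
      have hW2 := hW'.rot
      rw [← List.append_assoc] at hW2
      have := hnm _ _ _ hW2 (by rw [ih, wd_e_apply]; exact hlp)
      rw [wd_cons, wd_cons, Equiv.Perm.mul_apply, Equiv.Perm.mul_apply, lt_h_of_fix _ _ this, ih]
  have h1 := hwalk M (List.suffix_refl _)
  rw [hW.fix, wd_e_apply] at h1
  have h2 := eq_of_heq (Sigma.ext_iff.1 h1).2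
  have h2 := (Prod.ext_iff.1 h2).1
  have hpN : N ≤ p.1 := hW.stg [] List.nil_suffix
  have h3 := σ.girth p.1 (rl p.1 M) (by
    apply reduced_rl
    · exact hW.red.infix ⟨M, [], by simp⟩
    · intro b hb c hc
      exact hsep _ hpN _ (hW.mem b hb) _ (hW.mem c hc)) (by
      rw [rs_length, hW.len]; omega) (by simpa using h2.symm)
  rw [rs_eq_nil] at h3
  have := hW.len
  rw [h3] at this
  simp at this
  omega

lemma cof_C {M : List (σ.Thr × Bool)} (hM : M ≠ []) (hred : FreeGroup.IsReduced (M ++ M)) :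
    {p | wd h M p = p}.Finite := by
  let T : Set σ.Thr := {y | ∃ a ∈ M, a.1 = y}
  have hT : T.Finite := M.finite_toSet.image Prod.fst
  obtain ⟨N, hN⟩ := eventually_atTop.1 ((ev_sep T hT).and ((ev_act T hT).and
    ((ev_src T hT (M.length + 2)).and (eventually_ge_atTop (M.length + 2)))))
  have hsub : {p | wd h M p = p} ⊆ ⋃ L2 ∈ {L2 | L2 ∈ M.tails}, (⇑(wd h L2 : Equiv.Perm σ.X)) ⁻¹' {p | p.1 < N} := by
    intro p hp
    by_contra hcon
    simp only [Set.mem_iUnion, not_exists, List.mem_tails, Set.mem_ofPred_eq, Set.mem_preimage,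
      not_lt] at hcon
    exact cof_B (T := T) (m := M.length) (N := N) (hN N le_rfl).2.2.2
      (List.length_pos_iff.2 hM) (fun k hk => (hN k hk).1) (fun k hk => (hN k hk).2.1)
      (fun k hk => (hN k hk).2.2.1) (M := M) (p := p)
      ⟨fun a ha => ⟨a, ha, rfl⟩, rfl, hred, hp, hcon⟩
  refine Set.Finite.subset ?_ hsub
  refine Set.Finite.biUnion (List.finite_toSet _) fun L2 _ => ?_
  exact (fin_stage N).preimage (wd h L2).injective.injOn

lemma cofinitary (w : FreeGroup σ.Thr) (hw : w ≠ 1) :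
    {p | FreeGroup.lift h w p = p}.Finite := by
  classical
  have h0 := FreeGroup.reduceCyclically.conj_conjugator_reduceCyclically w.toWord
  have h1 := FreeGroup.reduceCyclically.isCyclicallyReduced (FreeGroup.isReduced_toWord (x := w))
  set M := FreeGroup.reduceCyclically w.toWord
  set C := FreeGroup.reduceCyclically.conjugator w.toWord
  have hM : M ≠ [] := by
    intro hM
    apply hw
    rw [hM] at h0
    rw [← FreeGroup.mk_toWord (x := w), ← h0, List.append_nil, ← FreeGroup.mul_mk,
      ← FreeGroup.inv_mk, mul_inv_cancel]
  have h2 := (h1.flatten_replicate 2).isReduced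
  have h3 : (List.replicate 2 M).flatten = M ++ M := by simp [List.replicate]
  rw [h3] at h2
  have h4 : FreeGroup.lift h w = wd h C * wd h M * (wd h C)⁻¹ := by
    conv_lhs => rw [← FreeGroup.mk_toWord (x := w), ← h0]
    rw [wd_lift, wd_append, wd_append, wd_invRev]
  refine ((cof_C hM h2).image (⇑(wd h C : Equiv.Perm σ.X))).subset ?_
  intro p hp
  refine ⟨(wd h C)⁻¹ p, ?_, by simp⟩
  have hp : FreeGroup.lift h w p = p := hp
  rw [h4] at hp
  have := congrArg (⇑(wd h C)⁻¹) hp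
  simpa [Equiv.Perm.mul_apply] using this
end Thr
end Sys

namespace Sys
namespace Thr
open Filter
variable {σ : Sys}

noncomputable abbrev _root_.Sys.UU : Ultrafilter ℕ := hyperfilter ℕ

lemma uu_const {β : Type*} [Finite β] (f : ℕ → β) : ∃ b, ∀ᶠ i in (UU : Filter ℕ), f i = b := by
  obtain ⟨b, hb⟩ := Ultrafilter.eq_pure_of_finite (UU.map f)
  refine ⟨b, ?_⟩
  have h1 : {b} ∈ UU.map f := by rw [hb]; exact Ultrafilter.mem_pure.2 rfl
  exact h1

lemma exists_lim (s : ℕ → σ.Thr) : ∃ x : σ.Thr, ∀ k, ∀ᶠ i in (UU : Filter ℕ), (s i).l k = x.l k := by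
  choose a ha using fun k => uu_const (fun i => (s i).l k)
  refine ⟨⟨fun k => (a k).1, fun k => (a k).2, ?_, ?_⟩, ha⟩
  · intro k
    obtain ⟨i, h1, h2⟩ := ((ha k).and (ha (k + 1))).exists
    rw [← h1, ← h2]; exact (s i).hα k
  · intro k
    obtain ⟨i, h1, h2⟩ := ((ha k).and (ha (k + 1))).exists
    rw [← h1, ← h2]; exact (s i).hq k

noncomputable def lim (s : ℕ → σ.Thr) : σ.Thr := (exists_lim s).choose
lemma lim_spec (s : ℕ → σ.Thr) (k) : ∀ᶠ i in (UU : Filter ℕ), (s i).l k = (lim s).l k :=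
  (exists_lim s).choose_spec k

lemma Eff.congr {x y : σ.Thr} {K j t} (hE : x.Eff K j t) (hl : y.l (K + 1) = x.l (K + 1)) :
    y.Eff K j t := by
  have hj := hE.le
  have hK : y.l K = x.l K := l_anti (by omega) hl
  have has : ∀ i ≤ K, y.as i = x.as i := fun i hi => as_congr (l_anti (by omega) hl)
  have har : ∀ i ≤ K, y.ar i = x.ar i := fun i hi => ar_congr (l_anti (by omega) hl)
  refine ⟨?_, ?_, ?_, ?_, ?_, ?_⟩
  · rw [har K le_rfl]; exact hE.ar
  · intro i h1 h2
    rw [har i h2.le]; exact hE.gap i h1 h2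
  · obtain ⟨i, hi⟩ := hE.act
    have h1 := σ.code_le i (x.α i)
    have h2 : y.l i = x.l i := l_anti (by omega) hl
    refine ⟨i, ?_⟩
    have : y.α i = x.α i := (Prod.ext_iff.1 h2).1
    rw [this, hi]
  · rw [has j hj]; exact hE.sep
  · rw [has K le_rfl, hK]; exact hE.c4a
  · intro h1 h2 K' h3 t'
    rw [has K le_rfl, hK, has K' h3.le, har K' h3.le, l_anti (x := y) (y := x) (k := K') (by omega) hK]
    exact hE.c4b h1 h2 K' h3 t'

lemma R_data {x : σ.Thr} {p p'} (hR : x.R p p') : ∃ K j t, x.Eff K j t ∧ j ≤ p.1 ∧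
    ∀ y : σ.Thr, y.l (K + 1) = x.l (K + 1) → y.R p p' := by
  have key : ∀ p p', x.Low p p' → ∃ K j t, x.Eff K j t ∧ j ≤ p.1 ∧ j ≤ p'.1 ∧
      ∀ y : σ.Thr, y.l (K + 1) = x.l (K + 1) → y.Low p p' := by
    intro p p' hL
    cases hL with
    | main K j t hE =>
      refine ⟨K, j, t, hE, le_rfl, hE.le, ?_⟩
      intro y hy
      have := Low.main K j t (hE.congr hy)
      have hj := hE.le
      have e1 : y.nn j = x.nn j := by
        rw [nn, nn, as_congr (l_anti (by omega) hy), l_anti (k := j) (by omega) hy]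
      have e2 : (y.e)⁻¹ ⟨K, t⟩ = (x.e)⁻¹ ⟨K, t⟩ := by
        rw [e_inv_apply, e_inv_apply]; simp only [l_anti (k := K) (by omega) hy]
      rwa [e1, e2] at this
    | dup K j t r hE h1 h2 h3 =>
      refine ⟨K, j, t, hE, h1, hE.le, ?_⟩
      intro y hy
      have hK : y.l K = x.l K := l_anti (by omega) hy
      have hr : y.l r = x.l r := l_anti (by omega) hy
      have := Low.dup K j t r (hE.congr hy) h1 h2 (by rw [hK]; exact h3)
      simp only [DD] at this ⊢
      rwa [hK, hr] at this
  rcases hR with hR | hR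
  · obtain ⟨K, j, t, h1, h2, h3, h4⟩ := key _ _ hR
    exact ⟨K, j, t, h1, h2, fun y hy => Or.inl (h4 y hy)⟩
  · obtain ⟨K, j, t, h1, h2, h3, h4⟩ := key _ _ hR
    exact ⟨K, j, t, h1, h3, fun y hy => Or.inr (h4 y hy)⟩

def Div (s : ℕ → σ.Thr) : Prop :=
  ∃ k, ∀ B, ∀ᶠ i in (UU : Filter ℕ), ∃ K > B, ∃ j ≤ k, ∃ t, (s i).Eff K j t

lemma conv_π {s : ℕ → σ.Thr} (hs : ¬ Div s) (p : σ.X) :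
    ∀ᶠ i in (UU : Filter ℕ), (s i).π p = (lim s).π p := by
  simp only [Div, not_exists, not_forall] at hs
  obtain ⟨B, hB⟩ := hs p.1
  rw [← Ultrafilter.eventually_not] at hB
  rcases (lim s).π_or p with h1 | h1
  · filter_upwards [hB, lim_spec s (B + 1)] with i h2 h3
    rcases (s i).π_or p with h4 | h4
    · rw [h1, h4]
    · obtain ⟨K, j, t, h5, h6, h7⟩ := R_data h4
      have hK : K ≤ B := by
        by_contra hK
        exact h2 ⟨K, by omega, j, h6, t, h5⟩
      exact (π_eq (h7 (lim s) (l_anti (by omega) h3.symm))).symm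
  · obtain ⟨K, j, t, h5, h6, h7⟩ := R_data h1
    filter_upwards [lim_spec s (K + 1)] with i hi
    exact π_eq (h7 _ hi)

lemma conv_lt {s : ℕ → σ.Thr} (hs : ¬ Div s) (b : Bool) (p : σ.X) :
    ∀ᶠ i in (UU : Filter ℕ), lt h (s i, b) p = lt h (lim s, b) p := by
  cases b with
  | true =>
    filter_upwards [conv_π hs p, lim_spec s ((lim s).π p).1] with i h1 h2
    rw [lt_h_true, lt_h_true, h1, e_apply, e_apply, h2]
  | false =>
    filter_upwards [conv_π hs ((lim s).e⁻¹ p), lim_spec s p.1] with i h1 h2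
    rw [lt_h_false, lt_h_false, ← h1, e_inv_apply, e_inv_apply, h2]

abbrev ev (LL : List ((ℕ → σ.Thr) × Bool)) (i : ℕ) : List (σ.Thr × Bool) :=
  rs (fun s : ℕ → σ.Thr => s i) LL
noncomputable abbrev limL (LL : List ((ℕ → σ.Thr) × Bool)) : List (σ.Thr × Bool) := rs lim LL

lemma conv_wd {LL : List ((ℕ → σ.Thr) × Bool)} (hs : ∀ a ∈ LL, ¬ Div a.1) (p : σ.X) :
    ∀ᶠ i in (UU : Filter ℕ), wd h (ev LL i) p = wd h (limL LL) p := by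
  induction LL with
  | nil => exact Eventually.of_forall fun i => rfl
  | cons a LL ih =>
    filter_upwards [ih fun b hb => hs b (List.mem_cons_of_mem _ hb),
      conv_lt (hs a List.mem_cons_self) a.2 (wd h (limL LL) p)] with i h1 h2
    simp only [ev, limL, rs_cons, wd_cons, Equiv.Perm.mul_apply] at h1 h2 ⊢
    rw [h1, h2]

lemma conv_rl (LL : List ((ℕ → σ.Thr) × Bool)) (N : ℕ) :
    ∀ᶠ i in (UU : Filter ℕ), rl N (ev LL i) = rl N (limL LL) := by
  induction LL with
  | nil => exact Eventually.of_forall fun i => rfl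
  | cons a LL ih =>
    filter_upwards [ih, lim_spec a.1 N] with i h1 h2
    simp only [rl, ev, limL, rs_cons] at h1 h2 ⊢
    rw [h1, h2]

lemma reduced_up {L : List (σ.Thr × Bool)} {N K : ℕ} (hNK : N ≤ K)
    (hL : FreeGroup.IsReduced (rl N L)) : FreeGroup.IsReduced (rl K L) := by
  unfold FreeGroup.IsReduced rl rs at hL ⊢
  rw [List.isChain_map] at hL ⊢
  exact hL.imp (fun a b hab hl => hab (l_anti hNK hl))

lemma split_last {β : Type*} (P : β → Prop) (L : List β) (hL : ∃ a ∈ L, P a) :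
    ∃ LA a LB, L = LA ++ a :: LB ∧ P a ∧ ∀ b ∈ LB, ¬ P b := by
  induction L with
  | nil => simp at hL
  | cons c L ih =>
    by_cases h1 : ∃ a ∈ L, P a
    · obtain ⟨LA, a, LB, h2, h3, h4⟩ := ih h1
      exact ⟨c :: LA, a, LB, by simp [h2], h3, h4⟩
    · obtain ⟨a, ha, hP⟩ := hL
      rcases List.mem_cons.1 ha with rfl | ha
      · refine ⟨[], a, L, rfl, hP, ?_⟩
        intro b hb hPb
        exact h1 ⟨b, hb, hPb⟩
      · exact absurd ⟨a, ha, hP⟩ h1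

/-- core step of the closedness argument, for one index -/
lemma div_core (LA : List (σ.Thr × Bool)) (x : σ.Thr) (b : Bool) {N K j k : ℕ} {t : σ.Y K}
    (hred : FreeGroup.IsReduced (rl N (LA ++ [(x, b)]))) (hE : x.Eff K j t) (hjk : j ≤ k)
    (hNK : N ≤ K) (hmK : k + LA.length + 2 ≤ K) :
    ∃ r, k ≤ r ∧ r ≤ k + LA.length + 1 ∧
      (wd h (LA ++ [(x, b)]) (cond b (x.DD r r) (x.e (x.DD r r)))).1 = K := by
  classical
  let bad : σ.Thr → ℕ := fun y => match y.ar K with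
    | some (_, (_, some (_, ρ))) => ρ.val
    | _ => 0
  have hbad : ∀ (y : σ.Thr) j' t' s r, r ≤ K → y.ar K = some (j', t') →
      t'.2 = some (s, Fin.ofNat (K + 1) r) → bad y = r := by
    intro y j' t' s r hr h1 h2
    obtain ⟨t1, t2⟩ := t'
    simp only at h2
    subst h2
    simp only [bad, h1, Fin.ofNat]
    exact Nat.mod_eq_of_lt (by omega)
  let F : Finset ℕ := ((LA ++ [(x, b)]).map fun a => bad a.1).toFinset
  have hF : F.card < (Finset.Icc k (k + LA.length + 1)).card := by
    have h1 : F.card ≤ _ := List.toFinset_card_le _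
    simp only [List.length_map, List.length_append, List.length_singleton] at h1
    rw [Nat.card_Icc]; omega
  obtain ⟨r, hr1, hr2⟩ := Finset.exists_mem_notMem_of_card_lt_card hF
  rw [Finset.mem_Icc] at hr1
  have hr3 : ∀ a ∈ LA ++ [(x, b)], bad a.1 ≠ r := by
    intro a ha hb
    apply hr2
    rw [List.mem_toFinset, List.mem_map]
    exact ⟨a, ha, hb⟩
  refine ⟨r, hr1.1, hr1.2, ?_⟩
  have hLow : x.Low (x.DD r r) (x.DD K r) := by
    refine Low.dup K j t r hE (by omega) (by omega) ?_
    intro ht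
    exact hr3 (x, b) (by simp) (hbad x j t _ r (by omega) hE.ar ht)
  have hst : wd h [(x, b)] (cond b (x.DD r r) (x.e (x.DD r r))) = st (x, b) (x.DD K r) := by
    rw [wd_single]
    cases b with
    | true => rw [lt_h_true]; simp only [cond_true, st]; rw [π_eq (Or.inl hLow)]
    | false =>
      have h1 : (x.e)⁻¹ (x.e (x.DD r r)) = x.DD r r := x.e.symm_apply_apply _
      rw [lt_h_false]; simp only [cond_false, st]
      rw [h1, π_eq (Or.inl hLow)]
  rw [wd_append, Equiv.Perm.mul_apply, hst]
  have key := prop (x.DD K r) (x, b) LA (reduced_up hNK hred)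
    (by show LA.length + 1 ≤ 2 * K + 2; omega) ?_
  · rw [key.1, wd_e_apply]
    cases b <;> rfl
  · intro a L2 U hs hq hU hne
    have haL : a ∈ LA := hs.subset List.mem_cons_self
    have hR := (a.1.π_or (wd e U (x.DD K r))).resolve_left hne
    clear hne hq
    generalize a.1.π (wd e U (x.DD K r)) = w at hR
    obtain ⟨v, hv⟩ : ∃ v, v = wd e U (x.DD K r) := ⟨_, rfl⟩
    rw [← hv] at hR ⊢
    rw [wd_e_apply] at hv
    simp only [DD] at hv
    rcases hR with hR | hR
    · exfalso
      cases hR with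
      | main K' j' t' hE' =>
        obtain rfl : j' = K := congrArg Sigma.fst hv
        have h1 := eq_of_heq (Sigma.ext_iff.1 hv).2
        cases (Prod.ext_iff.1 h1).2
      | dup K' j' t' r' hE' h1 h2 h3 =>
        obtain rfl : r' = K := congrArg Sigma.fst hv
        have h1 := eq_of_heq (Sigma.ext_iff.1 hv).2
        have h1 := (Prod.ext_iff.1 h1).2
        simp only [DD, Option.some.injEq, Prod.mk.injEq] at h1
        have := ofNat_inj (by omega) (by omega) h1.2
        omega
    · cases hR with
      | main K' j' t' hE' =>
        exfalso
        obtain rfl : K' = K := congrArg Sigma.fst hv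
        have h1 := eq_of_heq (Sigma.ext_iff.1 hv).2
        have h1 : t'.2 = _ := (Prod.ext_iff.1 h1).2
        exact hr3 a (by simp [haL]) (hbad a.1 j' t' _ r (by omega) hE'.ar h1)
      | dup K' j' t' r' hE' h1 h2 h3 =>
        obtain rfl : K' = K := congrArg Sigma.fst hv
        have h1 := eq_of_heq (Sigma.ext_iff.1 hv).2
        have h1 := (Prod.ext_iff.1 h1).2
        simp only [DD, Option.some.injEq, Prod.mk.injEq] at h1
        refine ⟨?_, h1.1⟩
        simp only [DD, h1.1, h1.2]

lemma no_div {LL : List ((ℕ → σ.Thr) × Bool)} {N : ℕ} {g : σ.X → σ.X}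
    (hred : ∀ i, FreeGroup.IsReduced (rl N (ev LL i)))
    (hg : ∀ p, ∀ᶠ i in (UU : Filter ℕ), wd h (ev LL i) p = g p) : ∀ a ∈ LL, ¬ Div a.1 := by
  by_contra hcon
  push Not at hcon
  obtain ⟨LA, ⟨s, b⟩, LB, rfl, ⟨k, hdiv⟩, hLB⟩ :=
    split_last (fun a : (ℕ → σ.Thr) × Bool => Div a.1) LL hcon
  let x := lim s
  let c : ℕ → σ.X := fun r => cond b (x.DD r r) (x.e (x.DD r r))
  let y : ℕ → σ.X := fun r => (wd h (limL LB))⁻¹ (c r)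
  let I := Finset.Icc k (k + LA.length + 1)
  let B := (I.sup fun r => (g (y r)).1) + N + k + LA.length + 2
  have h1 : ∀ᶠ i in (UU : Filter ℕ), ∀ r ∈ I, wd h (ev LB i) (y r) = c r := by
    rw [Finset.eventually_all]
    intro r _
    filter_upwards [conv_wd hLB (y r)] with i hi
    rw [hi]; simp [y]
  have h2 : ∀ᶠ i in (UU : Filter ℕ), ∀ r ∈ I,
      wd h (ev (LA ++ (s, b) :: LB) i) (y r) = g (y r) := by
    rw [Finset.eventually_all]
    intro r _
    exact hg (y r)
  obtain ⟨i, h1, h2, h3, K, hK, j, hj, t, hE⟩ :=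
    (h1.and (h2.and ((lim_spec s (k + LA.length + 2)).and (hdiv B)))).exists
  have hev : ev (LA ++ (s, b) :: LB) i = (ev LA i ++ [(s i, b)]) ++ ev LB i := by simp [ev]
  have hr := hred i
  rw [hev] at hr
  obtain ⟨r, hr1, hr2, hr3⟩ := div_core (ev LA i) (s i) b (N := N)
    (hr.infix ⟨[], rl N (ev LB i), by simp [rl]⟩) hE hj (by omega) (by simp; omega)
  simp only [ev, rs_length] at hr2
  have hrI : r ∈ I := Finset.mem_Icc.2 ⟨hr1, hr2⟩
  have h4 := h2 r hrI
  rw [hev, wd_append, Equiv.Perm.mul_apply, h1 r hrI] at h4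
  have hlr : (s i).l r = x.l r := l_anti (by omega) h3
  have hc : c r = cond b ((s i).DD r r) ((s i).e ((s i).DD r r)) := by
    simp only [c, DD, e_apply, hlr]
  rw [hc] at h4
  rw [h4] at hr3
  have := Finset.le_sup (f := fun r => (g (y r)).1) hrI
  simp only [B] at hK
  omega

lemma exists_LL (β : List Bool) : ∀ G : ℕ → List (σ.Thr × Bool),
    (∀ i, (G i).map Prod.snd = β) → ∃ LL : List ((ℕ → σ.Thr) × Bool),
      LL.map Prod.snd = β ∧ ∀ i, G i = ev LL i := by
  induction β with
  | nil =>
    intro G hG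
    refine ⟨[], rfl, fun i => by simpa using hG i⟩
  | cons b β ih =>
    intro G hG
    have h1 : ∀ i, ∃ x L, G i = (x, b) :: L ∧ L.map Prod.snd = β := by
      intro i
      have h2 := hG i
      rw [List.map_eq_cons_iff] at h2
      obtain ⟨⟨x, b'⟩, L, h3, h4, h5⟩ := h2
      simp only at h4
      subst h4
      exact ⟨x, L, h3, h5⟩
    choose s L hs hL using h1
    obtain ⟨LL, h2, h3⟩ := ih L hL
    refine ⟨(s, b) :: LL, by simp [h2], fun i => ?_⟩
    rw [hs i, h3 i]; rfl

def CC (σ : Sys) (β : List Bool) (N : ℕ) : Set (σ.X → σ.X) :=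
  {f | ∃ L : List (σ.Thr × Bool), L.map Prod.snd = β ∧ FreeGroup.IsReduced (rl N L) ∧
    f = ⇑(wd h L)}

lemma CC_closed (β : List Bool) (N : ℕ) (G : ℕ → σ.X → σ.X) (hG : ∀ i, G i ∈ CC σ β N)
    (g : σ.X → σ.X) (hg : ∀ p, ∀ᶠ i in atTop, G i p = g p) : g ∈ CC σ β N := by
  choose L h1 h2 h3 using hG
  obtain ⟨LL, h4, h5⟩ := exists_LL β L h1
  have hg' : ∀ p, ∀ᶠ i in (UU : Filter ℕ), wd h (ev LL i) p = g p := by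
    intro p
    have := (hg p).filter_mono Nat.hyperfilter_le_atTop
    refine this.mono fun i hi => ?_
    rw [← hi, h3 i, h5 i]
  have hnd := no_div (N := N) (fun i => by rw [← h5 i]; exact h2 i) hg'
  refine ⟨limL LL, ?_, ?_, ?_⟩
  · rw [← h4]; simp [limL, rs, Function.comp_def]
  · obtain ⟨i, hi⟩ := (conv_rl LL N).exists
    rw [← hi, ← h5 i]; exact h2 i
  · funext p
    obtain ⟨i, hi, hi'⟩ := ((conv_wd hnd p).and (hg' p)).exists
    rw [← hi, ← hi']

lemma range_eq_CC : {f : σ.X → σ.X | ∃ w : FreeGroup σ.Thr, f = ⇑(FreeGroup.lift h w)} =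
    ⋃ βN : List Bool × ℕ, CC σ βN.1 βN.2 := by
  classical
  ext f
  simp only [Set.mem_iUnion]
  constructor
  · rintro ⟨w, rfl⟩
    obtain ⟨N, hN⟩ := (ev_sep (σ := σ) {y | ∃ a ∈ w.toWord, a.1 = y}
      (w.toWord.finite_toSet.image Prod.fst)).exists
    refine ⟨⟨w.toWord.map Prod.snd, N⟩, w.toWord, rfl, ?_, ?_⟩
    · refine reduced_rl FreeGroup.isReduced_toWord ?_
      intro a ha b hb
      exact hN _ ⟨a, ha, rfl⟩ _ ⟨b, hb, rfl⟩
    · rw [← wd_lift, FreeGroup.mk_toWord]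
  · rintro ⟨⟨β, N⟩, L, h1, h2, rfl⟩
    exact ⟨FreeGroup.mk L, by rw [wd_lift]⟩
end Thr
end Sys

lemma greedy {α : Type*} [DecidableEq α] (d : ℕ) (nb : α → Finset α) (hd : ∀ a, (nb a).card ≤ d)
    (n : ℕ) : ∀ C : Finset α, n * (d + 1) ≤ C.card →
      ∃ T ⊆ C, T.card = n ∧ ∀ a ∈ T, ∀ b ∈ T, a ≠ b → b ∉ nb a ∨ a ∉ nb b := by
  induction n with
  | zero => intro C _; exact ⟨∅, by simp, by simp, by simp⟩
  | succ n ih =>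
    intro C hC
    have hne : C.Nonempty := by
      rw [← Finset.card_pos]
      have : 0 < (n + 1) * (d + 1) := by positivity
      omega
    obtain ⟨a, ha⟩ := hne
    have h1 : n * (d + 1) ≤ (C \ insert a (nb a)).card := by
      have h2 := Finset.le_card_sdiff (insert a (nb a)) C
      have h3 := Finset.card_insert_le a (nb a)
      have h4 := hd a
      have h5 : (n + 1) * (d + 1) = n * (d + 1) + (d + 1) := by ring
      omega
    obtain ⟨T, hT1, hT2, hT3⟩ := ih _ h1
    have haT : a ∉ T := fun h => by
      have := hT1 h
      simp at this
    refine ⟨insert a T, ?_, ?_, ?_⟩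
    · intro b hb
      rcases Finset.mem_insert.1 hb with rfl | hb
      · exact ha
      · exact (Finset.mem_sdiff.1 (hT1 hb)).1
    · rw [Finset.card_insert_of_notMem haT, hT2]
    · have key : ∀ b ∈ T, b ∉ nb a := by
        intro b hb h
        have := (Finset.mem_sdiff.1 (hT1 hb)).2
        exact this (Finset.mem_insert_of_mem h)
      intro b hb c hc hbc
      rcases Finset.mem_insert.1 hb with hb1 | hb1
      · rcases Finset.mem_insert.1 hc with hc1 | hc1
        · exact absurd (hb1.trans hc1.symm) hbc
        · subst hb1; exact Or.inl (key c hc1)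
      · rcases Finset.mem_insert.1 hc with hc1 | hc1
        · subst hc1; exact Or.inr (key b hb1)
        · exact hT3 b hb1 c hc1 hbc

namespace Sys
variable {σ : Sys}

def sr (k : ℕ) (g : σ.Γ k) : σ.X := ⟨k, g, none⟩
lemma sr_inj {k : ℕ} {g g' : σ.Γ k} (h : sr k g = sr k g') : g = g' := by
  have := eq_of_heq (Sigma.ext_iff.1 h).2
  exact (Prod.ext_iff.1 this).1

def Sep (k : ℕ) (a : σ.S k → σ.Γ k) : Prop :=
  ∀ s s', s ≠ s' → ∀ L : List (σ.S k × Bool), L.length ≤ k + 1 → wd (σ.γ k) L * a s ≠ a s'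
def clU (f : σ.X → σ.X) (k : ℕ) (a : σ.S k → σ.Γ k) : Prop :=
  ∀ s, k ≤ (f (sr k (a s))).1 ∧ ∀ t, f (sr k (a s)) ≠ sr k t
def clN (f : σ.X → σ.X) (k : ℕ) (a : σ.S k → σ.Γ k) : Prop :=
  ∀ s, ∃ t, f (sr k (a s)) = sr k t ∧
    ∀ s', ∀ L : List (σ.S k × Bool), L.length ≤ k + 1 → wd (σ.γ k) L * a s' ≠ t
def clW (f : σ.X → σ.X) (k : ℕ) (a : σ.S k → σ.Γ k) (w : List (σ.S k × Bool)) : Prop :=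
  ∀ s, f (sr k (a s)) = sr k (wd (σ.γ k) w * a s) ∧
    ∀ s', s' ≠ s → ∀ L : List (σ.S k × Bool), L.length ≤ k + 1 →
      wd (σ.γ k) L * a s' ≠ wd (σ.γ k) w * a s

lemma card_stage (k : ℕ) : {p : σ.X | p.1 < k}.ncard ≤ σ.sz k := by
  induction k with
  | zero => simp
  | succ k ih =>
    have h1 : {p : σ.X | p.1 < k + 1} = {p : σ.X | p.1 < k} ∪ Set.range (Sigma.mk k) := by
      ext ⟨i, y⟩
      constructor
      · intro h
        have h : i < k + 1 := h
        rcases Nat.lt_succ_iff_lt_or_eq.1 h with h | rfl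
        · exact Or.inl h
        · exact Or.inr ⟨y, rfl⟩
      · rintro (h | ⟨y', h⟩)
        · exact Nat.lt_succ_of_lt h
        · have : k = i := congrArg Sigma.fst h
          show i < k + 1
          omega
    rw [h1, σ.sz_succ]
    refine (Set.ncard_union_le _ _).trans (Nat.add_le_add ih ?_)
    rw [← Set.image_univ]
    refine (Set.ncard_image_le Set.finite_univ).trans ?_
    rw [Set.ncard_univ]

lemma counting (f : σ.X → σ.X) (hf : Function.Injective f) (k : ℕ) :
    ∃ a : σ.S k → σ.Γ k, Sep k a ∧ (clU f k a ∨ clN f k a ∨ ∃ w, clW f k a w) := by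
  classical
  let Wd := {L : List (σ.S k × Bool) // L.length ≤ k + 1}
  have : Finite Wd := List.finite_length_le _ _
  have : Fintype Wd := Fintype.ofFinite _
  have : Fintype (σ.Γ k) := Fintype.ofFinite _
  have : Fintype (σ.S k) := Fintype.ofFinite _
  let v : Wd → σ.Γ k := fun L => wd (σ.γ k) L.1
  let tF : σ.Γ k → σ.Γ k := fun g => if h : ∃ t, f (sr k g) = sr k t then h.choose else 1
  have htF : ∀ g t, f (sr k g) = sr k t → tF g = t := by
    intro g t h
    have h1 : ∃ t, f (sr k g) = sr k t := ⟨t, h⟩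
    simp only [tF, dif_pos h1]
    exact sr_inj (h1.choose_spec.symm.trans h)
  let iF : σ.Γ k → σ.Γ k := fun t => if h : ∃ g, f (sr k g) = sr k t then h.choose else 1
  have hiF : ∀ g t, f (sr k g) = sr k t → iF t = g := by
    intro g t h
    have h1 : ∃ g, f (sr k g) = sr k t := ⟨g, h⟩
    simp only [iF, dif_pos h1]
    exact sr_inj (hf (h1.choose_spec.trans h.symm))
  let nb : σ.Γ k → Finset (σ.Γ k) := fun g =>
    (Finset.univ.image (fun L => v L * g) ∪ Finset.univ.image (fun L => (v L)⁻¹ * g)) ∪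
    (Finset.univ.image (fun L => iF (v L * g)) ∪ Finset.univ.image (fun L => (v L)⁻¹ * tF g))
  have hW : (Finset.univ : Finset Wd).card = nW (σ.S k) k := by
    rw [Finset.card_univ, nW, Nat.card_eq_fintype_card]
  have hnb : ∀ g, (nb g).card ≤ 4 * nW (σ.S k) k := by
    intro g
    have h1 := fun F : Wd → σ.Γ k => (Finset.card_image_le (s := Finset.univ) (f := F))
    rw [hW] at h1
    refine (Finset.card_union_le _ _).trans ?_
    have h2 := Finset.card_union_le (Finset.univ.image (fun L => v L * g))
      (Finset.univ.image (fun L => (v L)⁻¹ * g))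
    have h3 := Finset.card_union_le (Finset.univ.image (fun L => iF (v L * g)))
      (Finset.univ.image (fun L => (v L)⁻¹ * tF g))
    have := h1 (fun L => v L * g)
    have := h1 (fun L => (v L)⁻¹ * g)
    have := h1 (fun L => iF (v L * g))
    have := h1 (fun L => (v L)⁻¹ * tF g)
    omega
  -- the points with image in stage at least `k`
  let G1 : Finset (σ.Γ k) := Finset.univ.filter fun g => k ≤ (f (sr k g)).1
  have hG1 : Fintype.card (σ.Γ k) ≤ G1.card + σ.sz k := by
    rw [← Finset.card_univ, ← Finset.card_filter_add_card_filter_not (s := Finset.univ)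
      (fun g : σ.Γ k => k ≤ (f (sr k g)).1)]
    refine Nat.add_le_add_left ?_ _
    refine le_trans ?_ (card_stage (σ := σ) k)
    rw [← Set.ncard_coe_finset]
    refine Set.ncard_le_ncard_of_injOn (fun g => f (sr k g)) ?_ ?_ (Thr.fin_stage k)
    · intro g hg
      have := (Finset.mem_filter.1 hg).2
      show (f (sr k g)).1 < k
      omega
    · intro g _ g' _ h
      exact sr_inj (hf h)
  let col : σ.Γ k → Option (Option Wd) := fun g =>
    if ∃ t, f (sr k g) = sr k t then
      if h : ∃ L : Wd, f (sr k g) = sr k (v L * g) then some (some h.choose) else some none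
    else none
  have hcol : ∃ c, Nat.card (σ.S k) * (4 * nW (σ.S k) k + 1) ≤
      (G1.filter fun g => col g = c).card := by
    have h1 := Finset.exists_le_card_fiber_of_mul_le_card_of_maps_to (s := G1)
      (t := Finset.univ) (f := col) (n := Nat.card (σ.S k) * (4 * nW (σ.S k) k + 1))
      (fun _ _ => Finset.mem_univ _) Finset.univ_nonempty (by
        have h2 := σ.big k
        rw [nBig, Nat.card_eq_fintype_card (α := σ.Γ k)] at h2
        rw [Finset.card_univ, Fintype.card_option, Fintype.card_option, ← Finset.card_univ, hW]
        change σ.sz k + (nW (σ.S k) k + 2) * (Nat.card (σ.S k) * (4 * nW (σ.S k) k + 1)) ≤ _ at h2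
        have h3 : (nW (σ.S k) k + 1 + 1) = nW (σ.S k) k + 2 := rfl
        rw [h3]
        omega)
    obtain ⟨c, -, hc⟩ := h1
    exact ⟨c, hc⟩
  obtain ⟨c, hc⟩ := hcol
  obtain ⟨T, hT1, hT2, hT3⟩ := greedy _ nb hnb _ _ hc
  have eqv : σ.S k ≃ T := Fintype.equivOfCardEq (by
    rw [Fintype.card_coe, hT2, Nat.card_eq_fintype_card])
  let a : σ.S k → σ.Γ k := fun s => (eqv s).1
  have ha : ∀ s, a s ∈ T := fun s => (eqv s).2
  have hainj : ∀ s s', s ≠ s' → a s ≠ a s' := fun s s' h h' =>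
    h (eqv.injective (Subtype.ext h'))
  have haG : ∀ s, k ≤ (f (sr k (a s))).1 := fun s =>
    (Finset.mem_filter.1 (Finset.mem_filter.1 (hT1 (ha s))).1).2
  have hac : ∀ s, col (a s) = c := fun s => (Finset.mem_filter.1 (hT1 (ha s))).2
  have hconf : ∀ s s', s ≠ s' → ¬ (a s' ∈ nb (a s) ∧ a s ∈ nb (a s')) := by
    intro s s' h ⟨h1, h2⟩
    rcases hT3 _ (ha s) _ (ha s') (hainj s s' h) with h3 | h3
    · exact h3 h1
    · exact h3 h2
  have hsep : Sep k a := by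
    intro s s' hs L hL he
    refine hconf s s' hs ⟨?_, ?_⟩
    · refine Finset.mem_union_left _ (Finset.mem_union_left _ (Finset.mem_image.2 ?_))
      exact ⟨⟨L, hL⟩, Finset.mem_univ _, he⟩
    · refine Finset.mem_union_left _ (Finset.mem_union_right _ (Finset.mem_image.2 ?_))
      exact ⟨⟨L, hL⟩, Finset.mem_univ _, by simp only [v]; rw [← he]; simp⟩
  have hsep2 : ∀ s s' t, s' ≠ s → f (sr k (a s)) = sr k t →
      ∀ L : List (σ.S k × Bool), L.length ≤ k + 1 → wd (σ.γ k) L * a s' ≠ t := by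
    intro s s' t hs hft L hL he
    refine hconf s' s hs ⟨?_, ?_⟩
    · refine Finset.mem_union_right _ (Finset.mem_union_left _ (Finset.mem_image.2 ?_))
      exact ⟨⟨L, hL⟩, Finset.mem_univ _, by simp only [v]; rw [he, hiF _ _ hft]⟩
    · refine Finset.mem_union_right _ (Finset.mem_union_right _ (Finset.mem_image.2 ?_))
      exact ⟨⟨L, hL⟩, Finset.mem_univ _, by simp only [v]; rw [htF _ _ hft, ← he]; simp⟩
  refine ⟨a, hsep, ?_⟩
  rcases c with _ | _ | w
  · left
    intro s
    refine ⟨haG s, ?_⟩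
    intro t ht
    have := hac s
    simp only [col] at this
    rw [if_pos ⟨t, ht⟩] at this
    split_ifs at this
  · right; left
    intro s
    have := hac s
    simp only [col] at this
    split_ifs at this with h1 h2
    · simp at this
    · obtain ⟨t, ht⟩ := h1
      refine ⟨t, ht, ?_⟩
      intro s' L hL
      by_cases hs : s' = s
      · subst hs
        intro he
        exact h2 ⟨⟨L, hL⟩, by rw [ht, ← he]⟩
      · exact hsep2 s s' t hs ht L hL
  · right; right
    refine ⟨w.1, ?_⟩
    intro s
    have := hac s
    simp only [col] at this
    split_ifs at this with h1 h2
    · have h3 := h2.choose_spec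
      simp only [Option.some.injEq] at this
      rw [this] at h3
      exact ⟨h3, fun s' hs L hL => hsep2 s s' _ hs h3 L hL⟩
    · simp at this
end Sys

lemma dep_choice {T : ℕ → Type*} (r : ∀ k, T k → T (k + 1) → Prop) (hr : ∀ k a, ∃ b, r k a b)
    (a0 : T 0) : ∃ s : ∀ k, T k, s 0 = a0 ∧ ∀ k, r k (s k) (s (k + 1)) := by
  choose F hF using hr
  exact ⟨fun k => Nat.rec a0 F k, rfl, fun k => hF k _⟩

namespace Sys
variable {σ : Sys}

lemma exists_α (a : ∀ k, σ.S k → σ.Γ k) : ∃ α : ∀ k, σ.A k,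
    (∀ k, σ.pA k (α (k + 1)) = α k) ∧ ∀ k, σ.asg k (α (k + 1)) = a k := by
  obtain ⟨a0⟩ := σ.neA
  obtain ⟨s, -, hs⟩ := dep_choice (T := σ.A) (fun k x y => σ.pA k y = x ∧ σ.asg k y = a k)
    (fun k x => σ.hA k x (a k)) a0
  exact ⟨s, fun k => (hs k).1, fun k => (hs k).2⟩

namespace Thr

lemma exists_thr (α : ∀ k, σ.A k) (hα : ∀ k, σ.pA k (α (k + 1)) = α k) :
    ∃ x : σ.Thr, x.α = α := by
  obtain ⟨q0⟩ := σ.neQ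
  obtain ⟨s, -, hs⟩ := dep_choice (T := σ.Q) (fun k x y => σ.pQ k y = x)
    (fun k x => by
      obtain ⟨y, hy, -⟩ := σ.hQ k x none (by simp)
      exact ⟨y, hy⟩) q0
  exact ⟨⟨α, s, hα, hs⟩, rfl⟩

lemma step (x : σ.Thr) (K : ℕ) (o : Option (ℕ × σ.Y K)) (ho : ∀ j t, o = some (j, t) → j ≤ K) :
    ∃ y : σ.Thr, y.α = x.α ∧ y.l K = x.l K ∧ y.ar K = o := by
  classical
  obtain ⟨s, h0, hs⟩ := dep_choice (T := σ.Q)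
    (fun k a b => σ.pQ k b = a ∧ (k < K → a = x.q k → b = x.q (k + 1)) ∧
      (∀ h : k = K, σ.arr k b = h ▸ o))
    (fun k a => by
      by_cases h1 : k = K
      · subst h1
        obtain ⟨b, hb1, hb2⟩ := σ.hQ k a o ho
        exact ⟨b, hb1, fun h => absurd h (lt_irrefl _), fun h => hb2⟩
      · by_cases h2 : a = x.q k
        · exact ⟨x.q (k + 1), by rw [x.hq, h2], fun _ _ => rfl, fun h => absurd h h1⟩
        · obtain ⟨b, hb1, hb2⟩ := σ.hQ k a none (by simp)
          exact ⟨b, hb1, fun _ h => absurd h h2, fun h => absurd h h1⟩) (x.q 0)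
  have h1 : ∀ k ≤ K, s k = x.q k := by
    intro k
    induction k with
    | zero => intro _; exact h0
    | succ k ih => intro hk; exact (hs k).2.1 (by omega) (ih (by omega))
  refine ⟨⟨x.α, s, x.hα, fun k => (hs k).1⟩, rfl, ?_, (hs K).2.2 rfl⟩
  exact Prod.ext rfl (h1 K le_rfl)

lemma diag (α : ∀ k, σ.A k) (hα : ∀ k, σ.pA k (α (k + 1)) = α k) (P : ℕ → σ.Thr → Prop)
    (hc : ∀ (K : ℕ) (x y : σ.Thr), x.α = α → y.α = α → x.l (K + 1) = y.l (K + 1) → P K x → P K y)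
    (hs : ∀ (K : ℕ) (x : σ.Thr), x.α = α → ∃ y : σ.Thr, y.α = α ∧ y.l K = x.l K ∧ P K y) :
    ∃ x : σ.Thr, x.α = α ∧ ∀ K, P K x := by
  obtain ⟨x0, hx0⟩ := exists_thr α hα
  obtain ⟨s, -, h⟩ := dep_choice (T := fun _ => {x : σ.Thr // x.α = α})
    (fun k y y' => y'.1.l k = y.1.l k ∧ P k y'.1)
    (fun k y => by
      obtain ⟨z, h1, h2, h3⟩ := hs k y.1 y.2
      exact ⟨⟨z, h1⟩, h2, h3⟩) ⟨x0, hx0⟩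
  let x : σ.Thr := ⟨α, fun k => (s k).1.q k, hα, fun k => by
    rw [(s (k + 1)).1.hq]
    exact (Prod.ext_iff.1 (h k).1).2⟩
  have hx : ∀ k, x.l k = (s k).1.l k := fun k => by
    refine Prod.ext ?_ rfl
    show α k = (s k).1.α k
    rw [(s k).2]
  refine ⟨x, rfl, fun K => hc K _ x (s (K + 1)).2 rfl (hx (K + 1)).symm (h K).2⟩

def Cond (f : σ.X → σ.X) (D : Set ℕ) (x : σ.Thr) (K j : ℕ) (t : σ.Y K) : Prop :=
  j ∈ D ∧ j ≤ K ∧ (∀ i, j ≤ i → i < K → x.ar i = none) ∧ f (x.nn j) = ⟨K, t⟩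

lemma Cond.congr {f : σ.X → σ.X} {D : Set ℕ} {x y : σ.Thr} {K j : ℕ} {t : σ.Y K}
    (hα : x.α = y.α) (hl : x.l K = y.l K) (h : Cond f D x K j t) : Cond f D y K j t := by
  obtain ⟨h1, h2, h3, h4⟩ := h
  refine ⟨h1, h2, ?_, ?_⟩
  · intro i hi hi'
    rw [← h3 i hi hi']
    exact (ar_congr (l_anti hi' hl)).symm
  · have : x.nn j = y.nn j := by
      unfold nn as
      rw [hα, l_anti h2 hl]
    rw [← this, h4]

def PP (f : σ.X → σ.X) (D : Set ℕ) (K : ℕ) (x : σ.Thr) : Prop :=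
  (∃ j t, Cond f D x K j t ∧ x.ar K = some (j, t)) ∨
    ((¬ ∃ j t, Cond f D x K j t) ∧ x.ar K = none)

lemma exists_x (f : σ.X → σ.X) (D : Set ℕ) (α : ∀ k, σ.A k)
    (hα : ∀ k, σ.pA k (α (k + 1)) = α k) : ∃ x : σ.Thr, x.α = α ∧ ∀ K, PP f D K x := by
  refine diag α hα _ ?_ ?_
  · intro K x y hx hy hl h
    have hl' : x.l K = y.l K := l_anti (Nat.le_succ K) hl
    have hxy : x.α = y.α := hx.trans hy.symm
    rcases h with ⟨j, t, h1, h2⟩ | ⟨h1, h2⟩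
    · exact Or.inl ⟨j, t, h1.congr hxy hl', by rw [← h2]; exact (ar_congr hl).symm⟩
    · refine Or.inr ⟨?_, by rw [← h2]; exact (ar_congr hl).symm⟩
      rintro ⟨j, t, h⟩
      exact h1 ⟨j, t, h.congr hxy.symm hl'.symm⟩
  · intro K x hx
    by_cases hC : ∃ j t, Cond f D x K j t
    · obtain ⟨j, t, h⟩ := hC
      obtain ⟨y, h1, h2, h3⟩ := step x K (some (j, t)) (by
        intro j' t' e
        have := (Prod.ext_iff.1 (Option.some.inj e)).1
        have h5 := h.2.1
        simp only at this
        omega)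
      exact ⟨y, h1.trans hx, h2, Or.inl ⟨j, t, h.congr h1.symm h2.symm, h3⟩⟩
    · obtain ⟨y, h1, h2, h3⟩ := step x K none (by simp)
      refine ⟨y, h1.trans hx, h2, Or.inr ⟨?_, h3⟩⟩
      rintro ⟨j, t, h⟩
      exact hC ⟨j, t, h.congr h1 h2⟩

lemma catch_D (f : σ.X → σ.X) (α : ∀ k, σ.A k) (hα : ∀ k, σ.pA k (α (k + 1)) = α k)
    (a : ∀ k, σ.S k → σ.Γ k) (ha : ∀ k, σ.asg k (α (k + 1)) = a k) (D : Set ℕ) (hD : D.Infinite)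
    (hact : ∀ j ∈ D, ∃ i, σ.code i (α i) = j) (hsep : ∀ j ∈ D, Sep j (a j))
    (hle : ∀ j ∈ D, ∀ s, j ≤ (f (sr j (a j s))).1)
    (c4a : ∀ j ∈ D, ∀ s t, f (sr j (a j s)) = sr j t → ∀ s', s' ≠ s →
      ∀ L : List (σ.S j × Bool), L.length ≤ j + 1 → wd (σ.γ j) L * a j s' ≠ t)
    (c4b : ∀ j ∈ D, ∀ j' ∈ D, j' < j → ∀ s s' t t', f (sr j (a j s)) = sr j t →
      f (sr j' (a j' s')) = sr j' t' → ∀ L : List (σ.Thr × Bool), L.length ≤ j' →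
      FreeGroup.IsReduced (rl j' L) → wd (σ.γ j) (rl j L) * a j s = t →
      wd (σ.γ j') (rl j' L) * a j' s' ≠ t') :
    ∃ x : σ.Thr, {p | f p = x.h p}.Infinite := by
  obtain ⟨x, hxα, hP⟩ := exists_x f D α hα
  refine ⟨x, ?_⟩
  have has : ∀ k, x.as k = a k := fun k => by rw [as, hxα, ha]
  have hnn : ∀ j, x.nn j = sr j (a j (x.l j)) := fun j => by rw [nn, has]; rfl
  have hC : ∀ {K j t}, x.ar K = some (j, t) → Cond f D x K j t := by
    intro K j t h
    rcases hP K with ⟨j', t', h1, h2⟩ | ⟨h1, h2⟩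
    · have := h.symm.trans h2
      simp only [Option.some.injEq, Prod.mk.injEq] at this
      obtain ⟨rfl, rfl⟩ := this
      exact h1
    · rw [h] at h2; cases h2
  have hE : ∀ {K j t}, x.ar K = some (j, t) → x.Eff K j t := by
    intro K j t h
    obtain ⟨h1, h2, h3, h4⟩ := hC h
    rw [hnn] at h4
    refine ⟨h, h3, ?_, ?_, ?_, ?_⟩
    · rw [hxα]; exact hact j h1
    · rw [has]; exact hsep j h1
    · intro hj ht s hs L hL
      subst hj
      rw [has]
      refine c4a j h1 (x.l j) t.1 ?_ s hs L hL
      rw [h4, sr, ← ht]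
    · intro hj ht K' hK' t' hK L hL hr he
      subst hj
      have h5 := hC hK
      have h6 := h5.2.2.2
      rw [hnn] at h6
      rw [has] at he ⊢
      refine c4b j h1 K' h5.1 hK' (x.l j) (x.l K') t.1 t' ?_ h6 L hL hr he
      rw [h4, sr, ← ht]
  have hT : {K | ∃ j t, x.ar K = some (j, t)}.Infinite := by
    refine Set.infinite_of_forall_exists_gt fun B => ?_
    obtain ⟨j, hj, hjB⟩ := hD.exists_gt B
    by_contra hcon
    push Not at hcon
    have hno : ∀ i, j ≤ i → x.ar i = none := by
      intro i hi
      rcases h : x.ar i with _ | ⟨j', t'⟩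
      · rfl
      · have := hcon i ⟨j', t', h⟩
        omega
    have h1 := hle j hj (x.l j)
    rw [← hnn] at h1
    have h2 : Cond f D x (f (x.nn j)).1 j (f (x.nn j)).2 :=
      ⟨hj, h1, fun i hi _ => hno i hi, rfl⟩
    rcases hP (f (x.nn j)).1 with ⟨j', t', _, h3⟩ | ⟨h3, _⟩
    · rw [hno _ h1] at h3; cases h3
    · exact h3 ⟨_, _, h2⟩
  refine Set.Infinite.of_image (fun p => (f p).1) (hT.mono ?_)
  rintro K ⟨j, t, hK⟩
  have h4 := (hC hK).2.2.2
  refine ⟨x.nn j, ?_, by simp only [h4]⟩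
  show f (x.nn j) = x.h (x.nn j)
  rw [h4, h_apply, π_eq (Or.inl (Low.main K j t (hE hK)))]
  exact (x.e.apply_symm_apply _).symm
end Thr
end Sys

namespace Sys
variable {σ : Sys}
namespace Thr

lemma bad_π (y : σ.Thr) (K : ℕ) : ∃ F : Finset σ.X, F.card ≤ 2 ∧
    ∀ q : σ.X, q.1 = K → q.2.2 = none → q ∉ F → y.π q = q := by
  classical
  obtain ⟨z, hz⟩ : ∃ z : σ.X, ∀ j t, y.ar K = some (j, t) → z = (y.e)⁻¹ ⟨K, t⟩ := by
    rcases h : y.ar K with _ | ⟨j, t⟩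
    · exact ⟨y.nn K, by simp⟩
    · refine ⟨(y.e)⁻¹ ⟨K, t⟩, ?_⟩
      intro j' t' e
      simp only [Option.some.injEq, Prod.mk.injEq] at e
      rw [e.2]
  refine ⟨{y.nn K, z}, Finset.card_le_two, ?_⟩
  intro q hq hn hF
  rcases y.π_or q with h | h
  · exact h
  · exfalso
    apply hF
    generalize y.π q = q' at h
    rcases h with h | h
    · cases h with
      | main K' j t h =>
        have : j = K := hq
        subst this
        simp
      | dup K' j t r h h1 h2 h3 => exact absurd hn (by simp [DD])
    · cases h with
      | main K' j t h =>
        have : K' = K := hq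
        subst this
        rw [← hz j t h.ar]
        simp
      | dup K' j t r h h1 h2 h3 => exact absurd hn (by simp [DD])

lemma wd_good (Φ : List (σ.Thr × Bool)) (K : ℕ) : ∃ B : Finset σ.X, B.card ≤ 2 * Φ.length ∧
    ∀ p : σ.X, p.1 = K → p.2.2 = none → p ∉ B → wd h Φ p = wd e Φ p := by
  classical
  induction Φ with
  | nil => exact ⟨∅, by simp, fun p _ _ _ => rfl⟩
  | cons a Φ ih =>
    obtain ⟨B, hB, h1⟩ := ih
    obtain ⟨F, hF, h2⟩ := bad_π a.1 K
    let τ : Equiv.Perm σ.X := (cond a.2 1 (a.1.e)⁻¹) * wd e Φ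
    have hτ : ∀ p, τ p = qq a (wd e Φ p) := by
      intro p
      rcases a with ⟨a, _ | _⟩ <;> rfl
    refine ⟨B ∪ F.image (τ.symm), ?_, ?_⟩
    · have h3 := Finset.card_union_le B (F.image τ.symm)
      have h4 : (F.image τ.symm).card ≤ F.card := Finset.card_image_le
      simp only [List.length_cons]
      omega
    · intro p hp hn hpB
      rw [Finset.mem_union, not_or] at hpB
      rw [wd_cons, wd_cons, Equiv.Perm.mul_apply, Equiv.Perm.mul_apply, h1 p hp hn hpB.1]
      apply lt_h_of_fix
      apply h2
      · rcases a with ⟨a, _ | _⟩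
        · show (wd e Φ p).1 = K
          rw [wd_e_apply]; exact hp
        · show (wd e Φ p).1 = K
          rw [wd_e_apply]; exact hp
      · rcases a with ⟨a, _ | _⟩
        · show (wd e Φ p).2.2 = none
          rw [wd_e_apply]; exact hn
        · show (wd e Φ p).2.2 = none
          rw [wd_e_apply]; exact hn
      · intro hF
        apply hpB.2
        refine Finset.mem_image.2 ⟨_, hF, ?_⟩
        rw [← hτ]; exact τ.symm_apply_apply p

lemma rl_anti {k K : ℕ} (hk : k ≤ K) : ∀ {L L' : List (σ.Thr × Bool)}, rl K L = rl K L' →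
    rl k L = rl k L' := by
  intro L
  induction L with
  | nil =>
    intro L' h
    rcases L' with _ | ⟨b, L'⟩
    · rfl
    · simp [rl] at h
  | cons a L ih =>
    intro L' h
    rcases L' with _ | ⟨b, L'⟩
    · simp [rl] at h
    · simp only [rl, rs_cons, List.cons.injEq, Prod.mk.injEq] at h ⊢
      exact ⟨⟨l_anti hk h.1.1, h.1.2⟩, ih h.2⟩

lemma rl_snd (k : ℕ) (L : List (σ.Thr × Bool)) : (rl k L).map Prod.snd = L.map Prod.snd := by
  simp [rl, rs]

lemma catch_chain (f : σ.X → σ.X) (a : ∀ k, σ.S k → σ.Γ k) (hsep : ∀ k, Sep k (a k))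
    (c : ℕ → ℕ) (hc : StrictMono c) (L : ℕ → List (σ.Thr × Bool))
    (hlen : ∀ n, (L n).length ≤ c n) (hred : ∀ n, FreeGroup.IsReduced (rl (c n) (L n)))
    (hL : ∀ n, wd (σ.γ (c (n + 1))) (rl (c (n + 1)) (L n)) =
      wd (σ.γ (c (n + 1))) (rl (c (n + 1)) (L (n + 1))))
    (hf : ∀ n s, f (sr (c n) (a (c n) s)) = sr (c n) (wd (σ.γ (c n)) (rl (c n) (L n)) * a (c n) s)) :
    ∃ Φ : List (σ.Thr × Bool), {p | f p = wd h Φ p}.Infinite := by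
  classical
  have h1 : ∀ n, rl (c (n + 1)) (L n) = rl (c (n + 1)) (L (n + 1)) := by
    intro n
    have h2 : c n < c (n + 1) := hc (Nat.lt_succ_self n)
    refine Girth.inj _ (σ.girth (c (n + 1))) (reduced_up h2.le (hred n)) (hred (n + 1)) ?_ (hL n)
    have := hlen n
    have := hlen (n + 1)
    simp only [rl, rs_length]
    omega
  have h2 : ∀ n m, n ≤ m → rl (c n) (L m) = rl (c n) (L n) := by
    intro n m hnm
    induction m, hnm using Nat.le_induction with
    | base => rfl
    | succ m hm ih => rw [← ih]; exact (rl_anti (hc.monotone (by omega)) (h1 m)).symm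
  have h3 : ∀ n, (L n).map Prod.snd = (L 0).map Prod.snd := by
    intro n
    rw [← rl_snd (c 0), h2 0 n (Nat.zero_le n), rl_snd]
  obtain ⟨LL, -, hLL⟩ := exists_LL _ L h3
  have h4 : ∀ n, rl (c n) (limL LL) = rl (c n) (L n) := by
    intro n
    have h5 := (conv_rl LL (c n)).and
      ((Filter.eventually_ge_atTop n).filter_mono Nat.hyperfilter_le_atTop)
    obtain ⟨i, hi, hin⟩ := h5.exists
    rw [← hi, ← hLL, h2 n i hin]
  refine ⟨limL LL, ?_⟩
  set Φ := limL LL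
  refine Set.Infinite.of_image (fun p => p.1) (Set.infinite_of_forall_exists_gt fun B => ?_)
  let n := max (B + 1) (2 * Φ.length)
  have hn : n ≤ c n := hc.id_le n
  refine ⟨c n, ?_, by omega⟩
  obtain ⟨F, hF, hF2⟩ := wd_good Φ (c n)
  have : Fintype (σ.S (c n)) := Fintype.ofFinite _
  have hinj : Function.Injective (fun s => sr (c n) (a (c n) s)) := by
    intro s s' hss
    by_contra hne
    exact hsep (c n) s s' hne [] (by simp) (by simpa using sr_inj hss)
  have hcard : F.card < (Finset.univ.image (fun s => sr (c n) (a (c n) s))).card := by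
    rw [Finset.card_image_of_injective _ hinj, Finset.card_univ, ← Nat.card_eq_fintype_card]
    have := σ.card_S (c n)
    show F.card < Nat.card (σ.A (c n) × σ.Q (c n))
    omega
  obtain ⟨p, hp, hpF⟩ := Finset.exists_mem_notMem_of_card_lt_card hcard
  obtain ⟨s, -, rfl⟩ := Finset.mem_image.1 hp
  refine ⟨sr (c n) (a (c n) s), ?_, rfl⟩
  show f (sr (c n) (a (c n) s)) = wd h Φ (sr (c n) (a (c n) s))
  rw [hF2 _ rfl rfl hpF, wd_e_apply, hf, ← h4]
  rfl

theorem catching (f : σ.X → σ.X) (hf : Function.Injective f) :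
    ∃ w : FreeGroup σ.Thr, {p | f p = FreeGroup.lift h w p}.Infinite := by
  classical
  choose a hsep hcl using counting f hf
  obtain ⟨α, hα, ha⟩ := exists_α a
  let Act : Set ℕ := Set.range fun i => σ.code i (α i)
  have hAct : Act.Infinite := by
    refine Set.infinite_of_forall_exists_gt fun B => ⟨_, ⟨B + 1, rfl⟩, ?_⟩
    have := σ.code_le (B + 1) (α (B + 1))
    simp only
    omega
  have one : (∃ x : σ.Thr, {p | f p = x.h p}.Infinite) →
      ∃ w : FreeGroup σ.Thr, {p | f p = FreeGroup.lift h w p}.Infinite := by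
    rintro ⟨x, hx⟩
    exact ⟨FreeGroup.of x, by simpa using hx⟩
  have hun : Act = {k ∈ Act | clU f k (a k)} ∪ ({k ∈ Act | clN f k (a k)} ∪
      {k ∈ Act | ∃ w, clW f k (a k) w}) := by
    ext k
    have := hcl k
    simp only [Set.mem_union, Set.mem_sep_iff]
    tauto
  rw [hun, Set.infinite_union, Set.infinite_union] at hAct
  rcases hAct with hU | hN | hW
  · refine one (catch_D f α hα a ha _ hU (fun j hj => hj.1) (fun j _ => hsep j)
      (fun j hj s => (hj.2 s).1) ?_ ?_)
    · intro j hj s t ht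
      exact absurd ht ((hj.2 s).2 t)
    · intro j hj j' hj' hlt s s' t t' ht
      exact absurd ht ((hj.2 s).2 t)
  · refine one (catch_D f α hα a ha _ hN (fun j hj => hj.1) (fun j _ => hsep j) ?_ ?_ ?_)
    · intro j hj s
      obtain ⟨t, ht, -⟩ := hj.2 s
      rw [ht]; exact le_rfl
    · intro j hj s t ht s' hs' L hL
      obtain ⟨t', ht', h2⟩ := hj.2 s
      obtain rfl := sr_inj (ht.symm.trans ht')
      exact h2 s' L hL
    · intro j hj j' hj' hlt s s' t t' ht ht' L hL hr he
      obtain ⟨t2, ht2, h2⟩ := hj.2 s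
      obtain rfl := sr_inj (ht.symm.trans ht2)
      exact absurd he (h2 s _ (by simp only [rl, rs_length]; omega))
  · have hex : ∀ k, ∃ w, (∃ w, clW f k (a k) w) → clW f k (a k) w := by
      intro k
      by_cases h : ∃ w, clW f k (a k) w
      · obtain ⟨w, hw⟩ := h
        exact ⟨w, fun _ => hw⟩
      · exact ⟨[], fun h' => absurd h' h⟩
    choose w hw using hex
    set W := {k ∈ Act | ∃ w, clW f k (a k) w}
    have : Infinite W := hW.to_subtype
    obtain ⟨g, hg⟩ := exists_increasing_or_nonincreasing_subseq'
      (fun K' K : ℕ => ∃ L : List (σ.Thr × Bool), L.length ≤ K' ∧ FreeGroup.IsReduced (rl K' L) ∧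
        wd (σ.γ K) (rl K L) = wd (σ.γ K) (w K) ∧ wd (σ.γ K') (rl K' L) = wd (σ.γ K') (w K'))
      (fun n => Nat.orderEmbeddingOfSet W n)
    let c : ℕ → ℕ := fun n => Nat.orderEmbeddingOfSet W (g n)
    have hc : StrictMono c := fun m n hmn =>
      (Nat.orderEmbeddingOfSet W).strictMono (g.strictMono hmn)
    have hcW : ∀ n, c n ∈ W := fun n => by
      have h5 := Set.mem_range_self (f := Nat.orderEmbeddingOfSet W) (g n)
      rwa [Nat.orderEmbeddingOfSet_range] at h5
    have hwc : ∀ n, clW f (c n) (a (c n)) (w (c n)) := fun n => hw _ (hcW n).2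
    rcases hg with hg | hg
    · choose L h1 h2 h3 h4 using hg
      obtain ⟨Φ, hΦ⟩ := catch_chain f a hsep c hc L h1 h2
        (fun n => (h3 n).trans (h4 (n + 1)).symm)
        (fun n s => by
          rw [(hwc n s).1]
          have := h4 n
          change wd (σ.γ (c n)) (rl (c n) (L n)) = _ at this
          rw [this])
      exact ⟨FreeGroup.mk Φ, by rw [wd_lift]; exact hΦ⟩
    · have hle : ∀ n, ∀ s t, f (sr (c n) (a (c n) s)) = sr (c n) t →
          t = wd (σ.γ (c n)) (w (c n)) * a (c n) s := by
        intro n s t ht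
        exact sr_inj (ht.symm.trans (hwc n s).1)
      refine one (catch_D f α hα a ha (Set.range c) (Set.infinite_range_of_injective hc.injective)
        ?_ (fun j _ => hsep j) ?_ ?_ ?_)
      · rintro _ ⟨n, rfl⟩
        exact (hcW n).1
      · rintro _ ⟨n, rfl⟩ s
        rw [(hwc n s).1]; exact le_rfl
      · rintro _ ⟨n, rfl⟩ s t ht s' hs' L hL
        rw [hle n s t ht]
        exact (hwc n s).2 s' hs' L hL
      · rintro _ ⟨n, rfl⟩ _ ⟨m, rfl⟩ hlt s s' t t' ht ht' L hL hr he he'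
        rw [hle n s t ht] at he
        rw [hle m s' t' ht'] at he'
        exact hg m n (hc.lt_iff_lt.1 hlt) ⟨L, hL, hr, mul_right_cancel he, mul_right_cancel he'⟩
end Thr
end Sys

lemma closed_of_seq (C : Set (ℕ → ℕ)) (hC : ∀ (G : ℕ → ℕ → ℕ) (g : ℕ → ℕ), (∀ i, G i ∈ C) →
    (∀ n, ∀ᶠ i in Filter.atTop, G i n = g n) → g ∈ C) : IsClosed C := by
  apply IsSeqClosed.isClosed
  intro G g hG hlim
  refine hC G g hG fun n => ?_
  have := (tendsto_pi_nhds.1 hlim) n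
  rw [nhds_discrete, Filter.tendsto_pure] at this
  exact this

lemma Sys.X_equiv (σ : Sys) : Nonempty (σ.X ≃ ℕ) := by
  have h1 : Countable σ.X := inferInstance
  have h2 : Infinite σ.X := Infinite.of_injective (fun k : ℕ => (⟨k, 1, none⟩ : σ.X))
    (fun a b h => congrArg Sigma.fst h)
  exact nonempty_equiv_of_countable

theorem exists_Fsigma_cofinitary_group_catching_all_injections :
    ∃ G : Subgroup (Equiv.Perm ℕ),
      IsCofinitary G ∧
      IsFsigma ((fun g : Equiv.Perm ℕ => (g : ℕ → ℕ)) '' (G : Set (Equiv.Perm ℕ))) ∧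
      ∀ g : ℕ → ℕ, Function.Injective g →
        ∃ h ∈ G, {n : ℕ | g n = h n}.Infinite := by
  obtain ⟨σ⟩ := exists_sys
  obtain ⟨E⟩ := σ.X_equiv
  let φ : FreeGroup σ.Thr →* Equiv.Perm ℕ :=
    E.permCongrHom.toMonoidHom.comp (FreeGroup.lift Sys.Thr.h)
  have hφ : ∀ w n, φ w n = E (FreeGroup.lift Sys.Thr.h w (E.symm n)) := fun w n => rfl
  refine ⟨φ.range, ?_, ?_, ?_⟩
  · rintro _ ⟨w, rfl⟩ hw
    have hw1 : w ≠ 1 := by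
      rintro rfl
      exact hw (map_one φ)
    refine ((Sys.Thr.cofinitary w hw1).image E).subset ?_
    intro n hn
    have hn : φ w n = n := hn
    refine ⟨E.symm n, ?_, E.apply_symm_apply n⟩
    rw [hφ] at hn
    show FreeGroup.lift Sys.Thr.h w (E.symm n) = E.symm n
    rw [Equiv.eq_symm_apply]; exact hn
  · let cj : (σ.X → σ.X) → (ℕ → ℕ) := fun f n => E (f (E.symm n))
    have hcj : Function.Injective cj := by
      intro f g hfg
      funext p
      have := congrFun hfg (E p)
      simpa [cj] using this
    obtain ⟨d⟩ : Nonempty (ℕ ≃ List Bool × ℕ) := nonempty_equiv_of_countable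
    refine ⟨fun n => cj '' (Sys.Thr.CC σ (d n).1 (d n).2), ?_, ?_⟩
    · intro n
      refine closed_of_seq _ ?_
      intro G g hG hlim
      choose F hF hFG using hG
      refine ⟨fun p => E.symm (g (E p)), ?_, ?_⟩
      · refine Sys.Thr.CC_closed _ _ F hF _ fun p => ?_
        refine (hlim (E p)).mono fun i hi => ?_
        rw [← hi, ← hFG i]
        simp [cj]
      · funext n
        simp [cj]
    · have h1 := Sys.Thr.range_eq_CC (σ := σ)
      have h2 : (⋃ n, cj '' (Sys.Thr.CC σ (d n).1 (d n).2)) =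
          cj '' (⋃ βN : List Bool × ℕ, Sys.Thr.CC σ βN.1 βN.2) := by
        rw [Set.image_iUnion]
        exact d.surjective.iUnion_comp (fun βN => cj '' (Sys.Thr.CC σ βN.1 βN.2))
      rw [h2, ← h1]
      ext f
      constructor
      · rintro ⟨_, ⟨w, rfl⟩, rfl⟩
        exact ⟨_, ⟨w, rfl⟩, rfl⟩
      · rintro ⟨_, ⟨w, rfl⟩, rfl⟩
        exact ⟨φ w, ⟨w, rfl⟩, rfl⟩
  · intro g hg
    obtain ⟨w, hw⟩ := Sys.Thr.catching (σ := σ) (fun p => E.symm (g (E p)))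
      (E.symm.injective.comp (hg.comp E.injective))
    refine ⟨φ w, ⟨w, rfl⟩, ?_⟩
    refine (hw.image (E.injective.injOn)).mono ?_
    rintro _ ⟨p, hp, rfl⟩
    have hp : E.symm (g (E p)) = FreeGroup.lift Sys.Thr.h w p := hp
    show g (E p) = φ w (E p)
    rw [hφ, E.symm_apply_apply, ← hp, E.apply_symm_apply]
end

section
/- There exists an injective map e from (ℕ → Bool) × (ℕ → Bool) × (ℕ → Bool) to the permutations of ℕ such that: e is continuous as a map from the product of three copies of Cantor space into Baire space ℕ → ℕ; the range of e is a closed subset of Baire space; and the range of e freely generates a cofinitary subgroup of S∞ (i.e., the subgroup generated by range(e) is cofinitary and is a free group with basis range(e)). -/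
/-- A set `F` of permutations freely generates the subgroup it generates:
`⟨F⟩` is a free group with basis `F`. -/
def FreelyGenerates (F : Set (Equiv.Perm ℕ)) : Prop :=
  ∃ φ : FreeGroup F ≃* (Subgroup.closure F),
    ∀ x : F, (φ (FreeGroup.of x) : Equiv.Perm ℕ) = (x : Equiv.Perm ℕ)

namespace Cofin

abbrev Ball (α : Type) [DecidableEq α] (n : ℕ) := {x : FreeGroup α // x.norm ≤ n}

instance ballFinite (α : Type) [DecidableEq α] [Finite α] (n : ℕ) : Finite (Ball α n) := by
  have := (List.finite_length_le (α × Bool) n).to_subtype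
  refine Finite.of_injective (β := {l : List (α × Bool) | l.length ≤ n})
    (fun x => ⟨x.1.toWord, x.2⟩) ?_
  intro x y h
  apply Subtype.ext
  apply FreeGroup.toWord_injective
  exact congrArg Subtype.val h

theorem exists_sigma (α : Type) [DecidableEq α] [Finite α] (n : ℕ) (a : α) :
    ∃ σ : Equiv.Perm (Ball α n), ∀ x y : Ball α n, y.1 = FreeGroup.of a * x.1 → σ x = y := by
  classical
  have := Fintype.ofFinite (Ball α n)
  let p : Ball α n → Prop := fun x => (FreeGroup.of a * x.1).norm ≤ n
  let q : Ball α n → Prop := fun x => ((FreeGroup.of a)⁻¹ * x.1).norm ≤ n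
  let e : {x // p x} ≃ {x // q x} :=
    { toFun := fun x => ⟨⟨FreeGroup.of a * x.1.1, x.2⟩, by
        change FreeGroup.norm _ ≤ n
        simpa using x.1.2⟩
      invFun := fun x => ⟨⟨(FreeGroup.of a)⁻¹ * x.1.1, x.2⟩, by
        change FreeGroup.norm _ ≤ n
        simpa using x.1.2⟩
      left_inv := fun x => by simp
      right_inv := fun x => by simp }
  refine ⟨e.extendSubtype, fun x y h => ?_⟩
  have hx : p x := by
    change FreeGroup.norm _ ≤ n
    rw [← h]; exact y.2
  rw [Equiv.extendSubtype_apply_of_mem e x hx]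
  exact Subtype.ext h.symm

noncomputable def sig (α : Type) [DecidableEq α] [Finite α] (n : ℕ) (a : α) :
    Equiv.Perm (Ball α n) := (exists_sigma α n a).choose

theorem sig_spec {α : Type} [DecidableEq α] [Finite α] {n : ℕ} (a : α) {x y : Ball α n}
    (h : y.1 = FreeGroup.of a * x.1) : sig α n a x = y :=
  (exists_sigma α n a).choose_spec x y h

theorem lift_one {α : Type} [DecidableEq α] [Finite α] {n : ℕ} (L : List (α × Bool))
    (hL : FreeGroup.IsReduced L) (hn : L.length ≤ n) (z : Ball α n) (hz : z.1 = 1) :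
    (FreeGroup.lift (sig α n) (FreeGroup.mk L) z).1 = FreeGroup.mk L := by
  induction L with
  | nil => simpa [← FreeGroup.one_eq_mk] using hz
  | cons c L ih =>
    obtain ⟨a, b⟩ := c
    have hL' : FreeGroup.IsReduced L := by
      exact hL.infix ⟨[(a,b)], [], by simp⟩
    have hn' : L.length ≤ n := by simp at hn; omega
    have ih := ih hL' hn'
    have hk : (FreeGroup.mk ((a,b)::L)).norm ≤ n := FreeGroup.norm_mk_le.trans hn
    have hs : FreeGroup.mk ((a,b)::L) = FreeGroup.mk [(a,b)] * FreeGroup.mk L := by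
      simp [FreeGroup.mul_mk]
    set u := FreeGroup.lift (sig α n) (FreeGroup.mk L) z with hu
    rw [hs, map_mul, Equiv.Perm.mul_apply, ← hu]
    cases b with
    | true =>
      have : FreeGroup.lift (sig α n) (FreeGroup.mk [(a,true)]) = sig α n a :=
        FreeGroup.lift_apply_of
      rw [this, sig_spec (y := ⟨_, hk⟩) a]
      · exact hs
      · rw [ih]; exact hs
    | false =>
      have h1 : FreeGroup.mk [(a,false)] = (FreeGroup.of a)⁻¹ := rfl
      rw [h1, map_inv, FreeGroup.lift_apply_of]
      have : (sig α n a)⁻¹ u = ⟨_, hk⟩ := by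
        rw [Equiv.Perm.inv_eq_iff_eq, sig_spec]
        rw [ih]; simp only [hs, h1]; simp
      rw [this]; simp only [hs, h1]

theorem lift_ne_one {α : Type} [DecidableEq α] [Finite α] {n : ℕ} (w : FreeGroup α)
    (hw : w ≠ 1) (hn : w.norm ≤ n) : FreeGroup.lift (sig α n) w ≠ 1 := by
  intro h
  have := lift_one w.toWord FreeGroup.isReduced_toWord hn ⟨1, by simp⟩ rfl
  rw [FreeGroup.mk_toWord, h] at this
  exact hw this.symm

abbrev X := (ℕ → Bool) × (ℕ → Bool) × (ℕ → Bool)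
abbrev A (n : ℕ) := (Fin n → Bool) × (Fin n → Bool) × (Fin n → Bool)
def r (n : ℕ) (x : X) : A n := (fun i => x.1 i, fun i => x.2.1 i, fun i => x.2.2 i)

theorem r_cont (n : ℕ) : Continuous (r n) := by
  unfold r; fun_prop

theorem r_sep (x y : X) (h : x ≠ y) : ∀ᶠ n in Filter.atTop, r n x ≠ r n y := by
  have : ∃ i, x.1 i ≠ y.1 i ∨ x.2.1 i ≠ y.2.1 i ∨ x.2.2 i ≠ y.2.2 i := by
    by_contra! hc
    exact h (Prod.ext (funext fun i => (hc i).1)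
      (Prod.ext (funext fun i => (hc i).2.1) (funext fun i => (hc i).2.2)))
  obtain ⟨i, hi⟩ := this
  filter_upwards [Filter.eventually_gt_atTop i] with n hn he
  simp only [r, Prod.mk.injEq] at he
  have h1 := congrFun he.1 ⟨i, hn⟩
  have h2 := congrFun he.2.1 ⟨i, hn⟩
  have h3 := congrFun he.2.2 ⟨i, hn⟩
  simp only at h1 h2 h3
  tauto

theorem map_comp_eq {α : Type} (f : α → α) (L : List (α × Bool)) (h : ∀ c ∈ L, f c.1 = c.1) :
    L.map (fun c => (f c.1, c.2)) = L := by
  conv_rhs => rw [← List.map_id L]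
  apply List.map_congr_left
  intro c hc
  simp [h c hc]

theorem eventually_map_ne (w : FreeGroup X) (hw : w ≠ 1) :
    ∀ᶠ n in Filter.atTop, FreeGroup.map (r n) w ≠ 1 ∧ (FreeGroup.map (r n) w).norm ≤ n := by
  classical
  let S : Set X := {x | ∃ b, (x, b) ∈ w.toWord}
  have hS : S.Finite := by
    refine ((w.toWord.map Prod.fst).finite_toSet).subset ?_
    rintro x ⟨b, hb⟩
    simp only [List.mem_map, Set.mem_ofPred_eq]
    exact ⟨_, hb, rfl⟩
  have h1 : ∀ᶠ n in Filter.atTop, ∀ x ∈ S, ∀ y ∈ S, x ≠ y → r n x ≠ r n y := by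
    rw [Filter.eventually_all_finite hS]
    intro x _
    rw [Filter.eventually_all_finite hS]
    intro y _
    by_cases h : x = y
    · simp [h]
    · filter_upwards [r_sep x y h] with n hn _ using hn
  filter_upwards [h1, Filter.eventually_ge_atTop w.norm] with n h1 h2
  constructor
  · intro h
    have hinj : Set.InjOn (r n) S := fun x hx y hy he => by
      by_contra hne
      exact h1 x hx y hy hne he
    have : Nonempty X := ⟨⟨fun _ => true, fun _ => true, fun _ => true⟩⟩
    apply hw
    have h3 : FreeGroup.map (Function.invFunOn (r n) S) (FreeGroup.map (r n) w) = w := by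
      rw [← FreeGroup.mk_toWord (x := w), FreeGroup.map.mk, FreeGroup.map.mk, List.map_map]
      congr 1
      refine map_comp_eq (fun x => Function.invFunOn (r n) S (r n x)) _ ?_
      intro c hc
      exact hinj.leftInvOn_invFunOn ⟨c.2, hc⟩
    rw [← h3, h, map_one]
  · refine le_trans ?_ h2
    conv_lhs => rw [← FreeGroup.mk_toWord (x := w), FreeGroup.map.mk]
    refine FreeGroup.norm_mk_le.trans ?_
    simp [FreeGroup.norm]

abbrev P (n : ℕ) := Equiv.Perm (Ball (A n) n)
abbrev T := Σ n : ℕ, P n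

theorem nonempty_T : Nonempty (T ≃ ℕ) := by
  have : Infinite T := Infinite.of_injective (fun n : ℕ => (⟨n, 1⟩ : T))
    fun a b h => (Sigma.mk.inj h).1
  have : Countable T := inferInstance
  exact nonempty_equiv_of_countable

noncomputable def enc : T ≃ ℕ := nonempty_T.some

noncomputable def eT (x : X) : Equiv.Perm T :=
  Equiv.sigmaCongrRight fun n => Equiv.mulLeft (sig (A n) n (r n x))

noncomputable def e (x : X) : Equiv.Perm ℕ := enc.permCongr (eT x)

theorem lift_eT (w : FreeGroup X) : ∀ t : T, FreeGroup.lift eT w t =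
    ⟨t.1, FreeGroup.lift (sig (A t.1) t.1) (FreeGroup.map (r t.1) w) * t.2⟩ := by
  induction w using FreeGroup.induction_on with
  | C1 => intro t; simp
  | of x => intro t; simp [eT]
  | inv_of x ih =>
    intro t
    rw [map_inv, Equiv.Perm.inv_eq_iff_eq, FreeGroup.lift_apply_of]
    simp [eT]
  | mul x y hx hy => intro t; simp [hx, hy, mul_assoc]

theorem lift_e (w : FreeGroup X) : FreeGroup.lift e w = enc.permCongr (FreeGroup.lift eT w) := by
  have : FreeGroup.lift e = (enc.permCongrHom.toMonoidHom).comp (FreeGroup.lift eT) := by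
    ext x : 1
    simp [e, Equiv.permCongrHom]
  rw [this]; rfl

theorem fix_finite (w : FreeGroup X) (hw : w ≠ 1) : {n | FreeGroup.lift e w n = n}.Finite := by
  obtain ⟨N, hN⟩ := Filter.eventually_atTop.1 (eventually_map_ne w hw)
  have hf : (Set.range fun s : (Σ n : Fin N, P n) => enc ⟨s.1, s.2⟩).Finite := Set.finite_range _
  refine hf.subset ?_
  intro m hm
  simp only [Set.mem_ofPred_eq, lift_e, Equiv.permCongr_apply] at hm
  rw [← Equiv.eq_symm_apply, lift_eT] at hm
  set t := enc.symm m with ht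
  have hlt : t.1 < N := by
    by_contra hge
    obtain ⟨h1, h2⟩ := hN t.1 (not_lt.1 hge)
    apply lift_ne_one _ h1 h2
    have := eq_of_heq (Sigma.mk.inj (hm.trans (Sigma.eta t).symm)).2
    exact mul_eq_right.1 this
  exact ⟨⟨⟨t.1, hlt⟩, t.2⟩, by simp [ht]⟩

theorem lift_inj : Function.Injective (FreeGroup.lift e) := by
  rw [injective_iff_map_eq_one]
  intro w h
  by_contra hw
  have := fix_finite w hw
  rw [h] at this
  simp at this
  exact Set.infinite_univ this

theorem e_inj : Function.Injective e := by
  intro x y h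
  apply FreeGroup.of_injective
  apply lift_inj
  simpa using h

theorem e_cont : Continuous (fun p => ((e p : Equiv.Perm ℕ) : ℕ → ℕ)) := by
  refine continuous_pi fun m => ?_
  let t := enc.symm m
  have : (fun p => e p m) =
      (fun a : A t.1 => enc ⟨t.1, sig (A t.1) t.1 a * t.2⟩) ∘ r t.1 := by
    funext p
    simp [e, eT, t]
  rw [this]
  exact continuous_of_discreteTopology.comp (r_cont _)

end Cofin

theorem exists_continuous_injection_with_closed_range_freely_generating_cofinitary :
    ∃ e : (ℕ → Bool) × (ℕ → Bool) × (ℕ → Bool) → Equiv.Perm ℕ,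
      Function.Injective e ∧
      Continuous (fun p => ((e p : Equiv.Perm ℕ) : ℕ → ℕ)) ∧
      IsClosed ((fun g : Equiv.Perm ℕ => (g : ℕ → ℕ)) '' Set.range e) ∧
      FreelyGenerates (Set.range e) ∧
      IsCofinitary (Subgroup.closure (Set.range e)) := by
  refine ⟨Cofin.e, Cofin.e_inj, Cofin.e_cont, ?_, ?_, ?_⟩
  · rw [← Set.range_comp]
    exact (isCompact_range Cofin.e_cont).isClosed
  · let ψ : FreeGroup (Set.range Cofin.e) →* Equiv.Perm ℕ := FreeGroup.lift Subtype.val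
    have hψ : ψ = (FreeGroup.lift Cofin.e).comp
        (FreeGroup.freeGroupCongr (Equiv.ofInjective _ Cofin.e_inj).symm).toMonoidHom := by
      ext x : 1
      simp [ψ, Equiv.apply_ofInjective_symm]
    have hinj : Function.Injective ψ := by
      rw [hψ]
      exact Cofin.lift_inj.comp (MulEquiv.injective _)
    have hr : ψ.range = Subgroup.closure (Set.range Cofin.e) := by
      rw [FreeGroup.range_lift_eq_closure, Subtype.range_coe]
    refine ⟨(MonoidHom.ofInjective hinj).trans (MulEquiv.subgroupCongr hr), fun x => ?_⟩
    change ψ (FreeGroup.of x) = x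
    simp [ψ]
  · intro g hg hne
    rw [← FreeGroup.range_lift_eq_closure] at hg
    obtain ⟨w, rfl⟩ := hg
    exact Cofin.fix_finite w fun h => hne (by rw [h, map_one])
end

section
/- There is no maximal finitely periodic group with infinitely many orbits. Precisely: if G ≤ S∞ is a finitely periodic group such that the natural action of G on ℕ has infinitely many orbits, then there exists a permutation h of ℕ with h ∉ G such that the subgroup of S∞ generated by G ∪ {h} is finitely periodic; in particular G is not a maximal finitely periodic group. -/
/-- A permutation `g ≠ 1` of `ℕ` is finitely periodic if the cyclic subgroup `⟨g⟩` has only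
finitely many finite orbits in its natural action on `ℕ`. -/
def IsFinitelyPeriodic (g : Equiv.Perm ℕ) : Prop :=
  {s : Set ℕ | (∃ n : ℕ, s = MulAction.orbit (Subgroup.zpowers g) n) ∧ s.Finite}.Finite

/-- A subgroup of `S∞ = Equiv.Perm ℕ` is finitely periodic if every non-identity element is
finitely periodic. -/
def IsFinitelyPeriodicGroup (G : Subgroup (Equiv.Perm ℕ)) : Prop :=
  ∀ g ∈ G, g ≠ 1 → IsFinitelyPeriodic g

/-- A finitely periodic group is maximal if it is not strictly contained in any finitely
periodic group. -/
def IsMaximalFinitelyPeriodic (G : Subgroup (Equiv.Perm ℕ)) : Prop :=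
  IsFinitelyPeriodicGroup G ∧
    ∀ H : Subgroup (Equiv.Perm ℕ), IsFinitelyPeriodicGroup H → G ≤ H → G = H

open Equiv

lemma fp_of_finite {g : Perm ℕ} (P : Set ℕ) (hP : P.Finite)
    (H : ∀ x, (Set.range fun i : ℤ => (g ^ i) x).Finite → ∃ i : ℤ, (g ^ i) x ∈ P) :
    IsFinitelyPeriodic g := by
  have horb : ∀ x, MulAction.orbit (Subgroup.zpowers g) x = Set.range fun i : ℤ => (g ^ i) x := by
    intro x
    ext y
    constructor
    · rintro ⟨⟨a, i, rfl⟩, rfl⟩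
      exact ⟨i, rfl⟩
    · rintro ⟨i, rfl⟩
      exact ⟨⟨g ^ i, i, rfl⟩, rfl⟩
  refine (hP.image fun x => MulAction.orbit (Subgroup.zpowers g) x).subset ?_
  rintro s ⟨⟨n, rfl⟩, hs⟩
  obtain ⟨i, hi⟩ := H n (by rw [← horb]; exact hs)
  refine ⟨_, hi, ?_⟩
  exact MulAction.orbit_eq_iff.2 ⟨⟨g ^ i, i, rfl⟩, rfl⟩

lemma fp_finite {g : Perm ℕ} (hg : IsFinitelyPeriodic g) :
    ∃ P : Set ℕ, P.Finite ∧
    ∀ x, (Set.range fun i : ℤ => (g ^ i) x).Finite → x ∈ P := by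
  have horb : ∀ x, MulAction.orbit (Subgroup.zpowers g) x = Set.range fun i : ℤ => (g ^ i) x := by
    intro x
    ext y
    constructor
    · rintro ⟨⟨a, i, rfl⟩, rfl⟩
      exact ⟨i, rfl⟩
    · rintro ⟨i, rfl⟩
      exact ⟨⟨g ^ i, i, rfl⟩, rfl⟩
  refine ⟨⋃₀ _, Set.Finite.sUnion hg (fun s hs => hs.2), ?_⟩
  intro x hx
  exact ⟨_, ⟨⟨x, rfl⟩, by rw [horb]; exact hx⟩, MulAction.mem_orbit_self x⟩

lemma fp_swap {a b : Perm ℕ} (hab : IsFinitelyPeriodic (a * b)) : IsFinitelyPeriodic (b * a) := by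
  obtain ⟨P, hP, H⟩ := fp_finite hab
  have key : ∀ (i : ℤ) (x : ℕ), ((a * b) ^ i) (a x) = a (((b * a) ^ i) x) := by
    intro i x
    have : a * b = a * (b * a) * a⁻¹ := by group
    rw [this, conj_zpow]
    simp
  refine fp_of_finite (a ⁻¹' P) (hP.preimage a.injective.injOn) ?_
  intro x hx
  refine ⟨0, ?_⟩
  simp only [zpow_zero, Perm.coe_one, id, Set.mem_preimage]
  apply H
  simp only [key]
  have := hx.image a
  rwa [← Set.range_comp] at this

/-- product of a list of syllables -/
def wprod (h : Perm ℕ) (L : List (ℤ × Perm ℕ)) : Perm ℕ := (L.map fun p => h ^ p.1 * p.2).prod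

lemma wprod_nil (h : Perm ℕ) : wprod h [] = 1 := rfl
lemma wprod_cons (h : Perm ℕ) (p L) : wprod h (p :: L) = h ^ p.1 * p.2 * wprod h L := by
  simp [wprod]
lemma wprod_append (h : Perm ℕ) (A B) : wprod h (A ++ B) = wprod h A * wprod h B := by
  simp [wprod]

lemma mem_closure_wprod (G : Subgroup (Perm ℕ)) (h w : Perm ℕ)
    (hw : w ∈ Subgroup.closure ((G : Set (Perm ℕ)) ∪ {h})) :
    ∃ L, (∀ p ∈ L, p.2 ∈ G) ∧ w = wprod h L := by
  induction hw using Subgroup.closure_induction with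
  | mem x hx =>
    rcases hx with hx | hx
    · exact ⟨[(0, x)], by simpa using hx, by simp [wprod]⟩
    · obtain rfl : x = h := hx
      exact ⟨[(1, 1)], by simp, by simp [wprod]⟩
  | one => exact ⟨[], by simp, rfl⟩
  | mul x y _ _ hx hy =>
    obtain ⟨A, hA, rfl⟩ := hx
    obtain ⟨B, hB, rfl⟩ := hy
    refine ⟨A ++ B, ?_, (wprod_append h A B).symm⟩
    intro p hp
    rcases List.mem_append.1 hp with hp | hp
    · exact hA p hp
    · exact hB p hp
  | inv x _ hx =>
    obtain ⟨A, hA, rfl⟩ := hx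
    clear * - hA
    induction A with
    | nil => exact ⟨[], by simp, by simp [wprod]⟩
    | cons p A ih =>
      obtain ⟨B, hB, e⟩ := ih (fun q hq => hA q (List.mem_cons_of_mem _ hq))
      refine ⟨B ++ [(0, p.2⁻¹), (-p.1, 1)], ?_, ?_⟩
      · intro q hq
        simp only [List.mem_append, List.mem_cons, List.not_mem_nil, or_false] at hq
        rcases hq with hq | rfl | rfl
        · exact hB q hq
        · exact G.inv_mem (hA p (by simp))
        · exact G.one_mem
      · rw [wprod_append, ← e, wprod_cons]
        simp [wprod, mul_assoc]

lemma fp_reduced (G : Subgroup (Perm ℕ)) (hG : IsFinitelyPeriodicGroup G) (h : Perm ℕ)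
    (hmin : ∀ p, (∀ g ∈ G, p ≤ g p) ∨ (∀ k : ℤ, p ≤ (h ^ k) p))
    (hfree : ∀ (k : ℤ) p, (h ^ k) p = p → k = 0)
    (L : List (ℤ × Perm ℕ)) (hL : ∀ p ∈ L, p.2 ∈ G) (hne : L ≠ [])
    (hred : ∀ p ∈ L, p.1 ≠ 0 ∧ p.2 ≠ 1) : IsFinitelyPeriodic (wprod h L) := by
  have hfix : ∀ g ∈ G, g ≠ 1 → {x | g x = x}.Finite := by
    intro g hg h1
    obtain ⟨P, hP, H⟩ := fp_finite (hG g hg h1)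
    refine hP.subset fun x hx => H x ?_
    refine (Set.finite_singleton x).subset ?_
    rintro _ ⟨i, rfl⟩
    exact Perm.zpow_apply_eq_self_of_apply_eq_self hx i
  set w := wprod h L with hw
  let q : ℕ → Perm ℕ := fun i => wprod h (L.drop i)
  have hq : ∀ i (hi : i < L.length) x, q i x = (h ^ L[i].1) (L[i].2 (q (i+1) x)) := by
    intro i hi x
    simp only [q]
    rw [List.drop_eq_getElem_cons hi, wprod_cons]
    rfl
  have hq0 : q 0 = w := rfl
  have hqm : q L.length = 1 := by
    simp only [q, List.drop_length]
    rfl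
  have hlen : 0 < L.length := List.length_pos_iff.2 hne
  refine fp_of_finite (⋃ i : Fin L.length, q (i+1) ⁻¹' {x | L[i].2 x = x}) ?_ ?_
  · refine Set.finite_iUnion fun i => ?_
    exact (hfix _ (hL _ (List.getElem_mem _)) (hred _ (List.getElem_mem _)).2).preimage
      (q (i+1)).injective.injOn
  intro x0 hfin
  by_contra hcon
  push Not at hcon
  set T := Set.range fun i : ℤ => (w ^ i) x0 with hT
  have hnf : ∀ i (hi : i < L.length), ∀ x ∈ T, L[i].2 (q (i+1) x) ≠ q (i+1) x := by
    rintro i hi _ ⟨j, rfl⟩ e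
    apply hcon j
    exact Set.mem_iUnion.2 ⟨⟨i, hi⟩, e⟩
  have hTw : ∀ x ∈ T, w x ∈ T := by
    rintro _ ⟨j, rfl⟩
    exact ⟨1 + j, by simp [zpow_add]⟩
  have hTw' : ∀ x ∈ T, ∃ y ∈ T, w y = x := by
    rintro _ ⟨j, rfl⟩
    exact ⟨_, ⟨-1 + j, rfl⟩, by simp [zpow_add]⟩
  let V : Set ℕ := ⋃ i : Fin L.length,
    ((fun x => q (i+1) x) '' T ∪ (fun x => L[i].2 (q (i+1) x)) '' T)
  have hV : V.Finite := Set.finite_iUnion fun i => (hfin.image _).union (hfin.image _)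
  have hV1 : ∀ i (hi : i < L.length), ∀ x ∈ T, q (i+1) x ∈ V := fun i hi x hx =>
    Set.mem_iUnion.2 ⟨⟨i, hi⟩, Or.inl ⟨x, hx, rfl⟩⟩
  have hV2 : ∀ i (hi : i < L.length), ∀ x ∈ T, L[i].2 (q (i+1) x) ∈ V := fun i hi x hx =>
    Set.mem_iUnion.2 ⟨⟨i, hi⟩, Or.inr ⟨x, hx, rfl⟩⟩
  have hVT : ∀ x ∈ T, x ∈ V := by
    intro x hx
    have := hV1 (L.length - 1) (by omega) x hx
    rwa [Nat.sub_add_cancel hlen, hqm] at this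
  have hVne : V.Nonempty := ⟨x0, hVT _ ⟨0, by simp⟩⟩
  have hGn : ∀ p ∈ V, ∃ g ∈ G, g p ∈ V ∧ g p ≠ p := by
    intro p hp
    obtain ⟨⟨i, hi⟩, ⟨x, hx, rfl⟩ | ⟨x, hx, rfl⟩⟩ := Set.mem_iUnion.1 hp
    · exact ⟨_, hL _ (List.getElem_mem hi), hV2 i hi x hx, hnf i hi x hx⟩
    · refine ⟨_, G.inv_mem (hL _ (List.getElem_mem hi)), ?_, ?_⟩
      · simpa using hV1 i hi x hx
      · simpa using (hnf i hi x hx).symm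
  have hhn : ∀ p ∈ V, ∃ k : ℤ, k ≠ 0 ∧ (h ^ k) p ∈ V := by
    have back : ∀ i (hi : i < L.length), ∀ x ∈ T, ∃ k : ℤ, k ≠ 0 ∧ (h ^ k) (q i x) ∈ V := by
      intro i hi x hx
      refine ⟨-L[i].1, neg_ne_zero.2 (hred _ (List.getElem_mem hi)).1, ?_⟩
      rw [hq i hi x]
      simpa using hV2 i hi x hx
    intro p hp
    obtain ⟨⟨i, hi⟩, ⟨x, hx, rfl⟩ | ⟨x, hx, rfl⟩⟩ := Set.mem_iUnion.1 hp
    · by_cases hi' : i + 1 < L.length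
      · exact back _ hi' x hx
      · obtain ⟨y, hy, rfl⟩ := hTw' x hx
        have e : i + 1 = L.length := by omega
        have := back 0 hlen y hy
        simpa [e, hqm, hq0] using this
    · refine ⟨L[i].1, (hred _ (List.getElem_mem hi)).1, ?_⟩
      have : (h ^ L[i].1) (L[i].2 (q (i+1) x)) ∈ V := by
        rw [← hq i hi x]
        cases i with
        | zero => exact hVT _ (hTw x hx)
        | succ j => exact hV1 j (by omega) x hx
      exact this
  obtain ⟨M, hM, hmax⟩ := Set.exists_max_image V id hV hVne
  rcases hmin M with H | H
  · obtain ⟨g, hg, hgV, hgne⟩ := hGn M hM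
    exact hgne (le_antisymm (hmax _ hgV) (H g hg))
  · obtain ⟨k, hk, hkV⟩ := hhn M hM
    exact hk (hfree k M (le_antisymm (hmax _ hkV) (H k)))

lemma fp_word (G : Subgroup (Perm ℕ)) (hG : IsFinitelyPeriodicGroup G) (h : Perm ℕ)
    (hmin : ∀ p, (∀ g ∈ G, p ≤ g p) ∨ (∀ k : ℤ, p ≤ (h ^ k) p))
    (hfree : ∀ (k : ℤ) p, (h ^ k) p = p → k = 0) (n : ℕ) :
    ∀ (L : List (ℤ × Perm ℕ)) (_ : L.length = n) (_ : ∀ p ∈ L, p.2 ∈ G) (_ : wprod h L ≠ 1),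
      IsFinitelyPeriodic (wprod h L) := by
  induction n using Nat.strong_induction_on with
  | _ n ih =>
  intro L hn hL h1
  have hne : L ≠ [] := by rintro rfl; exact h1 rfl
  by_cases hred : ∀ p ∈ L, p.1 ≠ 0 ∧ p.2 ≠ 1
  · exact fp_reduced G hG h hmin hfree L hL hne hred
  push Not at hred
  obtain ⟨⟨k, g⟩, hp, hbad⟩ := hred
  obtain ⟨A, B, rfl⟩ := List.append_of_mem hp
  have hgG : g ∈ G := hL _ hp
  rw [wprod_append] at h1 ⊢
  apply fp_swap
  have h1' : wprod h ((k, g) :: B) * wprod h A ≠ 1 := by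
    intro e
    exact h1 (mul_eq_one_comm.1 e)
  rw [wprod_cons, mul_assoc, ← wprod_append] at h1' ⊢
  have hC : ∀ p ∈ B ++ A, p.2 ∈ G := by
    intro p hp
    apply hL
    simp only [List.mem_append, List.mem_cons] at hp ⊢
    tauto
  have hlen : (B ++ A).length + 1 = n := by
    rw [← hn]; simp only [List.length_append, List.length_cons]; omega
  generalize B ++ A = C at *
  clear h1 hL hp hn hne
  simp only at h1' hbad ⊢
  by_cases hk : k = 0
  · subst hk
    rcases List.eq_nil_or_concat C with rfl | ⟨C', ⟨k', g'⟩, rfl⟩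
    · simp only [zpow_zero, one_mul, wprod_nil, mul_one] at h1' ⊢
      exact hG g hgG h1'
    · rw [List.concat_eq_append] at *
      have e : wprod h (C' ++ [(k', g')]) * (h ^ (0:ℤ) * g) = wprod h (C' ++ [(k', g' * g)]) := by
        simp [wprod, mul_assoc]
      apply fp_swap
      rw [Ne, mul_eq_one_comm, ← Ne] at h1'
      rw [e] at h1' ⊢
      refine ih (C' ++ [(k', g' * g)]).length ?_ _ rfl ?_ h1'
      · rw [← hlen]; simp
      · intro p hp
        rcases List.mem_append.1 hp with hp | hp
        · exact hC p (List.mem_append_left _ hp)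
        · obtain rfl := List.mem_singleton.1 hp
          exact G.mul_mem (hC (k', g') (by simp)) hgG
  · obtain rfl := hbad hk
    cases C with
    | nil =>
      refine fp_of_finite ∅ Set.finite_empty ?_
      intro x hx
      exfalso
      refine Set.infinite_range_of_injective ?_ hx
      intro i j hij
      simp only [wprod_nil, mul_one, ← zpow_mul] at hij
      have : (h ^ (k * i - k * j)) x = x := by
        rw [show k * i - k * j = - (k * j) + k * i by ring, zpow_add, Perm.mul_apply, hij]
        simp
      have := hfree _ _ this
      have := mul_left_cancel₀ hk (sub_eq_zero.1 this)
      exact this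
    | cons p C =>
      have e : h ^ k * 1 * wprod h (p :: C) = wprod h ((k + p.1, p.2) :: C) := by
        simp [wprod, zpow_add, mul_assoc]
      rw [e] at h1' ⊢
      refine ih ((k + p.1, p.2) :: C).length ?_ _ rfl ?_ h1'
      · rw [← hlen]; simp
      · intro r hr
        rcases List.mem_cons.1 hr with rfl | hr
        · exact hC p (by simp)
        · exact hC r (by simp [hr])

lemma exists_shift (c : ℕ → ℕ) (hc : ∀ n, {m | c m = c n}.Infinite) :
    ∃ h : Perm ℕ, (∀ (k : ℤ) n, c ((h ^ k) n) = c n) ∧ ∀ (k : ℤ) n, (h ^ k) n = n → k = 0 := by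
  classical
  have hf : ∀ y : Set.range c, Nonempty ({x // Set.rangeFactorization c x = y} ≃ ℤ) := by
    rintro ⟨_, n, rfl⟩
    have : Infinite {x // Set.rangeFactorization c x = ⟨c n, n, rfl⟩} := by
      refine (Set.infinite_coe_iff (s := {x | Set.rangeFactorization c x = ⟨c n, n, rfl⟩})).2 ?_
      convert hc n using 3
      exact Subtype.ext_iff
    obtain ⟨d⟩ := nonempty_denumerable {x // Set.rangeFactorization c x = ⟨c n, n, rfl⟩}
    exact ⟨Denumerable.equiv₂ _ _⟩
  let e := fun y => Classical.choice (hf y)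
  let φ : ℕ ≃ Set.range c × ℤ := (Equiv.sigmaFiberEquiv (Set.rangeFactorization c)).symm.trans
    ((Equiv.sigmaCongrRight e).trans (Equiv.sigmaEquivProd _ _))
  have hφ : ∀ n, ((φ n).1 : ℕ) = c n := fun n => rfl
  let h : Perm ℕ := φ.trans ((Equiv.prodCongr (Equiv.refl _) (Equiv.addRight 1)).trans φ.symm)
  have h1 : ∀ n, φ (h n) = ((φ n).1, (φ n).2 + 1) := by intro n; simp [h, Prod.map]
  have h2 : ∀ n, φ (h⁻¹ n) = ((φ n).1, (φ n).2 - 1) := by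
    intro n
    have := h1 (h⁻¹ n)
    rw [show h (h⁻¹ n) = n from h.apply_symm_apply n] at this
    rw [this]; simp
  have h3 : ∀ (k : ℤ) n, φ ((h ^ k) n) = ((φ n).1, (φ n).2 + k) := by
    intro k
    induction k using Int.induction_on with
    | zero => intro n; simp
    | succ i ih => intro n; rw [zpow_add_one, Perm.mul_apply, ih, h1]; simp; ring
    | pred i ih => intro n; rw [zpow_sub_one, Perm.mul_apply, ih, h2]; simp; ring
  refine ⟨h, ?_, ?_⟩
  · intro k n
    rw [← hφ, h3, hφ]
  · intro k n e
    have := h3 k n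
    rw [e] at this
    have := congrArg Prod.snd this
    simp at this
    exact this

lemma exists_c (R : Set ℕ) (hR : R.Infinite) (h0 : 0 ∈ R) :
    ∃ c : ℕ → ℕ, (∀ n, c n ≤ n) ∧ (∀ n, n ∉ R → c n = n) ∧ ∀ n, {m | c m = c n}.Infinite := by
  classical
  have : Infinite R := hR.to_subtype
  obtain ⟨d⟩ := nonempty_denumerable R
  let e : R ≃ ℕ := Denumerable.eqv R
  have hF : ∃ F : ℕ → ℕ, ∀ y, {r | r ∈ R ∧ F r = y}.Infinite := by
    refine ⟨fun n => if hn : n ∈ R then (Nat.unpair (e ⟨n, hn⟩)).1 else 0, fun y => ?_⟩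
    refine Set.infinite_of_injective_forall_mem (f := fun t : ℕ => (e.symm (Nat.pair y t) : ℕ)) ?_ ?_
    · intro s t hst
      have := e.symm.injective (Subtype.ext hst)
      exact (Nat.pair_eq_pair.1 this).2
    · intro t
      refine ⟨(e.symm (Nat.pair y t)).2, ?_⟩
      simp
  obtain ⟨F, hF⟩ := hF
  let c : ℕ → ℕ := fun n => if n ∈ R then (if F n ≤ n ∧ F n ∉ R then F n else 0) else n
  have c1 : ∀ n, n ∉ R → c n = n := fun n hn => by simp [c, hn]
  refine ⟨c, ?_, c1, ?_⟩
  · intro n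
    simp only [c]
    split_ifs <;> grind
  · intro n
    have hy : c n = 0 ∨ c n ∉ R := by
      simp only [c]
      split_ifs <;> grind
    generalize c n = y at *
    rcases hy with rfl | hy
    · refine (hF 0).mono ?_
      rintro r ⟨hr, hr'⟩
      simp [c, hr, hr']
    · refine ((hF y).sdiff (Set.finite_lt_nat y)).mono ?_
      rintro r ⟨⟨hr, hr'⟩, hlt⟩
      have : y ≤ r := by simpa using hlt
      simp [c, hr, hr', this, hy]

theorem no_mpg_with_infinitely_many_orbits (G : Subgroup (Equiv.Perm ℕ))
    (hG : IsFinitelyPeriodicGroup G)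
    (horb : {s : Set ℕ | ∃ n : ℕ, s = MulAction.orbit G n}.Infinite) :
    (∃ h : Equiv.Perm ℕ, h ∉ G ∧
      IsFinitelyPeriodicGroup (Subgroup.closure ((G : Set (Equiv.Perm ℕ)) ∪ {h}))) ∧
    ¬ IsMaximalFinitelyPeriodic G := by
  have main : ∃ h : Equiv.Perm ℕ, h ∉ G ∧
      IsFinitelyPeriodicGroup (Subgroup.closure ((G : Set (Equiv.Perm ℕ)) ∪ {h})) := by
    let R : Set ℕ := {n | ∀ g ∈ G, n ≤ g n}
    have hR : R.Infinite := by
      intro hfin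
      refine horb ((hfin.image fun n => MulAction.orbit G n).subset ?_)
      rintro s ⟨n, rfl⟩
      have hne : (MulAction.orbit G n).Nonempty := ⟨n, MulAction.mem_orbit_self n⟩
      have hm := Nat.sInf_mem hne
      refine ⟨sInf (MulAction.orbit G n), ?_, MulAction.orbit_eq_iff.2 hm⟩
      intro g hg
      apply Nat.sInf_le
      have := MulAction.mem_orbit_of_mem_orbit (⟨g, hg⟩ : G) hm
      exact this
    obtain ⟨c, hc1, hc2, hc3⟩ := exists_c R hR (fun g _ => Nat.zero_le _)
    obtain ⟨h, hh1, hfree⟩ := exists_shift c hc3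
    have hmin : ∀ p, (∀ g ∈ G, p ≤ g p) ∨ (∀ k : ℤ, p ≤ (h ^ k) p) := by
      intro p
      by_cases hp : p ∈ R
      · exact Or.inl hp
      · right
        intro k
        calc p = c p := (hc2 p hp).symm
          _ = c ((h ^ k) p) := (hh1 k p).symm
          _ ≤ _ := hc1 _
    refine ⟨h, ?_, ?_⟩
    · intro hG'
      have hk : ∀ p (k : ℤ), p ≤ (h ^ k) p := by
        intro p k
        rcases hmin p with H | H
        · exact H _ (G.zpow_mem hG' k)
        · exact H k
      have a := hk 0 1
      have b := hk ((h ^ (1:ℤ)) 0) (-1)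
      have e : (h ^ (-1:ℤ)) ((h ^ (1:ℤ)) 0) = 0 := by simp
      rw [e] at b
      have := hfree 1 0 (le_antisymm b a)
      omega
    · intro w hw h1
      obtain ⟨L, hL, rfl⟩ := mem_closure_wprod G h w hw
      exact fp_word G hG h hmin hfree _ L rfl hL h1
  refine ⟨main, ?_⟩
  rintro ⟨_, hmax⟩
  obtain ⟨h, hh, hfp⟩ := main
  have := hmax _ hfp (fun g hg => Subgroup.subset_closure (Or.inl hg))
  apply hh
  rw [this]
  exact Subgroup.subset_closure (Or.inr rfl)
end
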